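/- arXiv:1301.4853 — 4 statements merged into one kernel-verified Lean document; each statement's English description precedes it below -/
import Mathlib

section
/- There is an absolute constant c₀ > 0 such that for every ε > 0 there is a constant C > 0 with the following property: for every prime p and all finite nonempty sets A, B ⊆ F_p with 0 ∉ A and 0 ∉ B, if |A| ≤ c₀·p^(1/2), then for every G ⊆ A × B one has |G|^55 ≤ C · (|A|^36 · |B|^37 · |A −_G B|^28 · |A /_G B|^8)^(1+ε). -/
section
open Finset
open scoped Pointwise

lemma petridis2 {H : Type*} [AddCommGroup H] [DecidableEq H] (A B : Finset H) (hA : A.Nonempty) :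
    ∃ C ⊆ A, C.Nonempty ∧
      (#(C + B + B) : ℝ) * (#A : ℝ) ^ 2 ≤ (#(A + B) : ℝ) ^ 2 * #C := by
  have hA' : A ∈ A.powerset.erase ∅ := mem_erase_of_ne_of_mem hA.ne_empty (mem_powerset_self _)
  obtain ⟨C, hC, hmin⟩ := exists_min_image (A.powerset.erase ∅)
    (fun U => (#(U + B) : ℝ) / #U) ⟨A, hA'⟩
  rw [mem_erase, mem_powerset, ← nonempty_iff_ne_empty] at hC
  obtain ⟨hCne, hCA⟩ := hC
  have hCpos : (0 : ℝ) < #C := by exact_mod_cast hCne.card_pos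
  have hApos : (0 : ℝ) < #A := by exact_mod_cast hA.card_pos
  have hpet : ∀ A' ⊆ C, #(C + B) * #A' ≤ #(A' + B) * #C := by
    intro A' hA'
    obtain rfl | hne := A'.eq_empty_or_nonempty
    · simp
    have hpos : (0 : ℝ) < #A' := by exact_mod_cast hne.card_pos
    have := hmin A' (mem_erase_of_ne_of_mem hne.ne_empty (mem_powerset.2 (hA'.trans hCA)))
    rw [div_le_div_iff₀ hCpos hpos] at this
    exact_mod_cast this
  have h1 := pluennecke_petridis_inequality_add (A := C) (B := B) B hpet
  rw [show B + C + B = C + B + B by rw [add_comm B C], add_comm B C] at h1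
  have h1' : (#(C + B + B) : ℝ) * #C ≤ #(C + B) * #(C + B) := by exact_mod_cast h1
  have h2 := hmin A hA'
  rw [div_le_div_iff₀ hCpos hApos] at h2
  refine ⟨C, hCA, hCne, ?_⟩
  have h3 : ((#(C + B) : ℝ) * #A) ^ 2 ≤ (#(A + B) * #C) ^ 2 := by gcongr
  refine le_of_mul_le_mul_right ?_ hCpos
  calc (#(C + B + B) : ℝ) * (#A : ℝ) ^ 2 * #C = (#(C + B + B) : ℝ) * #C * (#A : ℝ) ^ 2 := by ring
    _ ≤ #(C + B) * #(C + B) * (#A : ℝ) ^ 2 := by gcongr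
    _ = ((#(C + B) : ℝ) * #A) ^ 2 := by ring
    _ ≤ _ := h3
    _ = _ := by ring

lemma ruzsa_two {F : Type*} [AddCommGroup F] [DecidableEq F] (X U V : Finset F)
    (hX : X.Nonempty) (hU : U.Nonempty) (hV : V.Nonempty) :
    ∃ C ⊆ X, C.Nonempty ∧
      (#(C + U + V) : ℝ) * (#X : ℝ) ^ 2 ≤ 4 * #(X + U) * #(X + V) * #C := by
  set n1 := #(X + V) with hn1
  set n2 := #(X + U) with hn2
  have hp1 : 0 < n1 := (hX.add hV).card_pos
  have hp2 : 0 < n2 := (hX.add hU).card_pos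
  let T1 : Finset (ℤ × ℤ) := (range n1).image (fun i : ℕ => ((i : ℤ), (0 : ℤ)))
  let T2 : Finset (ℤ × ℤ) := (range n2).image (fun i : ℕ => ((0 : ℤ), (i : ℤ)))
  have hT1 : #T1 = n1 := by
    rw [card_image_of_injective, card_range]
    intro i j h; simpa using h
  have hT2 : #T2 = n2 := by
    rw [card_image_of_injective, card_range]
    intro i j h; simpa using h
  let B : Finset (F × ℤ × ℤ) := (U ×ˢ T1) ∪ (V ×ˢ T2)
  let Xh : Finset (F × ℤ × ℤ) := X ×ˢ {0}
  have hXh : Xh.Nonempty := hX.product (singleton_nonempty _)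
  have hXhc : #Xh = #X := by simp [Xh]
  obtain ⟨C, hCX, hCne, hC⟩ := petridis2 Xh B hXh
  have hB : #(Xh + B) ≤ 2 * (n1 * n2) := by
    have : Xh + B ⊆ ((X + U) ×ˢ T1) ∪ ((X + V) ×ˢ T2) := by
      intro z hz
      obtain ⟨x, hx, y, hy, rfl⟩ := mem_add.1 hz
      have hx' := mem_product.1 hx
      have hx0 : x.2 = 0 := by simpa using hx'.2
      rcases mem_union.1 hy with hy | hy
      · have hy' := mem_product.1 hy
        refine mem_union_left _ (mem_product.2 ⟨add_mem_add hx'.1 hy'.1, ?_⟩)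
        simpa [hx0] using hy'.2
      · have hy' := mem_product.1 hy
        refine mem_union_right _ (mem_product.2 ⟨add_mem_add hx'.1 hy'.1, ?_⟩)
        simpa [hx0] using hy'.2
    refine (card_le_card this).trans ((card_union_le _ _).trans ?_)
    rw [card_product, card_product, hT1, hT2, ← hn1, ← hn2]
    nlinarith
  let C0 : Finset F := C.image Prod.fst
  have hCmem : ∀ c ∈ C, c.1 ∈ X ∧ c.2 = 0 := by
    intro c hc
    have := mem_product.1 (hCX hc)
    exact ⟨this.1, by simpa using this.2⟩
  have hC0 : #C0 = #C := by
    refine card_image_of_injOn ?_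
    intro x hx y hy hxy
    exact Prod.ext hxy ((hCmem x hx).2.trans (hCmem y hy).2.symm)
  have hbig : #(C0 + U + V) * (n1 * n2) ≤ #(C + B + B) := by
    have hsub : ((C0 + U + V) ×ˢ (range n1 ×ˢ range n2)).image
        (fun t => (t.1, ((t.2.1 : ℤ), (t.2.2 : ℤ)))) ⊆ C + B + B := by
      intro z hz
      obtain ⟨⟨s, i, j⟩, ht, rfl⟩ := mem_image.1 hz
      simp only [mem_product, mem_range] at ht
      obtain ⟨hs, hi, hj⟩ := ht
      obtain ⟨w, hw, v, hv, rfl⟩ := mem_add.1 hs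
      obtain ⟨c, hc, u, hu, rfl⟩ := mem_add.1 hw
      obtain ⟨c', hc', rfl⟩ := mem_image.1 hc
      refine mem_add.2 ⟨c' + (u, ((i : ℤ), 0)), add_mem_add hc' ?_, (v, (0, (j : ℤ))), ?_, ?_⟩
      · exact mem_union_left _ (mem_product.2 ⟨hu, mem_image.2 ⟨i, mem_range.2 hi, rfl⟩⟩)
      · exact mem_union_right _ (mem_product.2 ⟨hv, mem_image.2 ⟨j, mem_range.2 hj, rfl⟩⟩)
      · ext <;> simp [(hCmem c' hc').2]
    have := card_le_card hsub
    rw [card_image_of_injective, card_product, card_product, card_range, card_range] at this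
    · exact this
    · rintro ⟨s, i, j⟩ ⟨s', i', j'⟩ h
      simpa using h
  refine ⟨C0, ?_, hCne.image _, ?_⟩
  · intro x hx
    obtain ⟨c, hc, rfl⟩ := mem_image.1 hx
    exact (hCmem c hc).1
  · have hb : (#(C0 + U + V) : ℝ) * (n1 * n2) ≤ #(C + B + B) := by exact_mod_cast hbig
    have hB' : (#(Xh + B) : ℝ) ≤ 2 * (n1 * n2) := by exact_mod_cast hB
    have hp1' : (0 : ℝ) < n1 := by exact_mod_cast hp1
    have hp2' : (0 : ℝ) < n2 := by exact_mod_cast hp2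
    rw [hC0]
    rw [hXhc] at hC
    refine le_of_mul_le_mul_right ?_ (mul_pos hp1' hp2')
    calc (#(C0 + U + V) : ℝ) * (#X : ℝ) ^ 2 * (n1 * n2)
        = (#(C0 + U + V) : ℝ) * (n1 * n2) * (#X : ℝ) ^ 2 := by ring
      _ ≤ #(C + B + B) * (#X : ℝ) ^ 2 := by gcongr
      _ ≤ _ := hC
      _ ≤ (2 * (n1 * n2)) ^ 2 * #C := by gcongr
      _ = _ := by ring

/-- Averaging step of dependent random choice. -/
lemma drc {β : Type*} (B : Finset β) (n e : β → ℝ) (m δ : ℝ) (hB : B.Nonempty) (hm : 0 < m)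
    (hδ : 0 < δ) (hn : ∀ b ∈ B, 0 ≤ n b) (he : ∀ b ∈ B, 0 ≤ e b) (hsum : ∑ b ∈ B, n b = m)
    (hbad : ∑ b ∈ B, e b ≤ δ * m ^ 2 / #B) :
    ∃ b ∈ B, m / (2 * #B) ≤ n b ∧ e b ≤ 2 * δ * n b ^ 2 := by
  have hBp : (0 : ℝ) < #B := by exact_mod_cast hB.card_pos
  have hcs : m ^ 2 / #B ≤ ∑ b ∈ B, n b ^ 2 := by
    rw [div_le_iff₀ hBp, ← hsum, mul_comm]
    exact sq_sum_le_card_mul_sum_sq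
  have hs : ∑ b ∈ B, m ^ 2 / (2 * (#B : ℝ) ^ 2) ≤ ∑ b ∈ B, (n b ^ 2 - e b / (2 * δ)) := by
    rw [sum_const, nsmul_eq_mul, sum_sub_distrib, ← sum_div]
    have h1 : (∑ b ∈ B, e b) / (2 * δ) ≤ (m ^ 2 / #B) / 2 := by
      rw [div_le_iff₀ (by positivity)]
      refine hbad.trans (le_of_eq ?_)
      field_simp
    have h2 : (#B : ℝ) * (m ^ 2 / (2 * (#B : ℝ) ^ 2)) = (m ^ 2 / #B) / 2 := by
      field_simp
    rw [h2]; linarith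
  obtain ⟨b, hb, hle⟩ := exists_le_of_sum_le hB hs
  have he' := he b hb
  have hn' := hn b hb
  refine ⟨b, hb, ?_, ?_⟩
  · refine le_of_sq_le_sq ?_ hn' |> id
    have : 0 ≤ e b / (2 * δ) := by positivity
    have h4 : (m / (2 * #B)) ^ 2 ≤ m ^ 2 / (2 * (#B : ℝ) ^ 2) := by
      rw [div_pow, mul_pow]
      gcongr
      norm_num
    linarith
  · have : 0 ≤ m ^ 2 / (2 * (#B : ℝ) ^ 2) := by positivity
    have h5 : e b / (2 * δ) ≤ n b ^ 2 := by linarith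
    rw [div_le_iff₀ (by positivity)] at h5
    linarith

/-- Markov pruning. -/
lemma prune {υ : Type*} (Y : Finset υ) (f : υ → ℝ) (κ : ℝ) (hκ : 0 < κ)
    (hf : ∀ u ∈ Y, 0 ≤ f u) (h : ∑ u ∈ Y, f u ≤ κ * (#Y : ℝ) ^ 2) :
    (#Y : ℝ) / 2 ≤ #{u ∈ Y | f u ≤ 2 * κ * #Y} := by
  obtain rfl | hY := Y.eq_empty_or_nonempty
  · simp
  have hYp : (0 : ℝ) < #Y := by exact_mod_cast hY.card_pos
  have hsplit := card_filter_add_card_filter_not (s := Y) (fun u => f u ≤ 2 * κ * #Y)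
  have hsplit' : (#{u ∈ Y | f u ≤ 2 * κ * #Y} : ℝ) + #{u ∈ Y | ¬ f u ≤ 2 * κ * #Y} = #Y := by
    exact_mod_cast hsplit
  have h1 : (#{u ∈ Y | ¬ f u ≤ 2 * κ * #Y} : ℝ) * (2 * κ * #Y) ≤ κ * (#Y : ℝ) ^ 2 := by
    refine le_trans ?_ h
    rw [← nsmul_eq_mul]
    refine (card_nsmul_le_sum _ f _ ?_).trans
      (sum_le_sum_of_subset_of_nonneg (filter_subset _ _) fun i hi _ => hf i hi)
    intro u hu
    exact (not_le.1 (mem_filter.1 hu).2).le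
  have h2 : (#{u ∈ Y | ¬ f u ≤ 2 * κ * #Y} : ℝ) ≤ #Y / 2 := by
    refine le_of_mul_le_mul_right (h1.trans (le_of_eq ?_)) (by positivity : (0 : ℝ) < 2 * κ * #Y)
    ring
  linarith

/-- Greedy covering. -/
lemma cover {F : Type*} [AddCommGroup F] [DecidableEq F] (Y P D : Finset F) (τ η : ℝ)
    (hτ : 0 < τ) (hη : 0 < η) (hY : Y.Nonempty) (hD : D.Nonempty) (Z : Finset F)
    (hZ : ∀ y ∈ Z, τ ≤ #{z ∈ P | y - z ∈ D}) (hZY : Z ⊆ Y) :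
    ∃ S : Finset F, (#S : ℝ) ≤ #D / (η * τ) ∧ (#(Z \ (S + P)) : ℝ) ≤ η * #Y := by
  have hYp : (0 : ℝ) < #Y := by exact_mod_cast hY.card_pos
  have hDp : (0 : ℝ) < #D := by exact_mod_cast hD.card_pos
  set t : ℝ := η * #Y * τ / #D with ht
  have htp : 0 < t := by positivity
  let 𝒮 := D.powerset.filter (fun S => (#S : ℝ) * t ≤ #(Z ∩ (S + P)))
  have hne : 𝒮.Nonempty := ⟨∅, by simp [𝒮]⟩
  obtain ⟨S, hS, hmax⟩ := exists_max_image 𝒮 card hne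
  simp only [𝒮, mem_filter, mem_powerset] at hS hmax
  obtain ⟨hSD, hS⟩ := hS
  refine ⟨S, ?_, ?_⟩
  · have : (#S : ℝ) * t ≤ #Y := hS.trans (by exact_mod_cast card_le_card (inter_subset_left.trans hZY))
    rw [← le_div_iff₀ htp] at this
    refine this.trans (le_of_eq ?_)
    rw [ht]; field_simp
  · by_contra hcon
    push Not at hcon
    set W := Z \ (S + P) with hW
    -- count pairs
    have hpairs : (#W : ℝ) * τ ≤ ∑ s ∈ D, (#{y ∈ W | y - s ∈ P} : ℝ) := by
      have h1 : (#W : ℝ) * τ ≤ ∑ y ∈ W, (#{z ∈ P | y - z ∈ D} : ℝ) := by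
        rw [← nsmul_eq_mul]
        exact card_nsmul_le_sum _ _ _ fun y hy => hZ y (mem_sdiff.1 hy).1
      have h2 : ∑ y ∈ W, (#{z ∈ P | y - z ∈ D} : ℝ) = ∑ y ∈ W, (#{s ∈ D | y - s ∈ P} : ℝ) := by
        refine sum_congr rfl fun y _ => ?_
        congr 1
        refine card_bij' (fun z _ => y - z) (fun s _ => y - s) ?_ ?_ ?_ ?_ <;> simp +contextual
      rw [h2] at h1
      refine h1.trans (le_of_eq ?_)
      have := sum_card_bipartiteAbove_eq_sum_card_bipartiteBelow (s := W) (t := D)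
        (fun y s => y - s ∈ P)
      simp only [bipartiteAbove, bipartiteBelow] at this
      exact_mod_cast this
    have hlt : ∑ s ∈ D, t ≤ ∑ s ∈ D, (#{y ∈ W | y - s ∈ P} : ℝ) := by
      refine le_trans ?_ hpairs
      rw [sum_const, nsmul_eq_mul, ht]
      have : (#D : ℝ) * (η * #Y * τ / #D) = η * #Y * τ := by field_simp
      rw [this]; gcongr
    obtain ⟨s, hs, hle⟩ := exists_le_of_sum_le hD hlt
    have hdisj : Disjoint (Z ∩ (S + P)) {y ∈ W | y - s ∈ P} := by
      rw [disjoint_left]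
      intro y hy hy'
      exact (mem_sdiff.1 (mem_filter.1 hy').1).2 (mem_inter.1 hy).2
    have hsub : (Z ∩ (S + P)) ∪ {y ∈ W | y - s ∈ P} ⊆ Z ∩ (insert s S + P) := by
      intro y hy
      rcases mem_union.1 hy with hy | hy
      · exact mem_inter.2 ⟨(mem_inter.1 hy).1,
          add_subset_add_right (subset_insert _ _) (mem_inter.1 hy).2⟩
      · have := mem_filter.1 hy
        refine mem_inter.2 ⟨(mem_sdiff.1 this.1).1, mem_add.2 ⟨s, mem_insert_self _ _, y - s,
          this.2, by abel⟩⟩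
    have hsS : s ∉ S := by
      intro hsS
      have hpos : (0 : ℝ) < #{y ∈ W | y - s ∈ P} := htp.trans_le hle
      have hpos' : 0 < #{y ∈ W | y - s ∈ P} := by exact_mod_cast hpos
      obtain ⟨y, hy⟩ := card_pos.1 hpos'
      have := mem_filter.1 hy
      exact (mem_sdiff.1 this.1).2 (mem_add.2 ⟨s, hsS, y - s, this.2, by abel⟩)
    have hc := card_le_card hsub
    rw [card_union_of_disjoint hdisj] at hc
    have hc' : (#(Z ∩ (S + P)) : ℝ) + #{y ∈ W | y - s ∈ P} ≤ #(Z ∩ (insert s S + P)) := by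
      exact_mod_cast hc
    have := hmax (insert s S) ⟨insert_subset hs hSD, by
      rw [card_insert_of_notMem hsS]; push_cast; linarith⟩
    rw [card_insert_of_notMem hsS] at this
    omega

lemma bad_sum {β υ ν : Type*} (B : Finset β) (U : Finset υ) (V : Finset ν)
    (RU : β → υ → Prop) (RV : β → ν → Prop) (bad : υ → ν → Prop) (τ : υ → ℝ)
    [∀ b u, Decidable (RU b u)] [∀ b v, Decidable (RV b v)] [∀ u v, Decidable (bad u v)]
    (hτ : ∀ u ∈ U, 0 ≤ τ u)
    (h : ∀ u ∈ U, ∀ v ∈ V, bad u v → (#{b ∈ B | RU b u ∧ RV b v} : ℝ) ≤ τ u) :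
    ∑ b ∈ B, ∑ u ∈ U with RU b u, (#{v ∈ V | RV b v ∧ bad u v} : ℝ) ≤ #V * ∑ u ∈ U, τ u := by
  have h1 : ∑ b ∈ B, ∑ u ∈ U with RU b u, (#{v ∈ V | RV b v ∧ bad u v} : ℝ)
      = ∑ u ∈ U, ∑ v ∈ V, (if bad u v then (#{b ∈ B | RU b u ∧ RV b v} : ℝ) else 0) := by
    have e1 : ∀ b ∈ B, ∑ u ∈ U with RU b u, (#{v ∈ V | RV b v ∧ bad u v} : ℝ)
        = ∑ u ∈ U, ∑ v ∈ V, (if RU b u ∧ RV b v ∧ bad u v then (1 : ℝ) else 0) := by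
      intro b _
      rw [sum_filter]
      refine sum_congr rfl fun u _ => ?_
      split_ifs with hu
      · simp [hu]
      · simp [hu]
    rw [sum_congr rfl e1, sum_comm]
    refine sum_congr rfl fun u _ => ?_
    rw [sum_comm]
    refine sum_congr rfl fun v _ => ?_
    split_ifs with hb
    · simp [hb]
    · simp [hb]
  rw [h1, mul_sum]
  refine sum_le_sum fun u hu => ?_
  rw [← nsmul_eq_mul]
  refine sum_le_card_nsmul _ _ _ fun v hv => ?_
  split_ifs with hb
  · exact h u hu v hv hb
  · exact hτ u hu

lemma sum_deg {α β : Type*} [DecidableEq α] [DecidableEq β] (A : Finset α) (B : Finset β) (G : Finset (α × β))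
    (hG : G ⊆ A ×ˢ B) : ∑ a ∈ A, #{b ∈ B | (a, b) ∈ G} = #G := by
  rw [← card_sigma]
  refine card_bij' (fun x _ => (x.1, x.2)) (fun x _ => ⟨x.1, x.2⟩) ?_ ?_ ?_ ?_
  · rintro ⟨a, b⟩ h; simp at h; exact h.2.2
  · rintro ⟨a, b⟩ h
    have := mem_product.1 (hG h)
    simp_all
  · simp
  · simp

set_option maxHeartbeats 1000000 in
open Classical in
/-- Balog–Szemerédi–Gowers type lemma (Bourgain–Garaev form). -/
lemma bg_lemma {F : Type*} [AddCommGroup F] [DecidableEq F] (A B : Finset F)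
    (hB : B.Nonempty) (hA : A.Nonempty) (G : Finset (F × F)) (hG : G ⊆ A ×ˢ B) (hGne : G.Nonempty) :
    ∃ A' ⊆ A, (#G : ℝ) / (8 * #B) ≤ #A' ∧
      (∀ a ∈ A', (#G : ℝ) / (2 * #A) ≤ #{b ∈ B | (a, b) ∈ G}) ∧
      (#(A' - A') : ℝ) * (#G : ℝ) ^ 5 ≤
        32768 * (#(G.image fun x => x.1 - x.2) : ℝ) ^ 4 * (#A : ℝ) ^ 4 * (#B : ℝ) ^ 3 := by
  set D := G.image fun x => x.1 - x.2 with hD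
  set g : ℝ := ((#G : ℕ) : ℝ) with hg
  set a : ℝ := ((#A : ℕ) : ℝ) with ha
  set b : ℝ := ((#B : ℕ) : ℝ) with hb
  have hgp : 0 < g := by rw [hg]; exact_mod_cast hGne.card_pos
  have hap : 0 < a := by rw [ha]; exact_mod_cast hA.card_pos
  have hbp : 0 < b := by rw [hb]; exact_mod_cast hB.card_pos
  set A1 := {x ∈ A | g / (2 * a) ≤ #{y ∈ B | (x, y) ∈ G}} with hA1
  set m : ℝ := ∑ x ∈ A1, (#{y ∈ B | (x, y) ∈ G} : ℝ) with hm
  have hA1A : A1 ⊆ A := filter_subset _ _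
  have hA1c : (#A1 : ℝ) ≤ a := by rw [ha]; exact_mod_cast card_le_card hA1A
  have hmg : g / 2 ≤ m := by
    have h1 : (g : ℝ) = ∑ x ∈ A, (#{y ∈ B | (x, y) ∈ G} : ℝ) := by
      rw [hg]; exact_mod_cast (sum_deg A B G hG).symm
    rw [← sum_filter_add_sum_filter_not A (fun x => g / (2 * a) ≤ #{y ∈ B | (x, y) ∈ G})] at h1
    have h2 : ∑ x ∈ A with ¬ (g / (2 * a) ≤ #{y ∈ B | (x, y) ∈ G}), (#{y ∈ B | (x, y) ∈ G} : ℝ)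
        ≤ a * (g / (2 * a)) := by
      refine (sum_le_card_nsmul _ _ (g / (2 * a)) ?_).trans ?_
      · intro x hx; exact (not_le.1 (mem_filter.1 hx).2).le
      · rw [nsmul_eq_mul]
        gcongr
        rw [ha]; exact_mod_cast card_le_card (filter_subset _ _)
    have h3 : a * (g / (2 * a)) = g / 2 := by field_simp
    rw [h3] at h2
    have h4 : m = ∑ x ∈ A with (g / (2 * a) ≤ #{y ∈ B | (x, y) ∈ G}), (#{y ∈ B | (x, y) ∈ G} : ℝ) := rfl
    linarith
  clear_value m g a b
  have hmp : 0 < m := by linarith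
  let N : F → Finset F := fun y => {x ∈ A1 | (x, y) ∈ G}
  have hNsum : ∑ y ∈ B, (#(N y) : ℝ) = m := by
    have := sum_card_bipartiteAbove_eq_sum_card_bipartiteBelow (s := A1) (t := B)
      (fun x y => (x, y) ∈ G)
    simp only [bipartiteAbove, bipartiteBelow] at this
    rw [hm]; exact_mod_cast this.symm
  set τ : ℝ := (1 / 16) * m ^ 2 / (a ^ 2 * b) with hτ
  clear_value τ
  have hτp : 0 < τ := by rw [hτ]; positivity
  let cod : F → F → Finset F := fun x x' => {y ∈ B | (x, y) ∈ G ∧ (x', y) ∈ G}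
  have codsymm : ∀ x x', cod x x' = cod x' x := by
    intro x x'; exact filter_congr fun y _ => and_comm
  let bad : F → F → Prop := fun x x' => (#(cod x x') : ℝ) ≤ τ
  have hbs := bad_sum B A1 A1 (fun y x => (x, y) ∈ G) (fun y x => (x, y) ∈ G) bad (fun _ => τ)
    (fun _ _ => hτp.le) (fun u _ v _ h => h)
  obtain ⟨y0, hy0, hn0, he0⟩ := drc B (fun y => (#(N y) : ℝ))
    (fun y => ∑ u ∈ A1 with (u, y) ∈ G, (#{v ∈ A1 | (v, y) ∈ G ∧ bad u v} : ℝ)) m (1 / 16) hB hmp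
    (by norm_num) (fun _ _ => Nat.cast_nonneg _)
    (fun _ _ => sum_nonneg fun _ _ => Nat.cast_nonneg _) hNsum (by
      refine hbs.trans ?_
      rw [sum_const, nsmul_eq_mul]
      have : a * (a * τ) = (1 / 16) * m ^ 2 / b := by rw [hτ]; field_simp
      rw [← hb, ← this]
      gcongr)
  set Y := N y0 with hY
  have hpr := prune Y (fun u => (#{v ∈ A1 | (v, y0) ∈ G ∧ bad u v} : ℝ)) (1 / 8) (by norm_num)
    (fun _ _ => Nat.cast_nonneg _) (he0.trans (le_of_eq (by norm_num)))
  set Y' := {u ∈ Y | (#{v ∈ A1 | (v, y0) ∈ G ∧ bad u v} : ℝ) ≤ 2 * (1 / 8) * #Y} with hY'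
  have hYA1 : Y ⊆ A1 := filter_subset _ _
  have hYlow : g / (4 * b) ≤ #Y := by
    refine le_trans ?_ hn0
    rw [div_le_div_iff₀ (by positivity) (by positivity)]
    nlinarith
  refine ⟨Y', ((filter_subset _ _).trans hYA1).trans hA1A, ?_, ?_, ?_⟩
  · refine le_trans ?_ hpr
    have : g / (8 * b) = g / (4 * b) / 2 := by field_simp; norm_num
    rw [this]; gcongr
  · intro x hx
    exact (mem_filter.1 (hYA1 (filter_subset _ _ hx))).2
  · -- path counting
    have key : ∀ w ∈ Y' - Y', (#Y : ℝ) / 2 * τ ^ 2 ≤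
        #{d ∈ D ×ˢ D ×ˢ D ×ˢ D | d.1 - d.2.1 + d.2.2.1 - d.2.2.2 = w} := by
      intro w hw
      obtain ⟨x, hx, x', hx', rfl⟩ := mem_sub.1 hw
      let good := {v ∈ Y | ¬ bad x v ∧ ¬ bad x' v}
      have hgood : (#Y : ℝ) / 2 ≤ #good := by
        have hsub : Y ⊆ good ∪ ({v ∈ A1 | (v, y0) ∈ G ∧ bad x v} ∪
            {v ∈ A1 | (v, y0) ∈ G ∧ bad x' v}) := by
          intro v hv
          have hv' := mem_filter.1 hv
          simp only [good, mem_union, mem_filter]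
          tauto
        have h1 := (card_le_card hsub).trans (card_union_le _ _)
        have h2 := h1.trans (Nat.add_le_add_left (card_union_le _ _) _)
        have h3 : (#Y : ℝ) ≤ #good + (#{v ∈ A1 | (v, y0) ∈ G ∧ bad x v} +
            #{v ∈ A1 | (v, y0) ∈ G ∧ bad x' v}) := by exact_mod_cast h2
        have h4 := (mem_filter.1 hx).2
        have h5 := (mem_filter.1 hx').2
        linarith
      let T := good.sigma fun v => cod x v ×ˢ cod v x'
      have hT : (#Y : ℝ) / 2 * τ ^ 2 ≤ #T := by
        rw [card_sigma]
        push_cast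
        calc (#Y : ℝ) / 2 * τ ^ 2 ≤ #good * τ ^ 2 := by gcongr
          _ = #good • τ ^ 2 := by rw [nsmul_eq_mul]
          _ ≤ _ := by
            refine card_nsmul_le_sum _ _ _ fun v hv => ?_
            have hv' := (mem_filter.1 hv).2
            have h1 := (not_le.1 hv'.1).le
            have h2 := (not_le.1 hv'.2).le
            rw [card_product, Nat.cast_mul, codsymm v x', pow_two]
            gcongr
      refine hT.trans ?_
      have : #T ≤ #{d ∈ D ×ˢ D ×ˢ D ×ˢ D | d.1 - d.2.1 + d.2.2.1 - d.2.2.2 = x - x'} := by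
        refine card_le_card_of_injOn
          (fun t => (x - t.2.1, t.1 - t.2.1, t.1 - t.2.2, x' - t.2.2)) ?_ ?_
        · rintro ⟨v, y, z⟩ ht
          have ht' := mem_sigma.1 (mem_coe.1 ht)
          simp only [mem_product, cod, mem_filter] at ht'
          obtain ⟨_, ⟨_, h1, h2⟩, ⟨_, h3, h4⟩⟩ := ht'
          simp only [coe_filter, mem_product, Set.mem_ofPred_eq]
          refine ⟨⟨mem_image.2 ⟨_, h1, rfl⟩, mem_image.2 ⟨_, h2, rfl⟩, mem_image.2 ⟨_, h3, rfl⟩,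
            mem_image.2 ⟨_, h4, rfl⟩⟩, by abel⟩
        · rintro ⟨v, y, z⟩ _ ⟨v', y', z'⟩ _ h
          simp only [Prod.mk.injEq] at h
          obtain ⟨h1, h2, h3, h4⟩ := h
          have e1 : y = y' := by simpa using h1
          have e2 : z = z' := by simpa using h4
          subst e1 e2
          have e3 : v = v' := by simpa using h2
          subst e3; rfl
      exact_mod_cast this
    have hS : (#(Y' - Y') : ℝ) * ((#Y : ℝ) / 2 * τ ^ 2) ≤ (#D : ℝ) ^ 4 := by
      rw [← nsmul_eq_mul]
      refine (card_nsmul_le_sum _ _ _ key).trans ?_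
      have h1 := sum_card_fiberwise_eq_card_filter (D ×ˢ D ×ˢ D ×ˢ D) (Y' - Y')
        (fun d => d.1 - d.2.1 + d.2.2.1 - d.2.2.2)
      have h2 : ∑ w ∈ Y' - Y', #{d ∈ D ×ˢ D ×ˢ D ×ˢ D | d.1 - d.2.1 + d.2.2.1 - d.2.2.2 = w}
          ≤ #D ^ 4 := by
        rw [h1]
        refine (card_le_card (filter_subset _ _)).trans (le_of_eq ?_)
        simp only [card_product]; ring
      exact_mod_cast h2
    have hlow : g ^ 5 / (32768 * a ^ 4 * b ^ 3) ≤ (#Y : ℝ) / 2 * τ ^ 2 := by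
      have hτlow : g ^ 2 / (64 * a ^ 2 * b) ≤ τ := by
        rw [hτ, div_le_div_iff₀ (by positivity) (by positivity)]
        have : (g / 2) ^ 2 ≤ m ^ 2 := by gcongr
        have h6 : 0 ≤ a ^ 2 * b := by positivity
        nlinarith [mul_le_mul_of_nonneg_right this h6]
      calc g ^ 5 / (32768 * a ^ 4 * b ^ 3)
          = (g / (4 * b)) / 2 * (g ^ 2 / (64 * a ^ 2 * b)) ^ 2 := by field_simp; norm_num
        _ ≤ _ := by gcongr
    have h7 : (#(Y' - Y') : ℝ) * (g ^ 5 / (32768 * a ^ 4 * b ^ 3)) ≤ (#D : ℝ) ^ 4 :=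
      le_trans (by gcongr) hS
    rw [← mul_div_assoc, div_le_iff₀ (by positivity)] at h7
    linarith

lemma cs_image {α β : Type*} [DecidableEq α] [DecidableEq β] (s : Finset α) (f : α → β) :
    (#s : ℝ) ^ 2 ≤ #(s.image f) * #{t ∈ s ×ˢ s | f t.1 = f t.2} := by
  have h1 : (#s : ℝ) = ∑ w ∈ s.image f, (#{x ∈ s | f x = w} : ℝ) := by
    exact_mod_cast card_eq_sum_card_image f s
  have h2 : (#{t ∈ s ×ˢ s | f t.1 = f t.2} : ℝ) = ∑ w ∈ s.image f, (#{x ∈ s | f x = w} : ℝ) ^ 2 := by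
    have : #{t ∈ s ×ˢ s | f t.1 = f t.2} = ∑ w ∈ s.image f, #{x ∈ s | f x = w} ^ 2 := by
      rw [card_eq_sum_card_fiberwise (f := fun t : α × α => f t.1) (t := s.image f)]
      · refine sum_congr rfl fun w _ => ?_
        rw [pow_two, ← card_product]
        congr 1
        ext ⟨x, y⟩
        simp only [mem_filter, mem_product]
        constructor
        · rintro ⟨⟨⟨a, b⟩, c⟩, d⟩; exact ⟨⟨a, d⟩, b, c ▸ d⟩
        · rintro ⟨⟨a, b⟩, c, d⟩; exact ⟨⟨⟨a, c⟩, b.trans d.symm⟩, b⟩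
      · intro t ht
        have := (mem_product.1 (mem_filter.1 (mem_coe.1 ht)).1).1
        exact mem_coe.2 (mem_image_of_mem f this)
    exact_mod_cast this
  rw [h2, h1]
  exact sq_sum_le_card_mul_sum_sq

lemma energy_exists (p : ℕ) [Fact p.Prime] (Y : Finset (ZMod p)) (hp : (#Y : ℝ) ^ 2 ≤ p) :
    ∃ r : ZMod p, (#{t ∈ (Y ×ˢ Y) ×ˢ (Y ×ˢ Y) | t.1.1 + r * t.1.2 = t.2.1 + r * t.2.2} : ℝ) ≤
      2 * (#Y : ℝ) ^ 2 := by
  have hsum : ∑ r : ZMod p, #{t ∈ (Y ×ˢ Y) ×ˢ (Y ×ˢ Y) | t.1.1 + r * t.1.2 = t.2.1 + r * t.2.2}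
      ≤ p * #Y ^ 2 + #Y ^ 4 := by
    have := sum_card_bipartiteAbove_eq_sum_card_bipartiteBelow (s := (univ : Finset (ZMod p)))
      (t := (Y ×ˢ Y) ×ˢ (Y ×ˢ Y)) (fun r t => t.1.1 + r * t.1.2 = t.2.1 + r * t.2.2)
    simp only [bipartiteAbove, bipartiteBelow] at this
    rw [this]
    have hb : ∀ t ∈ (Y ×ˢ Y) ×ˢ (Y ×ˢ Y),
        #{r : ZMod p | t.1.1 + r * t.1.2 = t.2.1 + r * t.2.2} ≤ (if t.1 = t.2 then p else 0) + 1 := by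
      rintro ⟨⟨x, x'⟩, ⟨y, y'⟩⟩ _
      split_ifs with h
      · refine (card_le_univ _).trans ?_
        simp [ZMod.card]
      · rw [zero_add, card_le_one_iff]
        intro r r' hr hr'
        simp only [mem_filter, mem_univ, true_and] at hr hr'
        by_contra hne
        have h1 : (r - r') * (x' - y') = 0 := by linear_combination hr - hr'
        rcases mul_eq_zero.1 h1 with h2 | h2
        · exact hne (sub_eq_zero.1 h2)
        · have h3 := sub_eq_zero.1 h2
          subst h3
          have : x = y := by simpa using hr
          exact h (by simp [this])
    refine (sum_le_sum hb).trans ?_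
    rw [sum_add_distrib, ← sum_filter, sum_const, sum_const, smul_eq_mul, smul_eq_mul, mul_one]
    have h5 : #{t ∈ (Y ×ˢ Y) ×ˢ (Y ×ˢ Y) | t.1 = t.2} ≤ #Y ^ 2 := by
      rw [pow_two, ← card_product]
      refine card_le_card_of_injOn (fun t => t.1) ?_ ?_
      · intro t ht
        exact mem_coe.2 (mem_product.1 (mem_filter.1 (mem_coe.1 ht)).1).1
      · intro t ht t' ht' h
        have e1 := (mem_filter.1 (mem_coe.1 ht)).2
        have e2 := (mem_filter.1 (mem_coe.1 ht')).2
        exact Prod.ext h (e1.symm.trans (h.trans e2))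
    have h6 : #((Y ×ˢ Y) ×ˢ (Y ×ˢ Y)) = #Y ^ 4 := by simp only [card_product]; ring
    rw [h6, mul_comm]
    gcongr
  by_contra hcon
  push Not at hcon
  have h7 : ∑ r : ZMod p, (2 * (#Y : ℝ) ^ 2) < ∑ r : ZMod p,
      (#{t ∈ (Y ×ˢ Y) ×ˢ (Y ×ˢ Y) | t.1.1 + r * t.1.2 = t.2.1 + r * t.2.2} : ℝ) :=
    sum_lt_sum_of_nonempty univ_nonempty fun r _ => hcon r
  rw [sum_const, nsmul_eq_mul, card_univ, ZMod.card] at h7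
  have h8 : ∑ r : ZMod p,
      (#{t ∈ (Y ×ˢ Y) ×ˢ (Y ×ˢ Y) | t.1.1 + r * t.1.2 = t.2.1 + r * t.2.2} : ℝ)
      ≤ p * (#Y : ℝ) ^ 2 + (#Y : ℝ) ^ 4 := by exact_mod_cast hsum
  nlinarith [sq_nonneg (#Y : ℝ)]

lemma pivot (p : ℕ) [Fact p.Prime] (Y : Finset (ZMod p)) (hY : Y.Nonempty)
    (hp : (#Y : ℝ) ^ 2 ≤ p) :
    ∃ a ∈ Y, ∃ b ∈ Y, ∃ c ∈ Y, ∃ d ∈ Y, ∀ X ⊆ Y, ∀ X' ⊆ Y,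
      (#Y : ℝ) / 2 ≤ #X → (#Y : ℝ) / 2 ≤ #X' →
      (#Y : ℝ) ^ 3 ≤ 32 * #(Y - Y) *
        #((X ×ˢ X').image fun t => (c - d) * t.1 + (a - b) * t.2) := by
  have hYp : (0 : ℝ) < #Y := by exact_mod_cast hY.card_pos
  have hYY : (#Y : ℝ) ≤ #(Y - Y) := by
    exact_mod_cast card_le_card_sub_right hY
  by_cases hone : #Y ≤ 1
  · obtain ⟨y, hy⟩ := hY
    refine ⟨y, hy, y, hy, y, hy, y, hy, fun X hX X' hX' h1 h2 => ?_⟩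
    have hY1 : (#Y : ℝ) ≤ 1 := by exact_mod_cast hone
    have hXne : X.Nonempty := by
      rw [← card_pos]; have : (0 : ℝ) < #X := by linarith
      exact_mod_cast this
    have hXne' : X'.Nonempty := by
      rw [← card_pos]; have : (0 : ℝ) < #X' := by linarith
      exact_mod_cast this
    have h3 : (1 : ℝ) ≤ #((X ×ˢ X').image fun t => (y - y) * t.1 + (y - y) * t.2) := by
      exact_mod_cast ((hXne.product hXne').image _).card_pos
    have h4 : (1 : ℝ) ≤ #Y := by exact_mod_cast card_pos.2 ⟨y, hy⟩
    have h5 : (#Y : ℝ) ^ 3 ≤ 1 := pow_le_one₀ hYp.le hY1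
    nlinarith
  push Not at hone
  obtain ⟨u, hu, v, hv, huv⟩ := one_lt_card.1 hone
  let R : ZMod p → Prop := fun r => ∃ a ∈ Y, ∃ b ∈ Y, ∃ c ∈ Y, ∃ d ∈ Y, c ≠ d ∧ a - b = r * (c - d)
  by_cases hall : ∀ r, R r
  · obtain ⟨r, hr⟩ := energy_exists p Y hp
    obtain ⟨a, ha, b, hb, c, hc, d, hd, hcd, hrr⟩ := hall r
    refine ⟨a, ha, b, hb, c, hc, d, hd, fun X hX X' hX' h1 h2 => ?_⟩
    have hcs := cs_image (X ×ˢ X') (fun t => (c - d) * t.1 + (a - b) * t.2)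
    have hE : (#{t ∈ (X ×ˢ X') ×ˢ (X ×ˢ X') | (c - d) * t.1.1 + (a - b) * t.1.2 =
        (c - d) * t.2.1 + (a - b) * t.2.2} : ℝ) ≤ 2 * (#Y : ℝ) ^ 2 := by
      refine le_trans ?_ hr
      refine Nat.cast_le.2 (card_le_card ?_)
      intro t ht
      simp only [mem_filter, mem_product] at ht ⊢
      refine ⟨⟨⟨hX ht.1.1.1, hX' ht.1.1.2⟩, hX ht.1.2.1, hX' ht.1.2.2⟩, ?_⟩
      have := ht.2
      rw [hrr] at this
      refine mul_left_cancel₀ (sub_ne_zero.2 hcd) ?_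
      linear_combination this
    set I := #((X ×ˢ X').image fun t => (c - d) * t.1 + (a - b) * t.2) with hI
    have h3 : ((#Y : ℝ) ^ 2 / 4) ^ 2 ≤ I * (2 * (#Y : ℝ) ^ 2) := by
      refine le_trans ?_ (hcs.trans (by gcongr))
      rw [card_product, Nat.cast_mul]
      have : (#Y : ℝ) ^ 2 / 4 = (#Y / 2) * (#Y / 2) := by ring
      rw [this]
      gcongr
    have h4 : (#Y : ℝ) ^ 2 ≤ 32 * I := by
      have : (0 : ℝ) < (#Y : ℝ) ^ 2 := by positivity
      refine le_of_mul_le_mul_right ?_ this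
      nlinarith
    calc (#Y : ℝ) ^ 3 = (#Y : ℝ) * (#Y : ℝ) ^ 2 := by ring
      _ ≤ (#(Y - Y) : ℝ) * (32 * (I : ℝ)) := by gcongr
      _ = _ := by ring
  · have hex : ∃ r, R r ∧ ¬ R (r - 1) := by
      by_contra hcon
      push Not at hcon
      apply hall
      have h0 : R 0 := ⟨u, hu, u, hu, u, hu, v, hv, huv, by simp⟩
      have hn : ∀ n : ℕ, R (0 - (n : ZMod p)) := by
        intro n
        induction n with
        | zero => simpa using h0
        | succ n ih =>
          have := hcon _ ih
          convert this using 1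
          push_cast; ring
      intro r
      have := hn (-r).val
      rwa [ZMod.natCast_val, ZMod.cast_id', id, zero_sub, neg_neg] at this
    obtain ⟨r, ⟨a, ha, b, hb, c, hc, d, hd, hcd, hrr⟩, hnr⟩ := hex
    refine ⟨a, ha, b, hb, c, hc, d, hd, fun X hX X' hX' h1 h2 => ?_⟩
    have hXne : X.Nonempty := by
      rw [← card_pos]; have : (0 : ℝ) < #X := by linarith
      exact_mod_cast this
    have hXne' : X'.Nonempty := by
      rw [← card_pos]; have : (0 : ℝ) < #X' := by linarith
      exact_mod_cast this
    obtain ⟨C, hCX, hCne, hC⟩ := ruzsa_two X (-X') (X'.image (r * ·)) hXne hXne'.neg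
      (hXne'.image _)
    have hCp : (0 : ℝ) < #C := by exact_mod_cast hCne.card_pos
    set I := #((X ×ˢ X').image fun t => (c - d) * t.1 + (a - b) * t.2) with hI
    have hI1 : (#(X + X'.image (r * ·)) : ℝ) ≤ I := by
      refine Nat.cast_le.2 (card_le_card_of_injOn (fun z => (c - d) * z) ?_ ?_)
      · intro z hz
        obtain ⟨x, hx, w, hw, rfl⟩ := mem_add.1 (mem_coe.1 hz)
        obtain ⟨x', hx', rfl⟩ := mem_image.1 hw
        refine mem_coe.2 (mem_image.2 ⟨(x, x'), mem_product.2 ⟨hx, hx'⟩, ?_⟩)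
        simp only [hrr]; ring
      · intro z _ z' _ h
        exact mul_left_cancel₀ (sub_ne_zero.2 hcd) h
    have hS1 : (#(X + -X') : ℝ) ≤ #(Y - Y) := by
      rw [← sub_eq_add_neg]
      exact Nat.cast_le.2 (card_le_card (sub_subset_sub hX hX'))
    have hlow : (#C : ℝ) * #X' ≤ #(C + -X' + X'.image (r * ·)) := by
      rw [← Nat.cast_mul, ← card_product]
      refine Nat.cast_le.2 (card_le_card_of_injOn (fun t => t.1 + -t.2 + r * t.2) ?_ ?_)
      · intro t ht
        have ht' := mem_product.1 (mem_coe.1 ht)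
        exact mem_coe.2 (add_mem_add (add_mem_add ht'.1 (neg_mem_neg ht'.2))
          (mem_image_of_mem _ ht'.2))
      · rintro ⟨x, x'⟩ ht ⟨y, y'⟩ ht' h
        have k := mem_product.1 (mem_coe.1 ht)
        have k' := mem_product.1 (mem_coe.1 ht')
        simp only at h
        by_cases hxy : x' = y'
        · subst hxy
          have : x = y := by linear_combination h
          rw [this]
        · exfalso
          apply hnr
          refine ⟨x, hX (hCX k.1), y, hX (hCX k'.1), y', hX' k'.2, x', hX' k.2, Ne.symm hxy, ?_⟩
          linear_combination h
    have h3 : (#X' : ℝ) * (#X : ℝ) ^ 2 ≤ 4 * #(Y - Y) * I := by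
      refine le_of_mul_le_mul_right ?_ hCp
      calc (#X' : ℝ) * (#X : ℝ) ^ 2 * #C = #C * #X' * (#X : ℝ) ^ 2 := by ring
        _ ≤ #(C + -X' + X'.image (r * ·)) * (#X : ℝ) ^ 2 := by gcongr
        _ ≤ _ := hC
        _ ≤ 4 * #(Y - Y) * I * #C := by gcongr
    have h4 : (#Y : ℝ) / 2 * (#Y / 2) ^ 2 ≤ #X' * (#X : ℝ) ^ 2 := by gcongr
    nlinarith

lemma plu {F : Type*} [AddCommGroup F] [DecidableEq F] (A : Finset F) (hA : A.Nonempty) :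
    (#(2 • A - 2 • A) : ℝ) ≤ (#(A - A) : ℝ) ^ 4 / (#A : ℝ) ^ 3 := by
  have h := pluennecke_ruzsa_inequality_nsmul_sub_nsmul_sub hA A 2 2
  have h' : (#(2 • A - 2 • A) : ℝ) ≤ ((#(A - A) : ℝ) / #A) ^ 4 * #A := by
    have h2 := (NNRat.cast_le (K := ℝ)).2 h
    push_cast at h2

    exact h2
  refine h'.trans (le_of_eq ?_)
  have : (0 : ℝ) < #A := by exact_mod_cast hA.card_pos
  rw [div_pow]
  field_simp

/-- bound for the size of the pivoted sumset -/
lemma image_bound {F : Type*} [Field F] [DecidableEq F] (A X X' Sa Sb Sc Sd Pa Pb Pc Pd : Finset F)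
    (a b c d z0 : F)
    (ha : ∀ z ∈ Pa, ∃ w ∈ A, a * z = z0 * w) (hb : ∀ z ∈ Pb, ∃ w ∈ A, b * z = z0 * w)
    (hc : ∀ z ∈ Pc, ∃ w ∈ A, c * z = z0 * w) (hd : ∀ z ∈ Pd, ∃ w ∈ A, d * z = z0 * w)
    (hXc : X ⊆ Sc + Pc) (hXd : X ⊆ Sd + Pd) (hXa : X' ⊆ Sa + Pa) (hXb : X' ⊆ Sb + Pb) :
    #((X ×ˢ X').image fun t => (c - d) * t.1 + (a - b) * t.2) ≤
      #Sa * #Sb * #Sc * #Sd * #(2 • A - 2 • A) := by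
  have hsub : ((X ×ˢ X').image fun t => (c - d) * t.1 + (a - b) * t.2) ⊆
      ((Sa ×ˢ Sb ×ˢ Sc ×ˢ Sd) ×ˢ (2 • A - 2 • A)).image
        (fun t => (c * t.1.2.2.1 - d * t.1.2.2.2 + a * t.1.1 - b * t.1.2.1) + z0 * t.2) := by
    intro y hy
    obtain ⟨⟨x, x'⟩, ht, rfl⟩ := mem_image.1 hy
    obtain ⟨hx, hx'⟩ := mem_product.1 ht
    obtain ⟨sc, hsc, zc, hzc, ec⟩ := mem_add.1 (hXc hx)
    obtain ⟨sd, hsd, zd, hzd, ed⟩ := mem_add.1 (hXd hx)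
    obtain ⟨sa, hsa, za, hza, ea⟩ := mem_add.1 (hXa hx')
    obtain ⟨sb, hsb, zb, hzb, eb⟩ := mem_add.1 (hXb hx')
    obtain ⟨wa, hwa, fa⟩ := ha za hza
    obtain ⟨wb, hwb, fb⟩ := hb zb hzb
    obtain ⟨wc, hwc, fc⟩ := hc zc hzc
    obtain ⟨wd, hwd, fd⟩ := hd zd hzd
    refine mem_image.2 ⟨((sa, sb, sc, sd), (wc + wa) - (wd + wb)), ?_, ?_⟩
    · simp only [mem_product]
      refine ⟨⟨hsa, hsb, hsc, hsd⟩, ?_⟩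
      rw [two_nsmul]
      exact sub_mem_sub (add_mem_add hwc hwa) (add_mem_add hwd hwb)
    · simp only at ec ed ea eb ⊢
      linear_combination c * ec - d * ed + a * ea - b * eb - fa + fb - fc + fd
  refine (card_le_card hsub).trans (card_image_le.trans (le_of_eq ?_))
  simp only [card_product]; ring

lemma cast_bound (W s t u v M : ℕ) (K L : ℝ) (h : W ≤ s * t * u * v * M) (hs : (s : ℝ) ≤ K)
    (ht : (t : ℝ) ≤ K) (hu : (u : ℝ) ≤ K) (hv : (v : ℝ) ≤ K) (hM : (M : ℝ) ≤ L) :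
    (W : ℝ) ≤ K * K * K * K * L := by
  have hK : 0 ≤ K := (Nat.cast_nonneg _).trans hs
  have h1 : (W : ℝ) ≤ s * t * u * v * M := by exact_mod_cast h
  refine h1.trans ?_
  gcongr

lemma final_num (g a b e q S m n K tauz y SY W : ℝ) (hgp : 0 < g) (hap : 0 < a) (hbp : 0 < b)
    (hep : 0 < e) (hqp : 0 < q) (hSp : 0 < S) (hmp : 0 < m) (hmg : g / 2 ≤ m)
    (hn0' : g / (4 * b) ≤ n) (htauz : tauz = (1 / 64) * (m / (a * b)) * (g / (2 * q)))
    (hK : K = e / (1 / 16 * tauz)) (hy : n / 2 ≤ y) (hSY0 : 0 ≤ SY) (hW0 : 0 ≤ W) (hSY : SY ≤ S)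
    (hib' : W ≤ K * K * K * K * (S ^ 4 / a ^ 3)) (hfin : y ^ 3 ≤ 32 * SY * W) :
    g ^ 11 ≤ 2 ^ 62 * S ^ 5 * e ^ 4 * q ^ 4 * a * b ^ 7 := by
  have htauzp : 0 < tauz := by rw [htauz]; positivity
  have hKp : 0 < K := by rw [hK]; positivity
  have hK2 : K ≤ 4096 * e * a * b * q / g ^ 2 := by
    rw [hK, htauz]
    have : e / (1 / 16 * (1 / 64 * (m / (a * b)) * (g / (2 * q)))) = 2048 * e * a * b * q / (g * m) := by
      field_simp; norm_num
    rw [this, div_le_div_iff₀ (by positivity) (by positivity)]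
    have h9 : g * (g / 2) ≤ g * m := by gcongr
    have h10 : 0 ≤ e * a * b * q := by positivity
    nlinarith [mul_le_mul_of_nonneg_left h9 h10]
  have h11 : (g / (8 * b)) ^ 3 ≤ 32 * S * ((4096 * e * a * b * q / g ^ 2) ^ 4 * (S ^ 4 / a ^ 3)) := by
    have h12 : g / (8 * b) ≤ y := by
      refine le_trans ?_ hy
      have : g / (8 * b) = g / (4 * b) / 2 := by field_simp; norm_num
      rw [this]; gcongr
    calc (g / (8 * b)) ^ 3 ≤ y ^ 3 := by gcongr
      _ ≤ _ := hfin
      _ ≤ 32 * S * (K * K * K * K * (S ^ 4 / a ^ 3)) := by gcongr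
      _ = 32 * S * (K ^ 4 * (S ^ 4 / a ^ 3)) := by ring
      _ ≤ _ := by gcongr
  have h13 : (g / (8 * b)) ^ 3 = g ^ 11 / (512 * b ^ 3 * g ^ 8) := by field_simp; norm_num
  have h14 : 32 * S * ((4096 * e * a * b * q / g ^ 2) ^ 4 * (S ^ 4 / a ^ 3)) =
      (2 ^ 62 * S ^ 5 * e ^ 4 * q ^ 4 * a * b ^ 7) / (512 * b ^ 3 * g ^ 8) := by
    field_simp; norm_num
  rw [h13, h14] at h11
  exact (div_le_div_iff_of_pos_right (by positivity)).1 h11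

set_option maxHeartbeats 1000000 in
open Classical in
lemma mainstep (p : ℕ) [Fact p.Prime] (A B : Finset (ZMod p)) (hA : A.Nonempty) (hB : B.Nonempty)
    (h0 : (0 : ZMod p) ∉ B) (hAp : (#A : ℝ) ^ 2 ≤ p) (G : Finset (ZMod p × ZMod p))
    (hG : G ⊆ A ×ˢ B) (hGne : G.Nonempty) :
    (#G : ℝ) ^ 11 ≤ 2 ^ 62 * (#(A - A) : ℝ) ^ 5 * (#(G.image fun x => x.1 - x.2) : ℝ) ^ 4 *
      (#(G.image fun x => x.1 / x.2) : ℝ) ^ 4 * #A * (#B : ℝ) ^ 7 := by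
  set D := G.image fun x => x.1 - x.2 with hD
  set Ξ := G.image fun x => x.1 / x.2 with hΞ
  obtain ⟨g, hg⟩ : ∃ g : ℝ, g = #G := ⟨_, rfl⟩
  obtain ⟨a, ha⟩ : ∃ g : ℝ, g = #A := ⟨_, rfl⟩
  obtain ⟨b, hb⟩ : ∃ g : ℝ, g = #B := ⟨_, rfl⟩
  obtain ⟨q, hq⟩ : ∃ g : ℝ, g = #Ξ := ⟨_, rfl⟩
  obtain ⟨S, hS⟩ : ∃ g : ℝ, g = #(A - A) := ⟨_, rfl⟩
  obtain ⟨e, he⟩ : ∃ g : ℝ, g = #D := ⟨_, rfl⟩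
  rw [← hg, ← ha, ← hb, ← hq, ← hS, ← he]
  have hgp : 0 < g := by rw [hg]; exact_mod_cast hGne.card_pos
  have hap : 0 < a := by rw [ha]; exact_mod_cast hA.card_pos
  have hbp : 0 < b := by rw [hb]; exact_mod_cast hB.card_pos
  have hqp : 0 < q := by rw [hq]; exact_mod_cast (hGne.image _).card_pos
  have hep : 0 < e := by rw [he]; exact_mod_cast (hGne.image _).card_pos
  have hSp : 0 < S := by rw [hS]; exact_mod_cast (hA.sub hA).card_pos
  have hBne : ∀ z ∈ B, z ≠ 0 := fun z hz h => h0 (h ▸ hz)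
  let P : ZMod p → Finset (ZMod p) := fun ξ => {z ∈ B | (ξ * z, z) ∈ G}
  have hPsum : ∑ ξ ∈ Ξ, (#(P ξ) : ℝ) = g := by
    have h1 := card_eq_sum_card_image (fun x : ZMod p × ZMod p => x.1 / x.2) G
    rw [hg, h1, Nat.cast_sum]
    refine sum_congr rfl fun ξ _ => ?_
    congr 1
    refine card_bij' (fun z _ => (ξ * z, z)) (fun x _ => x.2) ?_ ?_ ?_ ?_
    · intro z hz
      obtain ⟨hz1, hz2⟩ := mem_filter.1 hz
      exact mem_filter.2 ⟨hz2, mul_div_cancel_right₀ _ (hBne z hz1)⟩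
    · rintro ⟨x, z⟩ hx
      obtain ⟨hx1, hx2⟩ := mem_filter.1 hx
      have hz := (mem_product.1 (hG hx1)).2
      simp only at hx2 hz
      refine mem_filter.2 ⟨hz, ?_⟩
      simp only
      rw [← hx2, div_mul_cancel₀ _ (hBne z hz)]; exact hx1
    · intro z hz; rfl
    · rintro ⟨x, z⟩ hx
      obtain ⟨hx1, hx2⟩ := mem_filter.1 hx
      have hz := (mem_product.1 (hG hx1)).2
      simp only at hx2 hz
      simp only
      rw [← hx2, div_mul_cancel₀ _ (hBne z hz)]
  set Ξ1 := {ξ ∈ Ξ | g / (2 * q) ≤ #(P ξ)} with hΞ1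
  obtain ⟨m, hm⟩ : ∃ m : ℝ, m = ∑ ξ ∈ Ξ1, (#(P ξ) : ℝ) := ⟨_, rfl⟩
  have hmg : g / 2 ≤ m := by
    have h1 := hPsum
    rw [← sum_filter_add_sum_filter_not Ξ (fun ξ => g / (2 * q) ≤ #(P ξ)), ← hΞ1, ← hm] at h1
    have h2 : ∑ ξ ∈ Ξ with ¬ (g / (2 * q) ≤ #(P ξ)), (#(P ξ) : ℝ) ≤ q * (g / (2 * q)) := by
      refine (sum_le_card_nsmul _ _ (g / (2 * q)) ?_).trans ?_
      · intro x hx; exact (not_le.1 (mem_filter.1 hx).2).le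
      · rw [nsmul_eq_mul]
        gcongr
        rw [hq]; exact_mod_cast card_le_card (filter_subset _ _)
    have h3 : q * (g / (2 * q)) = g / 2 := by field_simp
    linarith
  have hmp : 0 < m := by linarith
  let NU : ZMod p → Finset (ZMod p) := fun z => {ξ ∈ Ξ1 | (ξ * z, z) ∈ G}
  have hNsum : ∑ z ∈ B, (#(NU z) : ℝ) = m := by
    have := sum_card_bipartiteAbove_eq_sum_card_bipartiteBelow (s := Ξ1) (t := B)
      (fun ξ z => (ξ * z, z) ∈ G)
    simp only [bipartiteAbove, bipartiteBelow] at this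
    rw [hm]; exact_mod_cast this.symm
  let τ : ZMod p → ℝ := fun ξ => (1 / 64) * (m / (a * b)) * #(P ξ)
  have hτn : ∀ ξ, 0 ≤ τ ξ := fun ξ => by
    have : 0 ≤ (1 / 64) * (m / (a * b)) := by positivity
    exact mul_nonneg this (Nat.cast_nonneg _)
  let bad : ZMod p → ZMod p → Prop := fun ξ x =>
    (#{z ∈ B | (ξ * z, z) ∈ G ∧ ((x, z) ∈ G ∧ x / z ∈ Ξ1)} : ℝ) ≤ τ ξ
  have hbs := bad_sum B Ξ1 A (fun z ξ => (ξ * z, z) ∈ G) (fun z x => (x, z) ∈ G ∧ x / z ∈ Ξ1) bad τ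
    (fun ξ _ => hτn ξ) (fun u _ v _ h => h)
  obtain ⟨z0, hz0, hn0, he0⟩ := drc B (fun z => (#(NU z) : ℝ))
    (fun z => ∑ ξ ∈ Ξ1 with (ξ * z, z) ∈ G,
      (#{x ∈ A | ((x, z) ∈ G ∧ x / z ∈ Ξ1) ∧ bad ξ x} : ℝ)) m (1 / 64) hB hmp
    (by norm_num) (fun _ _ => Nat.cast_nonneg _)
    (fun _ _ => sum_nonneg fun _ _ => Nat.cast_nonneg _) hNsum (by
      refine hbs.trans (le_of_eq ?_)
      simp only [τ]
      rw [← mul_sum, ← hm, ← ha, ← hb]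
      field_simp)
  have hz0ne : z0 ≠ 0 := hBne z0 hz0
  set N := NU z0 with hN
  obtain ⟨n, hn⟩ : ∃ n : ℝ, n = #N := ⟨_, rfl⟩
  have hpr := prune N (fun ξ => (#{x ∈ A | ((x, z0) ∈ G ∧ x / z0 ∈ Ξ1) ∧ bad ξ x} : ℝ)) (1 / 32)
    (by norm_num) (fun _ _ => Nat.cast_nonneg _) (he0.trans (le_of_eq (by norm_num)))
  set Ξ' := {ξ ∈ N | (#{x ∈ A | ((x, z0) ∈ G ∧ x / z0 ∈ Ξ1) ∧ bad ξ x} : ℝ) ≤ 2 * (1 / 32) * #N}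
    with hΞ'
  rw [← hn] at hpr
  have hn0' : g / (4 * b) ≤ n := by
    rw [hn]
    refine le_trans ?_ hn0
    rw [← hb, div_le_div_iff₀ (by positivity) (by positivity)]
    nlinarith
  have hnp : 0 < n := lt_of_lt_of_le (by positivity) hn0'
  let Y : Finset (ZMod p) := N.image (· * z0)
  let Y' : Finset (ZMod p) := Ξ'.image (· * z0)
  have hinj : Function.Injective (fun ξ : ZMod p => ξ * z0) := mul_left_injective₀ hz0ne
  have hYc : (#Y : ℝ) = n := by rw [hn, card_image_of_injective _ hinj]
  have hYc' : #Y' = #Ξ' := card_image_of_injective _ hinj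
  have hYY' : Y' ⊆ Y := image_subset_image (filter_subset _ _)
  have hYmem : ∀ x ∈ Y, x ∈ A ∧ (x, z0) ∈ G ∧ x / z0 ∈ Ξ1 := by
    intro x hx
    obtain ⟨ξ, hξ, rfl⟩ := mem_image.1 hx
    obtain ⟨h1, h2⟩ := mem_filter.1 hξ
    refine ⟨(mem_product.1 (hG h2)).1, h2, ?_⟩
    rw [mul_div_cancel_right₀ _ hz0ne]; exact h1
  have hYne : Y.Nonempty := by
    rw [← card_pos]; have : (0 : ℝ) < #Y := by rw [hYc]; exact hnp
    exact_mod_cast this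
  have hY'low : n / 2 ≤ #Y' := by rw [hYc']; exact hpr
  have hYne' : Y'.Nonempty := by
    rw [← card_pos]; have : (0 : ℝ) < #Y' := by linarith
    exact_mod_cast this
  have hY'A : Y' ⊆ A := fun x hx => (hYmem x (hYY' hx)).1
  have hY'p : (#Y' : ℝ) ^ 2 ≤ p := by
    refine le_trans ?_ hAp
    have : (#Y' : ℝ) ≤ #A := by exact_mod_cast card_le_card hY'A
    gcongr
  have hDne : D.Nonempty := hGne.image _
  obtain ⟨tauz, htauz⟩ : ∃ tauz : ℝ, tauz = (1 / 64) * (m / (a * b)) * (g / (2 * q)) := ⟨_, rfl⟩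
  have htauzp : 0 < tauz := by rw [htauz]; positivity
  have hcov : ∀ y ∈ Y', ∃ T Q : Finset (ZMod p), (#T : ℝ) ≤ e / (1 / 16 * tauz) ∧
      (∀ z ∈ Q, ∃ w ∈ A, y * z = z0 * w) ∧ (#(Y' \ (T + Q)) : ℝ) ≤ n / 8 := by
    intro y hy
    obtain ⟨ξ, hξ, rfl⟩ := mem_image.1 hy
    obtain ⟨hξN, hξbad⟩ := mem_filter.1 hξ
    obtain ⟨hξ1, hξG⟩ := mem_filter.1 hξN
    have hPlow := (mem_filter.1 hξ1).2
    have hττ : tauz ≤ τ ξ := by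
      rw [htauz]
      simp only [τ]
      gcongr
    obtain ⟨T, hT1, hT2⟩ := cover Y (P ξ) D tauz (1 / 16) htauzp (by norm_num) hYne hDne
      {x ∈ Y' | ¬ bad ξ x} (by
        intro x hx
        have hx' := (not_le.1 (mem_filter.1 hx).2).le
        refine hττ.trans (hx'.trans (Nat.cast_le.2 (card_le_card ?_)))
        intro z hz
        obtain ⟨h1, h2, h3, h4⟩ := mem_filter.1 hz
        exact mem_filter.2 ⟨mem_filter.2 ⟨h1, h2⟩, mem_image.2 ⟨_, h3, rfl⟩⟩)
      ((filter_subset _ _).trans hYY')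
    refine ⟨T, P ξ, by rw [he]; exact hT1, ?_, ?_⟩
    · intro z hz
      have := (mem_filter.1 hz).2
      exact ⟨ξ * z, (mem_product.1 (hG this)).1, by ring⟩
    · have hsub : Y' \ (T + P ξ) ⊆ ({x ∈ Y' | ¬ bad ξ x} \ (T + P ξ)) ∪
          {x ∈ A | ((x, z0) ∈ G ∧ x / z0 ∈ Ξ1) ∧ bad ξ x} := by
        intro x hx
        obtain ⟨h1, h2⟩ := mem_sdiff.1 hx
        by_cases hbx : bad ξ x
        · have := hYmem x (hYY' h1)
          exact mem_union_right _ (mem_filter.2 ⟨this.1, this.2, hbx⟩)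
        · exact mem_union_left _ (mem_sdiff.2 ⟨mem_filter.2 ⟨h1, hbx⟩, h2⟩)
      have h3 := (card_le_card hsub).trans (card_union_le _ _)
      have h4 : (#(Y' \ (T + P ξ)) : ℝ) ≤ #({x ∈ Y' | ¬ bad ξ x} \ (T + P ξ)) +
          #{x ∈ A | ((x, z0) ∈ G ∧ x / z0 ∈ Ξ1) ∧ bad ξ x} := by exact_mod_cast h3
      rw [← hn] at hξbad
      rw [hYc] at hT2
      linarith
  obtain ⟨ya, hya, yb, hyb, yc, hyc, yd, hyd, hpiv⟩ := pivot p Y' hYne' hY'p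
  obtain ⟨Ta, Pa, hTa, hPa, hUa⟩ := hcov ya hya
  obtain ⟨Tb, Pb, hTb, hPb, hUb⟩ := hcov yb hyb
  obtain ⟨Tc, Pc, hTc, hPc, hUc⟩ := hcov yc hyc
  obtain ⟨Td, Pd, hTd, hPd, hUd⟩ := hcov yd hyd
  have hhalf : ∀ M M' : Finset (ZMod p), (#(Y' \ M) : ℝ) ≤ n / 8 → (#(Y' \ M') : ℝ) ≤ n / 8 →
      (#Y' : ℝ) / 2 ≤ #(Y' ∩ M ∩ M') := by
    intro M M' h1 h2
    have hsub : Y' ⊆ (Y' ∩ M ∩ M') ∪ ((Y' \ M) ∪ (Y' \ M')) := by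
      intro x hx
      simp only [mem_union, mem_inter, mem_sdiff]
      tauto
    have h3 := (card_le_card hsub).trans
      ((card_union_le _ _).trans (Nat.add_le_add_left (card_union_le _ _) _))
    have h4 : (#Y' : ℝ) ≤ #(Y' ∩ M ∩ M') + (#(Y' \ M) + #(Y' \ M')) := by exact_mod_cast h3
    linarith
  have hfin := hpiv (Y' ∩ (Tc + Pc) ∩ (Td + Pd)) (inter_subset_left.trans inter_subset_left)
    (Y' ∩ (Ta + Pa) ∩ (Tb + Pb)) (inter_subset_left.trans inter_subset_left)
    (hhalf _ _ hUc hUd) (hhalf _ _ hUa hUb)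
  have hib := image_bound A (Y' ∩ (Tc + Pc) ∩ (Td + Pd)) (Y' ∩ (Ta + Pa) ∩ (Tb + Pb))
    Ta Tb Tc Td Pa Pb Pc Pd ya yb yc yd z0 hPa hPb hPc hPd
    (inter_subset_left.trans inter_subset_right) inter_subset_right
    (inter_subset_left.trans inter_subset_right) inter_subset_right
  have hpl := plu A hA
  rw [← hS, ← ha] at hpl
  have hSY : (#(Y' - Y') : ℝ) ≤ S := by
    rw [hS]; exact_mod_cast card_le_card (sub_subset_sub hY'A hY'A)
  obtain ⟨K, hK⟩ : ∃ K : ℝ, K = e / (1 / 16 * tauz) := ⟨_, rfl⟩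
  rw [← hK] at hTa hTb hTc hTd
  have hKp : 0 < K := by rw [hK]; positivity
  have hib' : (#(((Y' ∩ (Tc + Pc) ∩ (Td + Pd)) ×ˢ (Y' ∩ (Ta + Pa) ∩ (Tb + Pb))).image
      fun t => (yc - yd) * t.1 + (ya - yb) * t.2) : ℝ) ≤ K * K * K * K * (S ^ 4 / a ^ 3) := by
    exact cast_bound _ _ _ _ _ _ K _ hib hTa hTb hTc hTd hpl
  have h12 : n / 2 ≤ #Y' := hY'low
  exact final_num g a b e q S m n K tauz #Y' _ _ hgp hap hbp hep hqp hSp hmp hmg hn0' htauz hK hY'low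
    (Nat.cast_nonneg _) (Nat.cast_nonneg _) hSY hib' hfin

lemma combine_num (g a b D Q a' S g' : ℝ) (hg : 0 < g) (ha : 0 < a) (hb : 0 < b)
    (hD : 0 < D) (hQ : 0 < Q) (ha'p : 0 < a') (hSp : 0 ≤ S)
    (ha' : g / (8 * b) ≤ a') (hg' : a' * (g / (2 * a)) ≤ g')
    (hS : S * g ^ 5 ≤ 32768 * D ^ 4 * a ^ 4 * b ^ 3)
    (hmain : g' ^ 11 ≤ 2 ^ 62 * S ^ 5 * D ^ 4 * Q ^ 4 * a' * b ^ 7)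
    (h1 : g ≤ a * D) (h2 : g ≤ b * D) (h3 : g ≤ a * Q) (h4 : g ≤ b * Q) (h5 : g ≤ a * b) :
    g ^ 55 ≤ 2 ^ 178 * (a ^ 36 * b ^ 37 * D ^ 28 * Q ^ 8) := by
  have e1 : a' ^ 10 * g ^ 11 ≤ 2 ^ 73 * S ^ 5 * D ^ 4 * Q ^ 4 * a ^ 11 * b ^ 7 := by
    have h6 : (a' * (g / (2 * a))) ^ 11 ≤ 2 ^ 62 * S ^ 5 * D ^ 4 * Q ^ 4 * a' * b ^ 7 :=
      (pow_le_pow_left₀ (by positivity) hg' 11).trans hmain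
    have h7 : (a' * (g / (2 * a))) ^ 11 = (a' ^ 10 * g ^ 11) * a' / (2 ^ 11 * a ^ 11) := by
      field_simp; try norm_num
    rw [h7, div_le_iff₀ (by positivity)] at h6
    refine le_of_mul_le_mul_right (h6.trans (le_of_eq ?_)) ha'p
    ring
  have e2 : a' ^ 10 * g ^ 36 ≤ 2 ^ 148 * D ^ 24 * Q ^ 4 * a ^ 31 * b ^ 22 := by
    have h6 : (S * g ^ 5) ^ 5 ≤ (32768 * D ^ 4 * a ^ 4 * b ^ 3) ^ 5 :=
      pow_le_pow_left₀ (by positivity) hS 5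
    calc a' ^ 10 * g ^ 36 = (a' ^ 10 * g ^ 11) * g ^ 25 := by ring
      _ ≤ (2 ^ 73 * S ^ 5 * D ^ 4 * Q ^ 4 * a ^ 11 * b ^ 7) * g ^ 25 := by gcongr
      _ = (2 ^ 73 * D ^ 4 * Q ^ 4 * a ^ 11 * b ^ 7) * (S * g ^ 5) ^ 5 := by ring
      _ ≤ (2 ^ 73 * D ^ 4 * Q ^ 4 * a ^ 11 * b ^ 7) * (32768 * D ^ 4 * a ^ 4 * b ^ 3) ^ 5 := by
        gcongr
      _ = _ := by ring
  have e3 : g ^ 46 ≤ 2 ^ 178 * D ^ 24 * Q ^ 4 * a ^ 31 * b ^ 32 := by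
    have h6 : g ≤ 8 * b * a' := by
      rw [div_le_iff₀ (by positivity)] at ha'; linarith
    calc g ^ 46 = g ^ 10 * g ^ 36 := by ring
      _ ≤ (8 * b * a') ^ 10 * g ^ 36 := by gcongr
      _ = (8 * b) ^ 10 * (a' ^ 10 * g ^ 36) := by ring
      _ ≤ (8 * b) ^ 10 * (2 ^ 148 * D ^ 24 * Q ^ 4 * a ^ 31 * b ^ 22) := by gcongr
      _ = _ := by ring
  have e4 : g ^ 9 ≤ D ^ 4 * Q ^ 4 * a ^ 5 * b ^ 5 := by
    calc g ^ 9 = (g * g) * (g * g) * (g * g) * (g * g) * g := by ring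
      _ ≤ ((a * D) * (b * D)) * ((a * D) * (b * D)) * ((a * Q) * (b * Q)) * ((a * Q) * (b * Q)) *
          (a * b) := by gcongr
      _ = _ := by ring
  calc g ^ 55 = g ^ 46 * g ^ 9 := by ring
    _ ≤ (2 ^ 178 * D ^ 24 * Q ^ 4 * a ^ 31 * b ^ 32) * (D ^ 4 * Q ^ 4 * a ^ 5 * b ^ 5) := by gcongr
    _ = _ := by ring

lemma card_le_fst {α : Type*} [DecidableEq α] (A B : Finset α) (G : Finset (α × α))
    (hG : G ⊆ A ×ˢ B) (f : α × α → α)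
    (hf : ∀ x ∈ A, ∀ y ∈ B, ∀ z ∈ B, f (x, y) = f (x, z) → y = z) :
    (#G : ℝ) ≤ #A * (#(G.image f) : ℝ) := by
  have : #G ≤ #(A ×ˢ G.image f) := by
    refine card_le_card_of_injOn (fun x => (x.1, f x)) ?_ ?_
    · intro x hx
      exact mem_coe.2 (mem_product.2 ⟨(mem_product.1 (hG hx)).1, mem_image_of_mem f hx⟩)
    · rintro ⟨x, y⟩ h1 ⟨x', y'⟩ h2 h
      have h3 := mem_product.1 (hG h1)
      have h4 := mem_product.1 (hG h2)
      simp only [Prod.mk.injEq] at h h3 h4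
      obtain ⟨rfl, h⟩ := h
      rw [hf x h3.1 y h3.2 y' h4.2 h]
  rw [card_product] at this
  exact_mod_cast this

lemma card_le_snd {α : Type*} [DecidableEq α] (A B : Finset α) (G : Finset (α × α))
    (hG : G ⊆ A ×ˢ B) (f : α × α → α)
    (hf : ∀ y ∈ B, ∀ x ∈ A, ∀ z ∈ A, f (x, y) = f (z, y) → x = z) :
    (#G : ℝ) ≤ #B * (#(G.image f) : ℝ) := by
  have : #G ≤ #(B ×ˢ G.image f) := by
    refine card_le_card_of_injOn (fun x => (x.2, f x)) ?_ ?_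
    · intro x hx
      exact mem_coe.2 (mem_product.2 ⟨(mem_product.1 (hG hx)).2, mem_image_of_mem f hx⟩)
    · rintro ⟨x, y⟩ h1 ⟨x', y'⟩ h2 h
      have h3 := mem_product.1 (hG h1)
      have h4 := mem_product.1 (hG h2)
      simp only [Prod.mk.injEq] at h h3 h4
      obtain ⟨rfl, h⟩ := h
      rw [hf y h3.2 x h3.1 x' h4.1 h]
  rw [card_product] at this
  exact_mod_cast this

lemma combine (p : ℕ) [Fact p.Prime] (A B : Finset (ZMod p)) (hA : A.Nonempty) (hB : B.Nonempty)
    (hA0 : (0 : ZMod p) ∉ A) (h0 : (0 : ZMod p) ∉ B) (hAp : (#A : ℝ) ^ 2 ≤ p)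
    (G : Finset (ZMod p × ZMod p)) (hG : G ⊆ A ×ˢ B) (hGne : G.Nonempty) :
    (#G : ℝ) ^ 55 ≤ 2 ^ 178 * ((#A : ℝ) ^ 36 * (#B : ℝ) ^ 37 *
      (#(G.image fun x => x.1 - x.2) : ℝ) ^ 28 * (#(G.image fun x => x.1 / x.2) : ℝ) ^ 8) := by
  obtain ⟨A', hA'A, hA'c, hdeg, hS⟩ := bg_lemma A B hB hA G hG hGne
  have hgp : (0 : ℝ) < #G := by exact_mod_cast hGne.card_pos
  have hap : (0 : ℝ) < #A := by exact_mod_cast hA.card_pos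
  have hbp : (0 : ℝ) < #B := by exact_mod_cast hB.card_pos
  have hDp : (0 : ℝ) < #(G.image fun x => x.1 - x.2) := by exact_mod_cast (hGne.image _).card_pos
  have hQp : (0 : ℝ) < #(G.image fun x => x.1 / x.2) := by exact_mod_cast (hGne.image _).card_pos
  have ha'p : (0 : ℝ) < #A' := lt_of_lt_of_le (by positivity) hA'c
  have hA'ne : A'.Nonempty := by
    rw [← card_pos]; exact_mod_cast ha'p
  let G' := {x ∈ G | x.1 ∈ A'}
  have hG'G : G' ⊆ G := filter_subset _ _
  have hG'sub : G' ⊆ A' ×ˢ B := by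
    intro x hx
    obtain ⟨h1, h2⟩ := mem_filter.1 hx
    exact mem_product.2 ⟨h2, (mem_product.1 (hG h1)).2⟩
  have hg' : (#A' : ℝ) * ((#G : ℝ) / (2 * (#A : ℝ))) ≤ #G' := by
    have h1 := sum_deg A' B G' hG'sub
    have h2 : (#G' : ℝ) = ∑ a ∈ A', (#{b ∈ B | (a, b) ∈ G'} : ℝ) := by exact_mod_cast h1.symm
    rw [h2, ← nsmul_eq_mul]
    refine card_nsmul_le_sum _ _ _ fun x hx => ?_
    refine (hdeg x hx).trans (Nat.cast_le.2 (card_le_card ?_))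
    intro z hz
    obtain ⟨h3, h4⟩ := mem_filter.1 hz
    exact mem_filter.2 ⟨h3, mem_filter.2 ⟨h4, hx⟩⟩
  have hg'p : (0 : ℝ) < #G' := lt_of_lt_of_le (by positivity) hg'
  have hG'ne : G'.Nonempty := by
    rw [← card_pos]; exact_mod_cast hg'p
  have hA'p : (#A' : ℝ) ^ 2 ≤ p := by
    refine le_trans ?_ hAp
    have : (#A' : ℝ) ≤ #A := by exact_mod_cast card_le_card hA'A
    gcongr
  have hm := mainstep p A' B hA'ne hB h0 hA'p G' hG'sub hG'ne
  have hD' : (#(G'.image fun x => x.1 - x.2) : ℝ) ≤ #(G.image fun x => x.1 - x.2) := by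
    exact_mod_cast card_le_card (image_subset_image hG'G)
  have hQ' : (#(G'.image fun x => x.1 / x.2) : ℝ) ≤ #(G.image fun x => x.1 / x.2) := by
    exact_mod_cast card_le_card (image_subset_image hG'G)
  have hBne : ∀ z ∈ B, z ≠ 0 := fun z hz h => h0 (h ▸ hz)
  have hAne : ∀ z ∈ A, z ≠ 0 := fun z hz h => hA0 (h ▸ hz)
  refine combine_num _ _ _ _ _ _ _ _ hgp hap hbp hDp hQp ha'p (Nat.cast_nonneg _) hA'c hg' hS
    (hm.trans ?_) ?_ ?_ ?_ ?_ ?_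
  · gcongr
  · exact card_le_fst A B G hG _ fun x _ y _ z _ h => by simpa using h
  · exact card_le_snd A B G hG _ fun x _ y _ z _ h => by simpa using h
  · exact card_le_fst A B G hG _ fun x hx y hy z hz h => by
      have h1 := hAne x hx
      have h2 := hBne y hy
      have h3 := hBne z hz
      simp only at h
      rw [div_eq_div_iff h2 h3] at h
      exact (mul_left_cancel₀ h1 h).symm
  · exact card_le_snd A B G hG _ fun y hy x hx z hz h => by
      have h2 := hBne y hy
      simp only at h
      exact (div_left_inj' h2).1 h
  · have := card_le_card hG
    rw [card_product] at this
    exact_mod_cast this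

end

theorem stmt9 :
    ∃ c₀ : ℝ, 0 < c₀ ∧
      ∀ ε : ℝ, 0 < ε → ∃ C : ℝ, 0 < C ∧
        ∀ (p : ℕ) [Fact p.Prime],
          ∀ A B : Finset (ZMod p), A.Nonempty → B.Nonempty →
            (0 : ZMod p) ∉ A → (0 : ZMod p) ∉ B →
            (A.card : ℝ) ≤ c₀ * (p : ℝ) ^ ((1 : ℝ) / 2) →
            ∀ G ⊆ A ×ˢ B,
              (G.card : ℝ) ^ 55 ≤
                C * ((A.card : ℝ) ^ 36 * (B.card : ℝ) ^ 37 *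
                    ((G.image fun x => x.1 - x.2).card : ℝ) ^ 28 *
                    ((G.image fun x => x.1 / x.2).card : ℝ) ^ 8) ^ ((1 : ℝ) + ε) := by
  refine ⟨1, one_pos, fun ε hε => ⟨2 ^ 178, by positivity, ?_⟩⟩
  intro p _ A B hA hB hA0 hB0 hAp G hG
  obtain rfl | hGne := G.eq_empty_or_nonempty
  · rw [Finset.card_empty, Nat.cast_zero, zero_pow (by norm_num)]
    positivity
  have hAp2 : (A.card : ℝ) ^ 2 ≤ p := by
    rw [one_mul, ← Real.sqrt_eq_rpow] at hAp
    exact (Real.le_sqrt' (by exact_mod_cast hA.card_pos)).1 hAp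
  refine (combine p A B hA hB hA0 hB0 hAp2 G hG hGne).trans ?_
  refine mul_le_mul_of_nonneg_left ?_ (by positivity)
  refine Real.self_le_rpow_of_one_le ?_ (by linarith)
  have h1 : (1 : ℝ) ≤ A.card := by exact_mod_cast hA.card_pos
  have h2 : (1 : ℝ) ≤ B.card := by exact_mod_cast hB.card_pos
  have h3 : (1 : ℝ) ≤ (G.image fun x => x.1 - x.2).card := by
    exact_mod_cast (hGne.image _).card_pos
  have h4 : (1 : ℝ) ≤ (G.image fun x => x.1 / x.2).card := by
    exact_mod_cast (hGne.image _).card_pos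
  exact one_le_mul_of_one_le_of_one_le (one_le_mul_of_one_le_of_one_le
    (one_le_mul_of_one_le_of_one_le (one_le_pow₀ h1) (one_le_pow₀ h2)) (one_le_pow₀ h3))
    (one_le_pow₀ h4)
end

section
/- There is an absolute constant c₀ > 0 such that for every ε > 0 there is a constant C > 0 with the following property: for every prime p and all finite nonempty sets A, B ⊆ F_p with 0 ∉ A and 0 ∉ B, and every G ⊆ A × B, if |G| ≤ c₀·p^(1/2)·|B|, then |G|^67 ≤ C · (|A|^44 · |B|^45 · |A −_G B|^28 · |A /_G B|^16)^(1+ε). -/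
open scoped Pointwise
open Finset

lemma pl_diff {V : Type*} [AddCommGroup V] [DecidableEq V] (X Y Z : Finset V)
    (hX : X.Nonempty) (hY : Y.Nonempty) (hZ : Z.Nonempty) :
    ∃ X' ⊆ X, X'.Nonempty ∧
      (X' + Y + Z).card * X.card ^ 2 ≤ 4 * (X + Y).card * (X + Z).card * X'.card := by
  classical
  set t1 := (X + Z).card with ht1
  set t2 := (X + Y).card with ht2
  have t1p : 0 < t1 := (hX.add hZ).card_pos
  have t2p : 0 < t2 := (hX.add hY).card_pos
  let I1 : Finset ℤ := (range t1).image (fun i : ℕ => (i : ℤ))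
  let I2 : Finset ℤ := (range t2).image (fun i : ℕ => (i : ℤ))
  have hI1 : I1.card = t1 := by
    simp [I1, Finset.card_image_of_injective _ Nat.cast_injective]
  have hI2 : I2.card = t2 := by
    simp [I2, Finset.card_image_of_injective _ Nat.cast_injective]
  let W1 : Finset (V × ℤ × ℤ) := Y ×ˢ (I1 ×ˢ {0})
  let W2 : Finset (V × ℤ × ℤ) := Z ×ˢ (({0} : Finset ℤ) ×ˢ I2)
  let W := W1 ∪ W2
  let Xh : Finset (V × ℤ × ℤ) := X ×ˢ ({(0, 0)} : Finset (ℤ × ℤ))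
  have hXh : Xh.card = X.card := by simp [Xh]
  have hXhW : (Xh + W).card ≤ 2 * t1 * t2 := by
    have h1 : Xh + W ⊆ ((X + Y) ×ˢ (I1 ×ˢ ({0} : Finset ℤ))) ∪
        ((X + Z) ×ˢ (({0} : Finset ℤ) ×ˢ I2)) := by
      intro w hw
      obtain ⟨x, hx, y, hy, rfl⟩ := mem_add.1 hw
      obtain ⟨x1, x2, x3⟩ := x
      obtain ⟨y1, y2, y3⟩ := y
      simp only [Xh, W, W1, W2, mem_union, mem_product, mem_singleton, Prod.mk.injEq] at hx hy ⊢
      obtain ⟨hx1, rfl, rfl⟩ := hx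
      rcases hy with ⟨h1, h2, h3⟩ | ⟨h1, h2, h3⟩
      · left; exact ⟨add_mem_add hx1 h1, by simpa using h2, by simpa using h3⟩
      · right; exact ⟨add_mem_add hx1 h1, by simpa using h2, by simpa using h3⟩
    refine (card_le_card h1).trans ((card_union_le _ _).trans ?_)
    simp only [card_product, hI1, hI2, card_singleton, ← ht1, ← ht2]
    nlinarith
  have hXhne : Xh.Nonempty := by simpa [Xh] using hX
  obtain ⟨U, hU, hmin⟩ := Finset.exists_min_image (Xh.powerset.filter (·.Nonempty))
    (fun U => ((U + W).card : ℚ) / U.card) ⟨Xh, by simp [hXhne]⟩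
  simp only [mem_filter, mem_powerset] at hU hmin
  obtain ⟨hUX, hUne⟩ := hU
  have hUpos : 0 < U.card := hUne.card_pos
  have hmin' : ∀ U' ⊆ Xh, (U + W).card * U'.card ≤ (U' + W).card * U.card := by
    intro U' hU'
    rcases U'.eq_empty_or_nonempty with rfl | hne
    · simp
    · have := hmin U' ⟨hU', hne⟩
      have h2 : 0 < U'.card := hne.card_pos
      rw [div_le_div_iff₀ (by exact_mod_cast hUpos) (by exact_mod_cast h2)] at this
      exact_mod_cast this
  have hpet := Finset.pluennecke_petridis_inequality_add (A := U) (B := W) W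
    (fun A' hA' => hmin' A' (hA'.trans hUX))
  rw [add_comm W U] at hpet
  have hb := hmin' Xh subset_rfl
  rw [hXh] at hb
  have hinj : Set.InjOn Prod.fst (U : Set (V × ℤ × ℤ)) := by
    intro u hu v hv huv
    have h1 := hUX hu
    have h2 := hUX hv
    simp only [Xh, mem_product, mem_singleton] at h1 h2
    exact Prod.ext huv (h1.2.trans h2.2.symm)
  have hcard : (U.image Prod.fst).card = U.card := card_image_of_injOn hinj
  refine ⟨U.image Prod.fst, ?_, hUne.image _, ?_⟩
  · intro x hx
    obtain ⟨u, hu, rfl⟩ := mem_image.1 hx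
    have := hUX hu
    simp only [Xh, mem_product] at this
    exact this.1
  · rw [hcard]
    have hsub : (U.image Prod.fst + Y + Z) ×ˢ (I1 ×ˢ I2) ⊆ U + W + W := by
      rintro ⟨v, i, j⟩ hv
      simp only [mem_product] at hv
      obtain ⟨hv, hi, hj⟩ := hv
      obtain ⟨w, hw, z, hz, rfl⟩ := mem_add.1 hv
      obtain ⟨x, hx, y, hy, rfl⟩ := mem_add.1 hw
      obtain ⟨u, hu, rfl⟩ := mem_image.1 hx
      have h0 := hUX hu
      simp only [Xh, mem_product, mem_singleton] at h0
      have e : ((u.1 + y + z, i, j) : V × ℤ × ℤ) = u + (y, i, 0) + (z, 0, j) := by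
        obtain ⟨u1, u2⟩ := u
        simp only at h0
        obtain ⟨_, rfl⟩ := h0
        simp
      rw [e]
      refine add_mem_add (add_mem_add hu ?_) ?_
      · simp [W, W1, hy, hi]
      · simp [W, W2, hz, hj]
    have hc := card_le_card hsub
    simp only [card_product, hI1, hI2] at hc
    set P := (U.image Prod.fst + Y + Z).card
    set u := U.card
    set k := (U + W).card
    set n := X.card
    have h1 : k * n ≤ 2 * t1 * t2 * u := hb.trans (Nat.mul_le_mul_right _ hXhW)
    have h2 : P * (t1 * t2) * u ≤ k * k := (Nat.mul_le_mul_right _ hc).trans hpet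
    have h3 : (P * n ^ 2) * (t1 * t2 * u) ≤ (4 * t2 * t1 * u) * (t1 * t2 * u) := by
      calc (P * n ^ 2) * (t1 * t2 * u) = (P * (t1 * t2) * u) * n ^ 2 := by ring
        _ ≤ (k * k) * n ^ 2 := Nat.mul_le_mul_right _ h2
        _ = (k * n) * (k * n) := by ring
        _ ≤ (2 * t1 * t2 * u) * (2 * t1 * t2 * u) := Nat.mul_le_mul h1 h1
        _ = _ := by ring
    exact Nat.le_of_mul_le_mul_right h3 (by positivity)

/-- Cauchy–Schwarz for collisions. -/
lemma cs_image_s10 {S T : Type*} [DecidableEq S] [DecidableEq T] (s : Finset S) (f : S → T) :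
    s.card ^ 2 ≤ (s.image f).card * ((s ×ˢ s).filter (fun q => f q.1 = f q.2)).card := by
  have h1 : s.card = ∑ t ∈ s.image f, (s.filter (fun x => f x = t)).card :=
    card_eq_sum_card_fiberwise (fun x hx => mem_image_of_mem f hx)
  have h2 : ((s ×ˢ s).filter (fun q => f q.1 = f q.2)).card
      = ∑ t ∈ s.image f, (s.filter (fun x => f x = t)).card ^ 2 := by
    rw [card_eq_sum_card_fiberwise (f := fun q : S × S => f q.1) (t := s.image f)]
    · refine sum_congr rfl fun t ht => ?_
      rw [sq, ← card_product]
      congr 1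
      ext ⟨x, y⟩
      simp only [mem_filter, mem_product]
      constructor
      · rintro ⟨⟨⟨h1, h2⟩, h3⟩, h4⟩
        exact ⟨⟨h1, h4⟩, h2, h3 ▸ h4⟩
      · rintro ⟨⟨h1, h2⟩, h3, h4⟩
        exact ⟨⟨⟨h1, h3⟩, h2.trans h4.symm⟩, h2⟩
    · intro q hq
      simp only [coe_filter, mem_product, Set.mem_ofPred_eq] at hq
      exact mem_coe.2 (mem_image_of_mem f hq.1.1)
  rw [h2]
  nth_rw 1 [h1]
  exact sq_sum_le_card_mul_sum_sq

lemma core_subset {F : Type*} [Field F] [DecidableEq F] (A : Finset F) (hA : A.Nonempty)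
    (h0 : (0 : F) ∉ A) (h : ℝ)
    (hE : 2 * (A.card : ℝ) ^ 2 * h ≤ (((A ×ˢ A) ×ˢ (A ×ˢ A)).filter
      (fun q => q.1.1 / q.1.2 = q.2.1 / q.2.2)).card) :
    ∃ x0 ∈ A, ∃ C ⊆ A, C.Nonempty ∧ ∀ d ∈ C,
      h ≤ ((C.filter (fun u => d * u / x0 ∈ A)).card : ℝ) := by
  set Q := ((A ×ˢ A) ×ˢ (A ×ˢ A)).filter (fun q => q.1.1 / q.1.2 = q.2.1 / q.2.2) with hQ
  have hpig : ∃ x0 ∈ A, 2 * (A.card : ℝ) * h ≤ ((Q.filter (fun q => q.2.1 = x0)).card : ℝ) := by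
    by_contra! hcon
    have h1 : Q.card = ∑ x ∈ A, (Q.filter (fun q => q.2.1 = x)).card :=
      card_eq_sum_card_fiberwise (fun q hq => by
        simp only [hQ, coe_filter, mem_product, Set.mem_ofPred_eq] at hq
        exact mem_coe.2 hq.1.2.1)
    have h2 : (Q.card : ℝ) < ∑ x ∈ A, 2 * (A.card : ℝ) * h := by
      rw [h1]; push_cast
      exact sum_lt_sum_of_nonempty hA hcon
    rw [sum_const, nsmul_eq_mul] at h2
    nlinarith
  obtain ⟨x0, hx0, hp⟩ := hpig
  have hx00 : x0 ≠ 0 := fun e => h0 (e ▸ hx0)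
  refine ⟨x0, hx0, ?_⟩
  set ed : Finset F → Finset (F × F) :=
    fun S => (S ×ˢ S).filter (fun q => q.1 * q.2 / x0 ∈ A) with hed
  have hA0 : 2 * (A.card : ℝ) * h ≤ ((ed A).card : ℝ) := by
    refine hp.trans ?_
    norm_cast
    refine card_le_card_of_injOn (fun q => (q.1.1, q.2.2)) ?_ ?_
    · rintro ⟨⟨u, w⟩, ⟨x, v⟩⟩ hq
      simp only [hQ, coe_filter, mem_filter, mem_product, Set.mem_ofPred_eq] at hq
      obtain ⟨⟨⟨⟨hu, hw⟩, hx, hv⟩, e⟩, rfl⟩ := hq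
      simp only [hed, coe_filter, mem_product, Set.mem_ofPred_eq]
      refine ⟨⟨hu, hv⟩, ?_⟩
      have hw0 : w ≠ 0 := fun e => h0 (e ▸ hw)
      have hv0 : v ≠ 0 := fun e => h0 (e ▸ hv)
      rw [div_eq_div_iff hw0 hv0] at e
      rw [e, mul_div_cancel_left₀ _ hx00]
      exact hw
    · rintro ⟨⟨u, w⟩, ⟨x, v⟩⟩ hq ⟨⟨u', w'⟩, ⟨x', v'⟩⟩ hq' he
      simp only [hQ, coe_filter, mem_filter, mem_product, Set.mem_ofPred_eq] at hq hq'
      obtain ⟨⟨⟨⟨hu, hw⟩, hx, hv⟩, e⟩, rfl⟩ := hq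
      obtain ⟨⟨⟨⟨hu', hw'⟩, hx', hv'⟩, e'⟩, rfl⟩ := hq'
      simp only [Prod.mk.injEq] at he
      obtain ⟨rfl, rfl⟩ := he
      have hw0 : w ≠ 0 := fun e => h0 (e ▸ hw)
      have hw0' : w' ≠ 0 := fun e => h0 (e ▸ hw')
      have hv0 : v ≠ 0 := fun e => h0 (e ▸ hv)
      rw [div_eq_div_iff hw0 hv0] at e
      rw [div_eq_div_iff hw0' hv0] at e'
      have : w = w' := mul_left_cancel₀ hx00 (e.symm.trans e')
      simp [this]
  obtain ⟨C, hC, hmax⟩ := Finset.exists_max_image (A.powerset.filter (·.Nonempty))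
    (fun S => ((ed S).card : ℝ) - 2 * h * S.card) ⟨A, by simp [hA]⟩
  simp only [mem_filter, mem_powerset] at hC hmax
  refine ⟨C, hC.1, hC.2, fun d hd => ?_⟩
  have hCA := hmax A ⟨subset_rfl, hA⟩
  have hCd : ((ed (C.erase d)).card : ℝ) - 2 * h * (C.erase d).card
      ≤ ((ed C).card : ℝ) - 2 * h * C.card := by
    rcases (C.erase d).eq_empty_or_nonempty with he | hne
    · rw [he]
      simp only [hed, empty_product, filter_empty, card_empty, Nat.cast_zero]
      simp only [hed] at hCA hA0
      nlinarith
    · exact hmax _ ⟨(erase_subset _ _).trans hC.1, hne⟩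
  set J := C.filter (fun u => d * u / x0 ∈ A) with hJ
  have hsub : ed C ⊆ ed (C.erase d) ∪ (({d} : Finset F) ×ˢ J ∪ J ×ˢ {d}) := by
    rintro ⟨x, y⟩ hxy
    simp only [hed, mem_filter, mem_product] at hxy
    simp only [hed, hJ, mem_union, mem_filter, mem_product, mem_erase, mem_singleton]
    by_cases h1 : x = d
    · right; left; subst h1; exact ⟨rfl, hxy.1.2, hxy.2⟩
    · by_cases h2 : y = d
      · right; right; subst h2; exact ⟨⟨hxy.1.1, by rw [mul_comm]; exact hxy.2⟩, rfl⟩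
      · left; exact ⟨⟨⟨h1, hxy.1.1⟩, h2, hxy.1.2⟩, hxy.2⟩
  have hcard : (ed C).card ≤ (ed (C.erase d)).card + (J.card + J.card) := by
    refine (card_le_card hsub).trans ((card_union_le _ _).trans ?_)
    gcongr
    refine (card_union_le _ _).trans ?_
    simp
  have hcard' : ((ed C).card : ℝ) ≤ (ed (C.erase d)).card + (J.card + J.card) := by
    exact_mod_cast hcard
  have hce : ((C.erase d).card : ℝ) = C.card - 1 := by
    have := card_erase_add_one hd
    rw [← this]; push_cast; ring
  rw [hce] at hCd
  linarith

lemma card_smul_ne {F : Type*} [Field F] [DecidableEq F] (S : Finset F) {c : F} (hc : c ≠ 0) :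
    (c • S).card = S.card :=
  card_image_of_injective _ (fun _ _ hxy => mul_left_cancel₀ hc hxy)

lemma pivot_bound {F : Type*} [Field F] [DecidableEq F] (A C : Finset F) (h0 : (0 : F) ∉ A)
    (hCA : C ⊆ A) (x0 : F) (hx0 : x0 ∈ A) (h : ℝ) (hh : 0 ≤ h)
    (hC : ∀ d ∈ C, h ≤ ((C.filter (fun u => d * u / x0 ∈ A)).card : ℝ))
    {a b c d r : F} (ha : a ∈ C) (hc : c ∈ C) (hcd : c ≠ d)
    (hr : a - b = r * (c - d)) :
    (((C.filter (fun u => d * u / x0 ∈ A)) + r • (C.filter (fun u => b * u / x0 ∈ A))).card : ℝ)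
      * h ^ 2 ≤ ((A - A).card : ℝ) ^ 2 * ((2 • A - 2 • A).card : ℝ) := by
  have hx00 : x0 ≠ 0 := fun e => h0 (e ▸ hx0)
  have ha0 : a ≠ 0 := fun e => h0 (e ▸ hCA ha)
  have hc0 : c ≠ 0 := fun e => h0 (e ▸ hCA hc)
  set J : F → Finset F := fun d => C.filter (fun u => d * u / x0 ∈ A) with hJ
  have hJC : ∀ d, J d ⊆ C := fun d => filter_subset _ _
  have hJx : ∀ d, d • J d ⊆ x0 • A := by
    intro d y hy
    obtain ⟨u, hu, rfl⟩ := mem_smul_finset.1 hy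
    simp only [hJ, mem_filter] at hu
    refine mem_smul_finset.2 ⟨d * u / x0, hu.2, ?_⟩
    simp only [smul_eq_mul]; field_simp
  -- generic Ruzsa step
  have step : ∀ (e : F), e ∈ C → ∀ (K : Finset F), K ⊆ C → ∀ Z : Finset F,
      ((e • K + Z).card : ℝ) * h ≤ ((A - A).card : ℝ) * ((x0 • A + Z).card : ℝ) := by
    intro e he K hK Z
    have he0 : e ≠ 0 := fun e' => h0 (e' ▸ hCA he)
    have h1 := Finset.ruzsa_triangle_inequality_add_sub_add (e • K) (e • J e) Z
    have h2 : (e • J e - e • K).card ≤ (A - A).card := by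
      have : e • J e - e • K ⊆ e • (A - A) := by
        intro y hy
        obtain ⟨_, hu', _, hv', rfl⟩ := mem_sub.1 hy
        obtain ⟨u, hu, rfl⟩ := mem_smul_finset.1 hu'
        obtain ⟨v, hv, rfl⟩ := mem_smul_finset.1 hv'
        rw [← smul_sub]
        exact smul_mem_smul_finset (sub_mem_sub (hCA (hJC _ hu)) (hCA (hK hv)))
      exact (card_le_card this).trans (card_smul_ne _ he0).le
    have h3 : (e • J e + Z).card ≤ (x0 • A + Z).card :=
      card_le_card (add_subset_add_right (hJx e))
    rw [card_smul_ne _ he0] at h1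
    have h4 : ((J e).card : ℝ) * ((e • K + Z).card : ℝ)
        ≤ ((A - A).card : ℝ) * ((x0 • A + Z).card : ℝ) := by
      exact_mod_cast h1.trans (Nat.mul_le_mul h2 h3)
    have h5 := hC e he
    refine le_trans ?_ h4
    rw [mul_comm]
    exact mul_le_mul_of_nonneg_right h5 (by positivity)
  have hsub : (c - d) • (J d + r • J b) ⊆ c • J d + (a • J b + (-(x0 • A) + -(x0 • A))) := by
    intro y hy
    obtain ⟨w, hw, rfl⟩ := mem_smul_finset.1 hy
    obtain ⟨u, hu, _, hv', rfl⟩ := mem_add.1 hw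
    obtain ⟨v, hv, rfl⟩ := mem_smul_finset.1 hv'
    have e : (c - d) • (u + r • v) = c • u + (a • v + (-(d • u) + -(b • v))) := by
      simp only [smul_eq_mul]
      linear_combination (-v) * hr
    rw [e]
    refine add_mem_add (smul_mem_smul_finset hu) (add_mem_add (smul_mem_smul_finset hv)
      (add_mem_add ?_ ?_))
    · exact neg_mem_neg (hJx d (smul_mem_smul_finset hu))
    · exact neg_mem_neg (hJx b (smul_mem_smul_finset hv))
  have s0 : ((J d + r • J b).card : ℝ) ≤
      ((c • J d + (a • J b + (-(x0 • A) + -(x0 • A)))).card : ℝ) := by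
    rw [← card_smul_ne (J d + r • J b) (sub_ne_zero.2 hcd)]
    exact_mod_cast card_le_card hsub
  have s1 := step c hc (J d) (hJC d) (a • J b + (-(x0 • A) + -(x0 • A)))
  have s2 := step a ha (J b) (hJC b) (x0 • A + (-(x0 • A) + -(x0 • A)))
  have e1 : x0 • A + (a • J b + (-(x0 • A) + -(x0 • A)))
      = a • J b + (x0 • A + (-(x0 • A) + -(x0 • A))) := add_left_comm _ _ _
  rw [e1] at s1
  have e2 : x0 • A + (x0 • A + (-(x0 • A) + -(x0 • A))) ⊆ x0 • (2 • A - 2 • A) := by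
    intro y hy
    obtain ⟨y1, h1, y', hy', rfl⟩ := mem_add.1 hy
    obtain ⟨y2, h2, y'', hy'', rfl⟩ := mem_add.1 hy'
    obtain ⟨y3, h3, y4, h4, rfl⟩ := mem_add.1 hy''
    obtain ⟨z1, g1, rfl⟩ := mem_smul_finset.1 h1
    obtain ⟨z2, g2, rfl⟩ := mem_smul_finset.1 h2
    obtain ⟨z3, g3, e3⟩ := mem_smul_finset.1 (mem_neg'.1 h3)
    obtain ⟨z4, g4, e4⟩ := mem_smul_finset.1 (mem_neg'.1 h4)
    refine mem_smul_finset.2 ⟨(z1 + z2) - (z3 + z4), ?_, ?_⟩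
    · rw [two_nsmul]
      exact sub_mem_sub (add_mem_add g1 g2) (add_mem_add g3 g4)
    · simp only [smul_eq_mul] at e3 e4 ⊢
      linear_combination -e3 - e4
  have s3 : ((x0 • A + (x0 • A + (-(x0 • A) + -(x0 • A)))).card : ℝ)
      ≤ ((2 • A - 2 • A).card : ℝ) := by
    rw [← card_smul_ne (2 • A - 2 • A) hx00]
    exact_mod_cast card_le_card e2
  set D := ((A - A).card : ℝ)
  have hD : 0 ≤ D := by positivity
  calc ((J d + r • J b).card : ℝ) * h ^ 2
      ≤ ((c • J d + (a • J b + (-(x0 • A) + -(x0 • A)))).card : ℝ) * h ^ 2 := by gcongr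
    _ = (((c • J d + (a • J b + (-(x0 • A) + -(x0 • A)))).card : ℝ) * h) * h := by ring
    _ ≤ (D * ((a • J b + (x0 • A + (-(x0 • A) + -(x0 • A)))).card : ℝ)) * h := by gcongr
    _ = D * (((a • J b + (x0 • A + (-(x0 • A) + -(x0 • A)))).card : ℝ) * h) := by ring
    _ ≤ D * (D * ((x0 • A + (x0 • A + (-(x0 • A) + -(x0 • A)))).card : ℝ)) := by gcongr
    _ ≤ D * (D * ((2 • A - 2 • A).card : ℝ)) := by gcongr
    _ = _ := by ring

lemma exists_small_energy (p : ℕ) [Fact p.Prime] (C : Finset (ZMod p)) :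
    ∃ r : ZMod p, ((((C ×ˢ C) ×ˢ (C ×ˢ C)).filter
      (fun q => q.1.1 + r * q.1.2 = q.2.1 + r * q.2.2)).card : ℝ)
      ≤ (C.card : ℝ) ^ 2 + (C.card : ℝ) ^ 4 / p := by
  have hp : (0 : ℝ) < p := by exact_mod_cast (Fact.out : p.Prime).pos
  by_contra! hcon
  set Q := (C ×ˢ C) ×ˢ (C ×ˢ C) with hQ
  have hsum : ∑ r : ZMod p, (Q.filter
      (fun q => q.1.1 + r * q.1.2 = q.2.1 + r * q.2.2)).card
      ≤ C.card ^ 2 * p + C.card ^ 4 := by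
    have h1 := Finset.sum_card_bipartiteAbove_eq_sum_card_bipartiteBelow
      (s := (univ : Finset (ZMod p))) (t := Q)
      (fun r q => q.1.1 + r * q.1.2 = q.2.1 + r * q.2.2)
    simp only [bipartiteAbove, bipartiteBelow] at h1
    rw [h1]
    have h2 : ∀ q ∈ Q, ((univ : Finset (ZMod p)).filter
        (fun r => q.1.1 + r * q.1.2 = q.2.1 + r * q.2.2)).card
        ≤ (if q.1 = q.2 then p else 0) + 1 := by
      intro q _
      split_ifs with h
      · refine (card_le_univ _).trans ?_
        simp [ZMod.card]
      · rw [zero_add, card_le_one]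
        intro r hr s hs
        simp only [mem_filter, mem_univ, true_and] at hr hs
        obtain ⟨⟨x, y⟩, x', y'⟩ := q
        simp only at hr hs h
        have hy : y - y' ≠ 0 := by
          intro hy
          have hy' : y = y' := sub_eq_zero.1 hy
          subst hy'
          exact h (by rw [add_right_cancel hr])
        refine mul_right_cancel₀ hy ?_
        linear_combination hr - hs
    refine (sum_le_sum h2).trans ?_
    rw [sum_add_distrib, ← sum_filter, sum_const, sum_const, smul_eq_mul, smul_eq_mul, mul_one]
    have h3 : (Q.filter (fun q => q.1 = q.2)).card ≤ C.card ^ 2 := by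
      rw [sq, ← card_product]
      refine card_le_card_of_injOn Prod.fst ?_ ?_
      · intro q hq
        simp only [hQ, coe_filter, mem_product, Set.mem_ofPred_eq] at hq
        simp only [mem_coe, mem_product]
        exact hq.1.1
      · intro q hq q' hq' e
        simp only [coe_filter, Set.mem_ofPred_eq] at hq hq'
        exact Prod.ext e (by rw [← hq.2, ← hq'.2, e])
    have h4 : Q.card = C.card ^ 4 := by simp only [hQ, card_product]; ring
    rw [h4]
    gcongr
  have hlt : ∑ r : ZMod p, ((C.card : ℝ) ^ 2 + (C.card : ℝ) ^ 4 / p)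
      < ∑ r : ZMod p, ((Q.filter
      (fun q => q.1.1 + r * q.1.2 = q.2.1 + r * q.2.2)).card : ℝ) :=
    sum_lt_sum_of_nonempty univ_nonempty (fun r _ => hcon r)
  rw [sum_const, card_univ, ZMod.card, nsmul_eq_mul] at hlt
  have hsum' : ∑ r : ZMod p, ((Q.filter
      (fun q => q.1.1 + r * q.1.2 = q.2.1 + r * q.2.2)).card : ℝ)
      ≤ (C.card : ℝ) ^ 2 * p + (C.card : ℝ) ^ 4 := by exact_mod_cast hsum
  have e : (p : ℝ) * ((C.card : ℝ) ^ 2 + (C.card : ℝ) ^ 4 / p)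
      = (C.card : ℝ) ^ 2 * p + (C.card : ℝ) ^ 4 := by field_simp
  linarith

lemma sum_prod_alt (p : ℕ) [Fact p.Prime] (A : Finset (ZMod p)) (hA : A.Nonempty)
    (h0 : (0 : ZMod p) ∉ A) (h : ℝ) (hh : 0 < h)
    (hE : 2 * (A.card : ℝ) ^ 2 * h ≤ (((A ×ˢ A) ×ˢ (A ×ˢ A)).filter
      (fun q => q.1.1 / q.1.2 = q.2.1 / q.2.2)).card) :
    h ^ 5 * (A.card : ℝ) ^ 3 ≤ 4 * ((A - A).card : ℝ) ^ 7 ∨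
    h ^ 6 * (A.card : ℝ) ^ 3 ≤ ((A - A).card : ℝ) ^ 6 *
      ((A.card : ℝ) ^ 2 + (A.card : ℝ) ^ 4 / p) := by
  obtain ⟨x0, hx0, C, hCA, hCne, hC⟩ := core_subset A hA h0 h hE
  have hp : (0 : ℝ) < p := by exact_mod_cast (Fact.out : p.Prime).pos
  have hn : (0 : ℝ) < A.card := by exact_mod_cast hA.card_pos
  have hPl : ((2 • A - 2 • A).card : ℝ) * (A.card : ℝ) ^ 3 ≤ ((A - A).card : ℝ) ^ 4 := by
    have h1 := Finset.pluennecke_ruzsa_inequality_nsmul_sub_nsmul_sub hA A 2 2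
    have h2 : ((2 • A - 2 • A).card : ℝ) ≤
        (((A - A).card : ℝ) / (A.card : ℝ)) ^ (2 + 2) * (A.card : ℝ) := by
      have h3 := (NNRat.cast_le (K := ℝ)).2 h1
      push_cast at h3
      exact h3
    have e : (((A - A).card : ℝ) / (A.card : ℝ)) ^ (2 + 2) * (A.card : ℝ)
      = ((A - A).card : ℝ) ^ 4 / (A.card : ℝ) ^ 3 := by
      rw [div_pow]; field_simp; ring
    rw [e, le_div_iff₀ (by positivity)] at h2
    exact h2
  have hnΔ : (A.card : ℝ) ≤ ((A - A).card : ℝ) := by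
    exact_mod_cast card_le_card_sub_right hA
  set Δ := ((A - A).card : ℝ) with hΔ
  set n := (A.card : ℝ) with hndef
  have hn1 : 1 ≤ n := by rw [hndef]; exact_mod_cast hA.card_pos
  have hΔ1 : 1 ≤ Δ := hn1.trans hnΔ
  set J : ZMod p → Finset (ZMod p) := fun d => C.filter (fun u => d * u / x0 ∈ A) with hJ
  have hJC : ∀ d, J d ⊆ C := fun d => filter_subset _ _
  have hJh : ∀ d ∈ C, h ≤ ((J d).card : ℝ) := hC
  have hJne : ∀ d ∈ C, (J d).Nonempty := by
    intro d hd
    have := lt_of_lt_of_le hh (hJh d hd)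
    exact card_pos.1 (by exact_mod_cast this)
  have hpiv : ∀ a b c d r : ZMod p, a ∈ C → c ∈ C → c ≠ d → a - b = r * (c - d) →
      ((J d + r • J b).card : ℝ) * h ^ 2 * n ^ 3 ≤ Δ ^ 6 := by
    intro a b c d r ha hc hcd hr
    have := pivot_bound A C h0 hCA x0 hx0 h hh.le hC ha hc hcd hr
    calc ((J d + r • J b).card : ℝ) * h ^ 2 * n ^ 3
        ≤ (Δ ^ 2 * ((2 • A - 2 • A).card : ℝ)) * n ^ 3 := by gcongr
      _ = Δ ^ 2 * (((2 • A - 2 • A).card : ℝ) * n ^ 3) := by ring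
      _ ≤ Δ ^ 2 * Δ ^ 4 := by gcongr
      _ = Δ ^ 6 := by ring
  by_cases hone : C.card ≤ 1
  · left
    obtain ⟨d, hd⟩ := hCne
    have h1 : h ≤ 1 := (hJh d hd).trans (by exact_mod_cast (card_le_card (hJC d)).trans hone)
    calc h ^ 5 * n ^ 3 ≤ 1 ^ 5 * Δ ^ 3 := by gcongr
      _ ≤ 4 * Δ ^ 7 := by
          have q1 : Δ ^ 3 ≤ Δ ^ 7 := pow_le_pow_right₀ hΔ1 (by norm_num)
          have q2 : 0 < Δ ^ 7 := pow_pos (lt_of_lt_of_le one_pos hΔ1) 7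
          linarith
  · rw [not_le, one_lt_card] at hone
    obtain ⟨c0, hc0, d0, hd0, hcd0⟩ := hone
    by_cases hcl : ∃ a ∈ C, ∃ b ∈ C, ∃ c ∈ C, ∃ d ∈ C, ∃ r : ZMod p, c ≠ d ∧
        a - b = r * (c - d) ∧
        ∀ a' ∈ C, ∀ b' ∈ C, ∀ c' ∈ C, ∀ d' ∈ C, a' - b' = (r - 1) * (c' - d') → c' = d'
    · left
      obtain ⟨a, ha, b, hb, c, hc, d, hd, r, hcd, hr, hinj⟩ := hcl
      have hP := hpiv a b c d r ha hc hcd hr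
      obtain ⟨X', hX', hX'ne, hXle⟩ := pl_diff (J d) (-(J b)) (r • J b) (hJne d hd)
        ((hJne b hb).neg) ((hJne b hb).smul_finset)
      have hlow : X'.card * (J b).card ≤ (X' + -(J b) + r • J b).card := by
        rw [← card_product]
        refine card_le_card_of_injOn (fun q => q.1 + (r - 1) * q.2) ?_ ?_
        · rintro ⟨x, y⟩ hxy
          simp only [mem_coe, mem_product] at hxy ⊢
          have e : x + (r - 1) * y = x + -y + r • y := by simp only [smul_eq_mul]; ring
          rw [e]
          exact add_mem_add (add_mem_add hxy.1 (neg_mem_neg hxy.2)) (smul_mem_smul_finset hxy.2)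
        · rintro ⟨x, y⟩ hxy ⟨x', y'⟩ hxy' e
          simp only [mem_coe, mem_product] at hxy hxy' e
          have hy : y = y' := hinj x' (hJC _ (hX' hxy'.1)) x (hJC _ (hX' hxy.1)) y (hJC _ hxy.2)
            y' (hJC _ hxy'.2) (by linear_combination (-1 : ZMod p) * e)
          subst hy
          rw [add_right_cancel e]
      have hX'pos : 0 < X'.card := hX'ne.card_pos
      have hk : (J b).card * (J d).card ^ 2 ≤ 4 * (J d + -(J b)).card * (J d + r • J b).card := by
        refine Nat.le_of_mul_le_mul_right ?_ hX'pos
        refine le_trans ?_ hXle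
        calc (J b).card * (J d).card ^ 2 * X'.card = (X'.card * (J b).card) * (J d).card ^ 2 := by
              ring
          _ ≤ _ := Nat.mul_le_mul_right _ hlow
      have hdd : ((J d + -(J b)).card : ℝ) ≤ Δ := by
        rw [← sub_eq_add_neg, hΔ]
        exact_mod_cast card_le_card (sub_subset_sub ((hJC d).trans hCA) ((hJC b).trans hCA))
      have hk' : ((J b).card : ℝ) * ((J d).card : ℝ) ^ 2
          ≤ 4 * ((J d + -(J b)).card : ℝ) * ((J d + r • J b).card : ℝ) := by exact_mod_cast hk
      have hb' := hJh b hb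
      have hd' := hJh d hd
      calc h ^ 5 * n ^ 3 = (h * h ^ 2) * (h ^ 2 * n ^ 3) := by ring
        _ ≤ (((J b).card : ℝ) * ((J d).card : ℝ) ^ 2) * (h ^ 2 * n ^ 3) := by gcongr
        _ ≤ (4 * Δ * ((J d + r • J b).card : ℝ)) * (h ^ 2 * n ^ 3) := by
            refine mul_le_mul_of_nonneg_right (hk'.trans ?_) (by positivity)
            gcongr
        _ = 4 * Δ * (((J d + r • J b).card : ℝ) * h ^ 2 * n ^ 3) := by ring
        _ ≤ 4 * Δ * Δ ^ 6 := by gcongr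
        _ = 4 * Δ ^ 7 := by ring
    · right
      push Not at hcl
      have hall : ∀ k : ℕ, ∃ a ∈ C, ∃ b ∈ C, ∃ c ∈ C, ∃ d ∈ C, c ≠ d ∧
          a - b = (-(k : ZMod p)) * (c - d) := by
        intro k
        induction k with
        | zero => exact ⟨c0, hc0, c0, hc0, c0, hc0, d0, hd0, hcd0, by simp⟩
        | succ k ih =>
          obtain ⟨a, ha, b, hb, c, hc, d, hd, hcd, hr⟩ := ih
          obtain ⟨a', ha', b', hb', c', hc', d', hd', hr', hcd'⟩ :=
            hcl a ha b hb c hc d hd _ hcd hr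
          exact ⟨a', ha', b', hb', c', hc', d', hd', hcd', by rw [hr']; push_cast; ring⟩
      obtain ⟨r, hr⟩ := exists_small_energy p C
      obtain ⟨a, ha, b, hb, c, hc, d, hd, hcd, habcd⟩ := hall (-r).val
      have hrr : -(((-r).val : ℕ) : ZMod p) = r := by rw [ZMod.natCast_zmod_val]; ring
      rw [hrr] at habcd
      have hP := hpiv a b c d r ha hc hcd habcd
      have hcs := cs_image_s10 (J d ×ˢ J b) (fun q => q.1 + r * q.2)
      have him : (J d ×ˢ J b).image (fun q => q.1 + r * q.2) ⊆ J d + r • J b := by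
        intro y hy
        obtain ⟨q, hq, rfl⟩ := mem_image.1 hy
        rw [mem_product] at hq
        exact add_mem_add hq.1 (smul_mem_smul_finset hq.2)
      have hen : (((J d ×ˢ J b) ×ˢ (J d ×ˢ J b)).filter
          (fun q => q.1.1 + r * q.1.2 = q.2.1 + r * q.2.2)) ⊆
          (((C ×ˢ C) ×ˢ (C ×ˢ C)).filter
          (fun q => q.1.1 + r * q.1.2 = q.2.1 + r * q.2.2)) :=
        filter_subset_filter _ (product_subset_product
          (product_subset_product (hJC _) (hJC _)) (product_subset_product (hJC _) (hJC _)))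
      have hcs2 := hcs.trans (Nat.mul_le_mul (card_le_card him) (card_le_card hen))
      rw [card_product] at hcs2
      have hcs3 : (((J d).card : ℝ) * ((J b).card : ℝ)) ^ 2 ≤ ((J d + r • J b).card : ℝ) *
          ((((C ×ˢ C) ×ˢ (C ×ˢ C)).filter
            (fun q => q.1.1 + r * q.1.2 = q.2.1 + r * q.2.2)).card : ℝ) := by exact_mod_cast hcs2
      set En := ((((C ×ˢ C) ×ˢ (C ×ˢ C)).filter
            (fun q => q.1.1 + r * q.1.2 = q.2.1 + r * q.2.2)).card : ℝ)
      have hEn : 0 ≤ En := by positivity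
      have hm : (C.card : ℝ) ≤ n := by rw [hndef]; exact_mod_cast card_le_card hCA
      have hb' := hJh b hb
      have hd' := hJh d hd
      calc h ^ 6 * n ^ 3 = (h * h) ^ 2 * (h ^ 2 * n ^ 3) := by ring
        _ ≤ (((J d).card : ℝ) * ((J b).card : ℝ)) ^ 2 * (h ^ 2 * n ^ 3) := by gcongr
        _ ≤ (((J d + r • J b).card : ℝ) * En) * (h ^ 2 * n ^ 3) := by gcongr
        _ = (((J d + r • J b).card : ℝ) * h ^ 2 * n ^ 3) * En := by ring
        _ ≤ Δ ^ 6 * En := by gcongr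
        _ ≤ Δ ^ 6 * ((C.card : ℝ) ^ 2 + (C.card : ℝ) ^ 4 / p) := by gcongr
        _ ≤ Δ ^ 6 * (n ^ 2 + n ^ 4 / p) := by gcongr

/-- Common neighbours of two vertices in `B` with respect to `G`. -/
def comN {F : Type*} [DecidableEq F] (B : Finset F) (G : Finset (F × F)) (a a' : F) : Finset F :=
  B.filter (fun b => (a, b) ∈ G ∧ (a', b) ∈ G)

lemma bsg_choose {F : Type*} [DecidableEq F] (A B : Finset F) (G : Finset (F × F))
    (hG : G ⊆ A ×ˢ B) (hGne : G.Nonempty) (τ : ℝ)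
    (hτ : τ * (16 * (A.card : ℝ) ^ 2 * B.card) = (G.card : ℝ) ^ 2) :
    ∃ A1 ⊆ A, A1.Nonempty ∧ (G.card : ℝ) ^ 2 ≤ 2 * (A1.card : ℝ) ^ 2 * (B.card : ℝ) ^ 2 ∧
      8 * (((A1 ×ˢ A1).filter (fun q => ((comN B G q.1 q.2).card : ℝ) < τ)).card : ℝ)
        ≤ (A1.card : ℝ) ^ 2 := by
  have hBne : B.Nonempty := by
    obtain ⟨q, hq⟩ := hGne
    exact ⟨q.2, (mem_product.1 (hG hq)).2⟩
  have hβ : (0 : ℝ) < B.card := by exact_mod_cast hBne.card_pos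
  have he : (0 : ℝ) < G.card := by exact_mod_cast hGne.card_pos
  set N : F → Finset F := fun b => A.filter (fun a => (a, b) ∈ G) with hN
  set bad : F → Finset (F × F) := fun b =>
    ((N b ×ˢ N b).filter (fun q => ((comN B G q.1 q.2).card : ℝ) < τ)) with hbad
  have hsum : G.card = ∑ b ∈ B, (N b).card := by
    rw [card_eq_sum_card_fiberwise (f := Prod.snd) (t := B)
      (fun q hq => mem_coe.2 (mem_product.1 (hG hq)).2)]
    refine sum_congr rfl fun b _ => ?_
    refine card_bij' (fun q _ => q.1) (fun a _ => (a, b)) ?_ ?_ ?_ ?_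
    · rintro ⟨a, b'⟩ hq
      simp only [mem_filter] at hq
      obtain ⟨hq, rfl⟩ := hq
      simp only [hN, mem_filter]
      exact ⟨(mem_product.1 (hG hq)).1, hq⟩
    · intro a ha
      simp only [hN, mem_filter] at ha ⊢
      exact ⟨ha.2, trivial⟩
    · rintro ⟨a, b'⟩ hq
      simp only [mem_filter] at hq
      simp [hq.2]
    · intro a _
      rfl
  have hsq : (G.card : ℝ) ^ 2 ≤ B.card * ∑ b ∈ B, ((N b).card : ℝ) ^ 2 := by
    rw [hsum]; push_cast
    exact sq_sum_le_card_mul_sum_sq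
  have hbads : ∑ b ∈ B, ((bad b).card : ℝ) ≤ τ * (A.card : ℝ) ^ 2 := by
    set P := (A ×ˢ A).filter (fun q => ((comN B G q.1 q.2).card : ℝ) < τ) with hP
    have h1 := Finset.sum_card_bipartiteAbove_eq_sum_card_bipartiteBelow
      (s := B) (t := P) (fun b q => (q.1, b) ∈ G ∧ (q.2, b) ∈ G)
    simp only [bipartiteAbove, bipartiteBelow] at h1
    have h2 : ∀ b ∈ B, (bad b).card = (P.filter (fun q => (q.1, b) ∈ G ∧ (q.2, b) ∈ G)).card := by
      intro b _
      congr 1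
      ext ⟨x, y⟩
      simp only [hbad, hP, hN, mem_filter, mem_product]
      tauto
    have h3 : ∑ b ∈ B, (bad b).card = ∑ q ∈ P, (comN B G q.1 q.2).card := by
      rw [sum_congr rfl h2, h1]
      rfl
    have hτ0 : 0 ≤ τ := by
      by_contra! hneg
      have : τ * (16 * (A.card : ℝ) ^ 2 * B.card) ≤ 0 :=
        mul_nonpos_of_nonpos_of_nonneg hneg.le (by positivity)
      nlinarith [pow_pos he 2]
    calc ∑ b ∈ B, ((bad b).card : ℝ) = ∑ q ∈ P, ((comN B G q.1 q.2).card : ℝ) := by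
          exact_mod_cast h3
      _ ≤ ∑ q ∈ P, τ := sum_le_sum fun q hq => (mem_filter.1 hq).2.le
      _ = P.card * τ := by rw [sum_const, nsmul_eq_mul]
      _ ≤ (A.card : ℝ) ^ 2 * τ := by
          gcongr
          have : P.card ≤ A.card ^ 2 := by
            rw [sq, ← card_product]; exact card_filter_le _ _
          exact_mod_cast this
      _ = _ := by ring
  have hex : ∃ b ∈ B, (G.card : ℝ) ^ 2 / (2 * (B.card : ℝ) ^ 2)
      ≤ ((N b).card : ℝ) ^ 2 - 8 * ((bad b).card : ℝ) := by
    by_contra! hcon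
    have h1 := sum_lt_sum_of_nonempty hBne hcon
    rw [sum_const, nsmul_eq_mul, sum_sub_distrib, ← mul_sum] at h1
    have e1 : (B.card : ℝ) * ((G.card : ℝ) ^ 2 / (2 * (B.card : ℝ) ^ 2))
      = (G.card : ℝ) ^ 2 / (2 * B.card) := by field_simp
    rw [e1] at h1
    have h2 : (G.card : ℝ) ^ 2 / B.card ≤ ∑ b ∈ B, ((N b).card : ℝ) ^ 2 := by
      rw [div_le_iff₀ hβ]; linarith
    have h3 : 8 * (τ * (A.card : ℝ) ^ 2) = (G.card : ℝ) ^ 2 / (2 * B.card) := by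
      rw [eq_div_iff (by positivity)]; linarith
    have h4 : (G.card : ℝ) ^ 2 / B.card = 2 * ((G.card : ℝ) ^ 2 / (2 * B.card)) := by
      field_simp
    linarith
  obtain ⟨b, _, hb⟩ := hex
  have hbn : (0 : ℝ) ≤ ((bad b).card : ℝ) := by positivity
  have hq : 0 < (G.card : ℝ) ^ 2 / (2 * (B.card : ℝ) ^ 2) := by positivity
  refine ⟨N b, filter_subset _ _, ?_, ?_, ?_⟩
  · rw [nonempty_iff_ne_empty]
    intro h0
    rw [h0] at hb
    simp only [card_empty, Nat.cast_zero] at hb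
    nlinarith
  · have : (G.card : ℝ) ^ 2 / (2 * (B.card : ℝ) ^ 2) ≤ ((N b).card : ℝ) ^ 2 := by linarith
    rw [div_le_iff₀ (by positivity)] at this
    linarith
  · change 8 * ((bad b).card : ℝ) ≤ _
    linarith

lemma bsg_refine {F : Type*} [DecidableEq F] (A1 : Finset F) (hne : A1.Nonempty)
    (Bad : F → F → Prop) [∀ a b, Decidable (Bad a b)]
    (hbad : 8 * (((A1 ×ˢ A1).filter (fun q => Bad q.1 q.2)).card : ℝ) ≤ (A1.card : ℝ) ^ 2) :
    ∃ A' ⊆ A1, (A1.card : ℝ) ≤ 2 * A'.card ∧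
      ∀ a ∈ A', 4 * ((A1.filter (fun a' => Bad a a')).card : ℝ) ≤ A1.card := by
  have hn : (0 : ℝ) < A1.card := by exact_mod_cast hne.card_pos
  set A' := A1.filter (fun a => 4 * ((A1.filter (fun a' => Bad a a')).card : ℝ) ≤ A1.card) with hA'
  refine ⟨A', filter_subset _ _, ?_, fun a ha => (mem_filter.1 ha).2⟩
  set A2 := A1.filter (fun a => ¬ 4 * ((A1.filter (fun a' => Bad a a')).card : ℝ) ≤ A1.card)
    with hA2
  have hsplit : A'.card + A2.card = A1.card := card_filter_add_card_filter_not _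
  have hs : ((A1 ×ˢ A1).filter (fun q => Bad q.1 q.2)).card
      = ∑ a ∈ A1, (A1.filter (fun a' => Bad a a')).card := by
    simp only [card_filter, sum_product]
  have h1 : (A2.card : ℝ) * A1.card ≤ 4 * ∑ a ∈ A1, ((A1.filter (fun a' => Bad a a')).card : ℝ) := by
    calc (A2.card : ℝ) * A1.card = ∑ a ∈ A2, (A1.card : ℝ) := by rw [sum_const, nsmul_eq_mul]
      _ ≤ ∑ a ∈ A2, 4 * ((A1.filter (fun a' => Bad a a')).card : ℝ) :=
          sum_le_sum fun a ha => (not_le.1 (mem_filter.1 ha).2).le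
      _ ≤ ∑ a ∈ A1, 4 * ((A1.filter (fun a' => Bad a a')).card : ℝ) :=
          sum_le_sum_of_subset_of_nonneg (filter_subset _ _) (fun _ _ _ => by positivity)
      _ = _ := by rw [mul_sum]
  have hs' : (((A1 ×ˢ A1).filter (fun q => Bad q.1 q.2)).card : ℝ)
      = ∑ a ∈ A1, ((A1.filter (fun a' => Bad a a')).card : ℝ) := by exact_mod_cast hs
  have hsplit' : (A'.card : ℝ) + A2.card = A1.card := by exact_mod_cast hsplit
  have h2 : (2 * A2.card : ℝ) * A1.card ≤ A1.card * A1.card := by nlinarith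
  have h3 := le_of_mul_le_mul_right h2 hn
  linarith

lemma bsg_diff {F : Type*} [Field F] [DecidableEq F] (B A1 A' : Finset F) (G : Finset (F × F))
    (τ : ℝ) (hτ : 0 ≤ τ)
    (hgood : ∀ a ∈ A', 4 * ((A1.filter (fun a' => ((comN B G a a').card : ℝ) < τ)).card : ℝ)
      ≤ A1.card) :
    ((A' - A').card : ℝ) * (A1.card : ℝ) * τ ^ 2
      ≤ 2 * ((G.image fun x => x.1 - x.2).card : ℝ) ^ 4 := by
  have hch : ∀ x : F, ∃ q : F × F, x ∈ A' - A' → q.1 ∈ A' ∧ q.2 ∈ A' ∧ q.1 - q.2 = x := by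
    intro x
    by_cases hx : x ∈ A' - A'
    · obtain ⟨a, ha, b, hb, rfl⟩ := mem_sub.1 hx
      exact ⟨(a, b), fun _ => ⟨ha, hb, rfl⟩⟩
    · exact ⟨(x, x), fun h => absurd h hx⟩
  choose σ hσ using hch
  set D := G.image fun x => x.1 - x.2 with hD
  set gd : F → Finset F := fun x => A1.filter (fun a' =>
    ¬ ((comN B G (σ x).1 a').card : ℝ) < τ ∧ ¬ ((comN B G (σ x).2 a').card : ℝ) < τ) with hgd
  set S := (A' - A').sigma (fun x => (gd x).sigma (fun a' =>
    comN B G (σ x).1 a' ×ˢ comN B G (σ x).2 a')) with hS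
  have hup : S.card ≤ D.card ^ 4 := by
    have e4 : D.card ^ 4 = ((D ×ˢ D) ×ˢ (D ×ˢ D)).card := by simp only [card_product]; ring
    rw [e4]
    refine card_le_card_of_injOn (fun s => (((σ s.1).1 - s.2.2.1, s.2.1 - s.2.2.1),
      (s.2.1 - s.2.2.2, (σ s.1).2 - s.2.2.2))) ?_ ?_
    · rintro ⟨x, a', b, b'⟩ hs
      simp only [hS, coe_sigma, Set.mem_sigma_iff, mem_coe, mem_product, comN,
        mem_filter] at hs
      obtain ⟨hx, ha', ⟨hb, h1, h2⟩, hb', h3, h4⟩ := hs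
      simp only [mem_coe, mem_product, hD]
      exact ⟨⟨mem_image_of_mem (fun x : F × F => x.1 - x.2) h1,
        mem_image_of_mem (fun x : F × F => x.1 - x.2) h2⟩,
        mem_image_of_mem (fun x : F × F => x.1 - x.2) h4,
        mem_image_of_mem (fun x : F × F => x.1 - x.2) h3⟩
    · rintro ⟨x, a, b, b'⟩ hs ⟨y, c, d, d'⟩ hs' he
      simp only [hS, coe_sigma, Set.mem_sigma_iff, mem_coe] at hs hs'
      simp only [Prod.mk.injEq] at he
      obtain ⟨⟨e1, e2⟩, e3, e4⟩ := he
      have hxy : x = y := by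
        rw [← (hσ x hs.1).2.2, ← (hσ y hs'.1).2.2]
        linear_combination e1 - e2 + e3 - e4
      subst hxy
      have hb : b = d := by linear_combination -e1
      have hb' : b' = d' := by linear_combination -e4
      subst hb hb'
      have ha : a = c := by linear_combination e2
      subst ha
      rfl
  have hlow : ((A' - A').card : ℝ) * ((A1.card : ℝ) / 2 * τ ^ 2) ≤ S.card := by
    rw [hS, card_sigma]
    push_cast
    rw [← nsmul_eq_mul]
    refine card_nsmul_le_sum _ _ _ fun x hx => ?_
    rw [card_sigma]
    push_cast
    have hgc : (A1.card : ℝ) / 2 ≤ (gd x).card := by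
      have hsub : A1 ⊆ gd x ∪ ((A1.filter (fun a' => ((comN B G (σ x).1 a').card : ℝ) < τ)) ∪
          (A1.filter (fun a' => ((comN B G (σ x).2 a').card : ℝ) < τ))) := by
        intro a ha
        simp only [hgd, mem_union, mem_filter]
        tauto
      have h1 := (card_le_card hsub).trans ((card_union_le _ _).trans
        (Nat.add_le_add_left (card_union_le _ _) _))
      have h2 : (A1.card : ℝ) ≤ (gd x).card +
        (((A1.filter (fun a' => ((comN B G (σ x).1 a').card : ℝ) < τ)).card : ℝ) +
          ((A1.filter (fun a' => ((comN B G (σ x).2 a').card : ℝ) < τ)).card : ℝ)) := by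
        exact_mod_cast h1
      have h3 := hgood _ (hσ x hx).1
      have h4 := hgood _ (hσ x hx).2.1
      linarith
    calc (A1.card : ℝ) / 2 * τ ^ 2 ≤ (gd x).card * τ ^ 2 := by gcongr
      _ = (gd x).card • τ ^ 2 := by rw [nsmul_eq_mul]
      _ ≤ _ := card_nsmul_le_sum _ _ _ fun a ha => ?_
    simp only [hgd, mem_filter, not_lt] at ha
    rw [card_product]
    push_cast
    rw [sq]
    exact mul_le_mul ha.2.1 ha.2.2 hτ (by positivity)
  have hup' : (S.card : ℝ) ≤ (D.card : ℝ) ^ 4 := by exact_mod_cast hup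
  nlinarith

lemma bsg_energy {F : Type*} [Field F] [DecidableEq F] (B A1 A' : Finset F) (G : Finset (F × F))
    (h0 : (0 : F) ∉ A') (h0B : (0 : F) ∉ B)
    (τ : ℝ) (hτ : 0 ≤ τ) (hA' : A' ⊆ A1) (hn : (A1.card : ℝ) ≤ 2 * A'.card)
    (hgood : ∀ a ∈ A', 4 * ((A1.filter (fun a' => ((comN B G a a').card : ℝ) < τ)).card : ℝ)
      ≤ A1.card) :
    (A'.card : ℝ) ^ 4 * τ ≤ 4 * ((G.image fun x => x.1 / x.2).card : ℝ) ^ 2 *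
      (((A' ×ˢ A') ×ˢ (A' ×ˢ A')).filter
      (fun q => q.1.1 / q.1.2 = q.2.1 / q.2.2)).card := by
  set L := G.image fun x => x.1 / x.2 with hL
  set W := (A' ×ˢ A').filter (fun q => ¬ ((comN B G q.1 q.2).card : ℝ) < τ) with hW
  have hWlow : (A'.card : ℝ) ^ 2 ≤ 2 * W.card := by
    have hsplit : ((A' ×ˢ A').filter (fun q => ((comN B G q.1 q.2).card : ℝ) < τ)).card + W.card
      = (A' ×ˢ A').card := card_filter_add_card_filter_not _
    have hs : ((A' ×ˢ A').filter (fun q => ((comN B G q.1 q.2).card : ℝ) < τ)).card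
      = ∑ a ∈ A', (A'.filter (fun a' => ((comN B G a a').card : ℝ) < τ)).card := by
      simp only [card_filter, sum_product]
    have hb : ∑ a ∈ A', ((A'.filter (fun a' => ((comN B G a a').card : ℝ) < τ)).card : ℝ)
        ≤ ∑ a ∈ A', (A'.card : ℝ) / 2 := by
      refine sum_le_sum fun a ha => ?_
      have h1 := hgood a ha
      have h2 : ((A'.filter (fun a' => ((comN B G a a').card : ℝ) < τ)).card : ℝ) ≤
          ((A1.filter (fun a' => ((comN B G a a').card : ℝ) < τ)).card : ℝ) := by
        exact_mod_cast card_le_card (filter_subset_filter _ hA')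
      linarith
    rw [sum_const, nsmul_eq_mul] at hb
    rw [hs, card_product] at hsplit
    have hsplit' : ∑ a ∈ A', ((A'.filter (fun a' => ((comN B G a a').card : ℝ) < τ)).card : ℝ)
      + W.card = (A'.card : ℝ) * A'.card := by exact_mod_cast hsplit
    nlinarith
  set T := W.image (fun q => q.1 / q.2) with hT
  have hch : ∀ t : F, ∃ q : F × F, t ∈ T → q ∈ W ∧ q.1 / q.2 = t := by
    intro t
    by_cases ht : t ∈ T
    · obtain ⟨q, hq, rfl⟩ := mem_image.1 ht
      exact ⟨q, fun _ => ⟨hq, rfl⟩⟩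
    · exact ⟨(t, t), fun h => absurd h ht⟩
  choose ρ hρ using hch
  have hTL : τ * T.card ≤ (L.card : ℝ) ^ 2 := by
    set S := T.sigma (fun t => comN B G (ρ t).1 (ρ t).2) with hS
    have hup : S.card ≤ L.card ^ 2 := by
      rw [sq, ← card_product]
      refine card_le_card_of_injOn (fun s => ((ρ s.1).1 / s.2, (ρ s.1).2 / s.2)) ?_ ?_
      · rintro ⟨t, b⟩ hs
        simp only [hS, coe_sigma, Set.mem_sigma_iff, mem_coe, comN, mem_filter] at hs
        simp only [mem_coe, mem_product, hL]
        exact ⟨mem_image_of_mem (fun x : F × F => x.1 / x.2) hs.2.2.1,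
          mem_image_of_mem (fun x : F × F => x.1 / x.2) hs.2.2.2⟩
      · rintro ⟨t, b⟩ hs ⟨u, c⟩ hs' he
        simp only [hS, coe_sigma, Set.mem_sigma_iff, mem_coe, comN, mem_filter] at hs hs'
        simp only [Prod.mk.injEq] at he
        obtain ⟨e1, e2⟩ := he
        have hb0 : b ≠ 0 := fun e => h0B (e ▸ hs.2.1)
        have hc0 : c ≠ 0 := fun e => h0B (e ▸ hs'.2.1)
        have htu : t = u := by
          rw [← (hρ t hs.1).2, ← (hρ u hs'.1).2, ← div_div_div_cancel_right₀ hb0,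
            ← div_div_div_cancel_right₀ hc0 (ρ u).1, e1, e2]
        subst htu
        have hW1 := (hρ t hs.1).1
        simp only [hW, mem_filter, mem_product] at hW1
        have ha0 : (ρ t).1 ≠ 0 := fun e => h0 (e ▸ hW1.1.1)
        have : b = c := by
          rw [div_eq_div_iff hb0 hc0] at e1
          exact (mul_left_cancel₀ ha0 e1).symm
        subst this
        rfl
    have hlow : (T.card : ℝ) * τ ≤ S.card := by
      rw [hS, card_sigma]
      push_cast
      rw [← nsmul_eq_mul]
      refine card_nsmul_le_sum _ _ _ fun t ht => ?_
      have := (hρ t ht).1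
      simp only [hW, mem_filter, not_lt] at this
      exact this.2
    have hup' : (S.card : ℝ) ≤ (L.card : ℝ) ^ 2 := by exact_mod_cast hup
    linarith
  have hcs := cs_image_s10 W (fun q => q.1 / q.2)
  have hen : ((W ×ˢ W).filter (fun q => q.1.1 / q.1.2 = q.2.1 / q.2.2)) ⊆
      (((A' ×ˢ A') ×ˢ (A' ×ˢ A')).filter (fun q => q.1.1 / q.1.2 = q.2.1 / q.2.2)) :=
    filter_subset_filter _ (product_subset_product (filter_subset _ _) (filter_subset _ _))
  have hcs2 := hcs.trans (Nat.mul_le_mul_left _ (card_le_card hen))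
  set E := (((A' ×ˢ A') ×ˢ (A' ×ˢ A')).filter
    (fun q => q.1.1 / q.1.2 = q.2.1 / q.2.2)).card with hE
  have hcs3 : (W.card : ℝ) ^ 2 ≤ (T.card : ℝ) * E := by exact_mod_cast hcs2
  calc (A'.card : ℝ) ^ 4 * τ = ((A'.card : ℝ) ^ 2) ^ 2 * τ := by ring
    _ ≤ (2 * W.card) ^ 2 * τ := by gcongr
    _ = 4 * ((W.card : ℝ) ^ 2) * τ := by ring
    _ ≤ 4 * ((T.card : ℝ) * E) * τ := by gcongr
    _ = 4 * (τ * T.card) * E := by ring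
    _ ≤ 4 * (L.card : ℝ) ^ 2 * E := by gcongr

lemma numeric_A (e α β D L n n1 Δ τ h : ℝ) (he : 0 < e) (hα : 0 < α) (hβ : 0 < β) (hD : 0 < D)
    (hL : 0 < L) (hn : 0 < n) (hn1 : 0 < n1) (hΔ : 0 < Δ) (hτ : 0 < τ)
    (hτe : τ * (16 * α ^ 2 * β) = e ^ 2) (h1 : e ≤ 2 * n1 * β) (h2 : n1 ≤ 2 * n)
    (h3 : Δ * n1 * τ ^ 2 ≤ 2 * D ^ 4) (hh : h * (8 * L ^ 2) = n ^ 2 * τ)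
    (hA : h ^ 5 * n ^ 3 ≤ 4 * Δ ^ 7)
    (t1 : e ≤ α * β) (t2 : e ≤ α * L) (t3 : e ≤ β * L) :
    e ^ 67 ≤ 2 ^ 133 * (α ^ 44 * β ^ 45 * D ^ 28 * L ^ 16) := by
  have s1 : n ^ 13 * τ ^ 5 ≤ 2 ^ 17 * L ^ 10 * Δ ^ 7 := by
    calc n ^ 13 * τ ^ 5 = (n ^ 2 * τ) ^ 5 * n ^ 3 := by ring
      _ = (h * (8 * L ^ 2)) ^ 5 * n ^ 3 := by rw [hh]
      _ = (h ^ 5 * n ^ 3) * (8 * L ^ 2) ^ 5 := by ring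
      _ ≤ (4 * Δ ^ 7) * (8 * L ^ 2) ^ 5 := by gcongr
      _ = _ := by ring
  have s2 : e ^ 20 * τ ^ 19 ≤ 2 ^ 57 * β ^ 20 * D ^ 28 * L ^ 10 := by
    calc e ^ 20 * τ ^ 19 ≤ (2 * n1 * β) ^ 20 * τ ^ 19 := by gcongr
      _ = 2 ^ 20 * β ^ 20 * (n1 ^ 13) * n1 ^ 7 * τ ^ 19 := by ring
      _ ≤ 2 ^ 20 * β ^ 20 * ((2 * n) ^ 13) * n1 ^ 7 * τ ^ 19 := by gcongr
      _ = 2 ^ 33 * β ^ 20 * n1 ^ 7 * τ ^ 14 * (n ^ 13 * τ ^ 5) := by ring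
      _ ≤ 2 ^ 33 * β ^ 20 * n1 ^ 7 * τ ^ 14 * (2 ^ 17 * L ^ 10 * Δ ^ 7) := by gcongr
      _ = 2 ^ 50 * β ^ 20 * L ^ 10 * (Δ * n1 * τ ^ 2) ^ 7 := by ring
      _ ≤ 2 ^ 50 * β ^ 20 * L ^ 10 * (2 * D ^ 4) ^ 7 := by gcongr
      _ = _ := by ring
  calc e ^ 67 = e ^ 20 * (e ^ 2) ^ 19 * (e ^ 3 * e ^ 3 * e ^ 3) := by ring
    _ = e ^ 20 * (τ * (16 * α ^ 2 * β)) ^ 19 * (e ^ 3 * e ^ 3 * e ^ 3) := by rw [hτe]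
    _ = (e ^ 20 * τ ^ 19) * (16 * α ^ 2 * β) ^ 19 * (e ^ 3 * e ^ 3 * e ^ 3) := by ring
    _ ≤ (2 ^ 57 * β ^ 20 * D ^ 28 * L ^ 10) * (16 * α ^ 2 * β) ^ 19 *
        ((α * β) ^ 3 * (α * L) ^ 3 * (β * L) ^ 3) := by gcongr
    _ = _ := by ring

lemma numeric_B (e α β D L n n1 Δ τ h p : ℝ) (he : 0 < e) (hα : 0 < α) (hβ : 0 < β) (hD : 0 < D)
    (hL : 0 < L) (hn : 0 < n) (hn1 : 0 < n1) (hΔ : 0 < Δ) (hτ : 0 < τ) (hp : 0 < p)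
    (hτe : τ * (16 * α ^ 2 * β) = e ^ 2) (h1 : e ≤ 2 * n1 * β) (h2 : n1 ≤ 2 * n)
    (h3 : Δ * n1 * τ ^ 2 ≤ 2 * D ^ 4) (hh : h * (8 * L ^ 2) = n ^ 2 * τ)
    (hB : h ^ 6 * n ^ 3 ≤ Δ ^ 6 * (n ^ 2 + n ^ 4 / p)) (hpe : e ^ 2 ≤ p * β ^ 2)
    (t1 : e ≤ α * β) (t2 : e ≤ α * D) (t3 : e ≤ β * L) :
    e ^ 67 ≤ 2 ^ 133 * (α ^ 44 * β ^ 45 * D ^ 28 * L ^ 16) := by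
  have hE : (n ^ 2 + n ^ 4 / p) * e ^ 2 ≤ 17 * n ^ 4 * β ^ 2 := by
    have q1 : e ≤ 4 * n * β := by nlinarith
    have q2 : n ^ 2 * e ^ 2 ≤ n ^ 2 * (4 * n * β) ^ 2 := by gcongr
    have q3 : n ^ 4 / p * e ^ 2 ≤ n ^ 4 / p * (p * β ^ 2) := by gcongr
    have q4 : n ^ 4 / p * (p * β ^ 2) = n ^ 4 * β ^ 2 := by field_simp
    nlinarith
  have s0 : (n ^ 11 * τ ^ 6 * e ^ 2) * n ^ 4 ≤ (17 * 2 ^ 18 * L ^ 12 * Δ ^ 6 * β ^ 2) * n ^ 4 := by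
    calc (n ^ 11 * τ ^ 6 * e ^ 2) * n ^ 4 = (n ^ 2 * τ) ^ 6 * n ^ 3 * e ^ 2 := by ring
      _ = (h * (8 * L ^ 2)) ^ 6 * n ^ 3 * e ^ 2 := by rw [hh]
      _ = (h ^ 6 * n ^ 3) * (8 * L ^ 2) ^ 6 * e ^ 2 := by ring
      _ ≤ (Δ ^ 6 * (n ^ 2 + n ^ 4 / p)) * (8 * L ^ 2) ^ 6 * e ^ 2 := by gcongr
      _ = Δ ^ 6 * (8 * L ^ 2) ^ 6 * ((n ^ 2 + n ^ 4 / p) * e ^ 2) := by ring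
      _ ≤ Δ ^ 6 * (8 * L ^ 2) ^ 6 * (17 * n ^ 4 * β ^ 2) := by gcongr
      _ = _ := by ring
  have s1 := le_of_mul_le_mul_right s0 (by positivity)
  have s2 : e ^ 19 * τ ^ 18 ≤ 17 * 2 ^ 52 * β ^ 19 * D ^ 24 * L ^ 12 := by
    calc e ^ 19 * τ ^ 18 = e ^ 17 * e ^ 2 * τ ^ 18 := by ring
      _ ≤ (2 * n1 * β) ^ 17 * e ^ 2 * τ ^ 18 := by gcongr
      _ = 2 ^ 17 * β ^ 17 * (n1 ^ 11) * n1 ^ 6 * e ^ 2 * τ ^ 18 := by ring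
      _ ≤ 2 ^ 17 * β ^ 17 * ((2 * n) ^ 11) * n1 ^ 6 * e ^ 2 * τ ^ 18 := by gcongr
      _ = 2 ^ 28 * β ^ 17 * n1 ^ 6 * τ ^ 12 * (n ^ 11 * τ ^ 6 * e ^ 2) := by ring
      _ ≤ 2 ^ 28 * β ^ 17 * n1 ^ 6 * τ ^ 12 * (17 * 2 ^ 18 * L ^ 12 * Δ ^ 6 * β ^ 2) := by gcongr
      _ = 17 * 2 ^ 46 * β ^ 19 * L ^ 12 * (Δ * n1 * τ ^ 2) ^ 6 := by ring
      _ ≤ 17 * 2 ^ 46 * β ^ 19 * L ^ 12 * (2 * D ^ 4) ^ 6 := by gcongr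
      _ = _ := by ring
  calc e ^ 67 = e ^ 19 * (e ^ 2) ^ 18 * (e ^ 4 * e ^ 4 * e ^ 4) := by ring
    _ = e ^ 19 * (τ * (16 * α ^ 2 * β)) ^ 18 * (e ^ 4 * e ^ 4 * e ^ 4) := by rw [hτe]
    _ = (e ^ 19 * τ ^ 18) * (16 * α ^ 2 * β) ^ 18 * (e ^ 4 * e ^ 4 * e ^ 4) := by ring
    _ ≤ (17 * 2 ^ 52 * β ^ 19 * D ^ 24 * L ^ 12) * (16 * α ^ 2 * β) ^ 18 *
        ((α * β) ^ 4 * (α * D) ^ 4 * (β * L) ^ 4) := by gcongr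
    _ = (17 * 2 ^ 124) * (α ^ 44 * β ^ 45 * D ^ 28 * L ^ 16) := by ring
    _ ≤ 2 ^ 133 * (α ^ 44 * β ^ 45 * D ^ 28 * L ^ 16) := by
        gcongr; norm_num

lemma main_bound (p : ℕ) [Fact p.Prime] (A B : Finset (ZMod p)) (h0A : (0 : ZMod p) ∉ A)
    (h0B : (0 : ZMod p) ∉ B) (G : Finset (ZMod p × ZMod p)) (hG : G ⊆ A ×ˢ B) (hGne : G.Nonempty)
    (hpe : (G.card : ℝ) ^ 2 ≤ p * (B.card : ℝ) ^ 2) :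
    (G.card : ℝ) ^ 67 ≤ 2 ^ 133 * ((A.card : ℝ) ^ 44 * (B.card : ℝ) ^ 45 *
      ((G.image fun x => x.1 - x.2).card : ℝ) ^ 28 *
      ((G.image fun x => x.1 / x.2).card : ℝ) ^ 16) := by
  have hp : (0 : ℝ) < p := by exact_mod_cast (Fact.out : p.Prime).pos
  have hm : ∀ q ∈ G, q.1 ∈ A ∧ q.2 ∈ B := fun q hq => mem_product.1 (hG hq)
  have hne : ∀ q ∈ G, q.1 ≠ 0 ∧ q.2 ≠ 0 := fun q hq =>
    ⟨fun e => h0A (e ▸ (hm q hq).1), fun e => h0B (e ▸ (hm q hq).2)⟩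
  have hAne : A.Nonempty := by obtain ⟨q, hq⟩ := hGne; exact ⟨_, (hm q hq).1⟩
  have hBne : B.Nonempty := by obtain ⟨q, hq⟩ := hGne; exact ⟨_, (hm q hq).2⟩
  have t1 : G.card ≤ A.card * B.card := by rw [← card_product]; exact card_le_card hG
  have t2 : G.card ≤ A.card * (G.image fun x => x.1 - x.2).card := by
    rw [← card_product]
    refine card_le_card_of_injOn (fun q => (q.1, q.1 - q.2)) ?_ ?_
    · intro q hq
      exact mem_coe.2 (mem_product.2 ⟨(hm q hq).1,
        mem_image_of_mem (fun x : ZMod p × ZMod p => x.1 - x.2) hq⟩)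
    · rintro ⟨a, b⟩ hq ⟨a', b'⟩ hq' e
      simp only [Prod.mk.injEq] at e ⊢
      obtain ⟨rfl, e⟩ := e
      exact ⟨rfl, sub_right_injective e⟩
  have t3 : G.card ≤ A.card * (G.image fun x => x.1 / x.2).card := by
    rw [← card_product]
    refine card_le_card_of_injOn (fun q => (q.1, q.1 / q.2)) ?_ ?_
    · intro q hq
      exact mem_coe.2 (mem_product.2 ⟨(hm q hq).1,
        mem_image_of_mem (fun x : ZMod p × ZMod p => x.1 / x.2) hq⟩)
    · rintro ⟨a, b⟩ hq ⟨a', b'⟩ hq' e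
      simp only [Prod.mk.injEq] at e ⊢
      obtain ⟨rfl, e⟩ := e
      rw [div_eq_div_iff (hne _ hq).2 (hne _ hq').2] at e
      exact ⟨rfl, (mul_left_cancel₀ (hne _ hq).1 e).symm⟩
  have t4 : G.card ≤ B.card * (G.image fun x => x.1 / x.2).card := by
    rw [← card_product]
    refine card_le_card_of_injOn (fun q => (q.2, q.1 / q.2)) ?_ ?_
    · intro q hq
      exact mem_coe.2 (mem_product.2 ⟨(hm q hq).2,
        mem_image_of_mem (fun x : ZMod p × ZMod p => x.1 / x.2) hq⟩)
    · rintro ⟨a, b⟩ hq ⟨a', b'⟩ hq' e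
      simp only [Prod.mk.injEq] at e ⊢
      obtain ⟨rfl, e⟩ := e
      exact ⟨(div_left_inj' (hne _ hq).2).1 e, rfl⟩
  have t1' : (G.card : ℝ) ≤ A.card * B.card := by exact_mod_cast t1
  have t2' : (G.card : ℝ) ≤ A.card * (G.image fun x => x.1 - x.2).card := by exact_mod_cast t2
  have t3' : (G.card : ℝ) ≤ A.card * (G.image fun x => x.1 / x.2).card := by exact_mod_cast t3
  have t4' : (G.card : ℝ) ≤ B.card * (G.image fun x => x.1 / x.2).card := by exact_mod_cast t4
  have he : (0 : ℝ) < G.card := by exact_mod_cast hGne.card_pos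
  have hα : (0 : ℝ) < A.card := by exact_mod_cast hAne.card_pos
  have hβ : (0 : ℝ) < B.card := by exact_mod_cast hBne.card_pos
  have hD : (0 : ℝ) < (G.image fun x => x.1 - x.2).card := by
    exact_mod_cast (hGne.image _).card_pos
  have hL : (0 : ℝ) < (G.image fun x => x.1 / x.2).card := by
    exact_mod_cast (hGne.image _).card_pos
  obtain ⟨τ, hτdef⟩ : ∃ τ : ℝ, τ = (G.card : ℝ) ^ 2 / (16 * (A.card : ℝ) ^ 2 * B.card) := ⟨_, rfl⟩
  have hτ : 0 < τ := by rw [hτdef]; positivity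
  have hτe : τ * (16 * (A.card : ℝ) ^ 2 * B.card) = (G.card : ℝ) ^ 2 := by
    rw [hτdef]; field_simp
  obtain ⟨A1, hA1, hA1ne, hA1c, hA1b⟩ := bsg_choose A B G hG hGne τ hτe
  obtain ⟨A', hA', hA'c, hA'g⟩ := bsg_refine A1 hA1ne
    (fun a a' => ((comN B G a a').card : ℝ) < τ) hA1b
  have hn1 : (0 : ℝ) < A1.card := by exact_mod_cast hA1ne.card_pos
  have hn : (0 : ℝ) < A'.card := by linarith
  have hA'ne : A'.Nonempty := card_pos.1 (by exact_mod_cast hn)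
  have h0A' : (0 : ZMod p) ∉ A' := fun h => h0A (hA1 (hA' h))
  have hdiff := bsg_diff B A1 A' G τ hτ.le hA'g
  have hen := bsg_energy B A1 A' G h0A' h0B τ hτ.le hA' hA'c hA'g
  have hΔ : (0 : ℝ) < (A' - A').card := by exact_mod_cast (hA'ne.sub hA'ne).card_pos
  have h1 : (G.card : ℝ) ≤ 2 * A1.card * B.card := by
    refine le_of_sq_le_sq ?_ (by positivity)
    nlinarith [mul_pos (pow_pos hn1 2) (pow_pos hβ 2)]
  obtain ⟨h, hdef⟩ : ∃ h : ℝ, h = (A'.card : ℝ) ^ 2 * τ /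
    (8 * ((G.image fun x => x.1 / x.2).card : ℝ) ^ 2) := ⟨_, rfl⟩
  have hh0 : 0 < h := by rw [hdef]; positivity
  have hh : h * (8 * ((G.image fun x => x.1 / x.2).card : ℝ) ^ 2) = (A'.card : ℝ) ^ 2 * τ := by
    rw [hdef]; field_simp
  have hE : 2 * (A'.card : ℝ) ^ 2 * h ≤ (((A' ×ˢ A') ×ˢ (A' ×ˢ A')).filter
      (fun q => q.1.1 / q.1.2 = q.2.1 / q.2.2)).card := by
    refine le_of_mul_le_mul_left (le_trans (le_of_eq ?_) hen)
      (show (0 : ℝ) < 4 * ((G.image fun x => x.1 / x.2).card : ℝ) ^ 2 by positivity)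
    linear_combination (A'.card : ℝ) ^ 2 * hh
  rcases sum_prod_alt p A' hA'ne h0A' h hh0 hE with hcase | hcase
  · exact numeric_A _ _ _ _ _ _ _ _ _ _ he hα hβ hD hL hn hn1 hΔ hτ hτe h1 hA'c hdiff hh hcase
      t1' t3' t4'
  · exact numeric_B _ _ _ _ _ _ _ _ _ _ _ he hα hβ hD hL hn hn1 hΔ hτ hp hτe h1 hA'c hdiff hh
      hcase hpe t1' t2' t4'

theorem stmt10 :
    ∃ c₀ : ℝ, 0 < c₀ ∧
      ∀ ε : ℝ, 0 < ε → ∃ C : ℝ, 0 < C ∧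
        ∀ (p : ℕ) [Fact p.Prime],
          ∀ A B : Finset (ZMod p), A.Nonempty → B.Nonempty →
            (0 : ZMod p) ∉ A → (0 : ZMod p) ∉ B →
            ∀ G ⊆ A ×ˢ B,
              (G.card : ℝ) ≤ c₀ * (p : ℝ) ^ ((1 : ℝ) / 2) * (B.card : ℝ) →
              (G.card : ℝ) ^ 67 ≤
                C * ((A.card : ℝ) ^ 44 * (B.card : ℝ) ^ 45 *
                    ((G.image fun x => x.1 - x.2).card : ℝ) ^ 28 *
                    ((G.image fun x => x.1 / x.2).card : ℝ) ^ 16) ^ ((1 : ℝ) + ε) := by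
  refine ⟨1, one_pos, fun ε hε => ⟨2 ^ 133, by positivity, ?_⟩⟩
  intro p _ A B hA hB h0A h0B G hG hp
  rcases G.eq_empty_or_nonempty with rfl | hGne
  · simp only [card_empty, Nat.cast_zero]
    rw [zero_pow (by norm_num)]
    positivity
  have hpe : (G.card : ℝ) ^ 2 ≤ p * (B.card : ℝ) ^ 2 := by
    rw [one_mul, ← Real.sqrt_eq_rpow] at hp
    calc (G.card : ℝ) ^ 2 ≤ (Real.sqrt p * (B.card : ℝ)) ^ 2 := by gcongr
      _ = p * (B.card : ℝ) ^ 2 := by rw [mul_pow, Real.sq_sqrt (Nat.cast_nonneg p)]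
  refine (main_bound p A B h0A h0B G hG hGne hpe).trans ?_
  have h1 : (1 : ℝ) ≤ A.card := by exact_mod_cast hA.card_pos
  have h2 : (1 : ℝ) ≤ B.card := by exact_mod_cast hB.card_pos
  have h3 : (1 : ℝ) ≤ (G.image fun x => x.1 - x.2).card := by
    exact_mod_cast (hGne.image _).card_pos
  have h4 : (1 : ℝ) ≤ (G.image fun x => x.1 / x.2).card := by
    exact_mod_cast (hGne.image _).card_pos
  have hX : (1 : ℝ) ≤ (A.card : ℝ) ^ 44 * (B.card : ℝ) ^ 45 *
      ((G.image fun x => x.1 - x.2).card : ℝ) ^ 28 *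
      ((G.image fun x => x.1 / x.2).card : ℝ) ^ 16 :=
    one_le_mul_of_one_le_of_one_le (one_le_mul_of_one_le_of_one_le
      (one_le_mul_of_one_le_of_one_le (one_le_pow₀ h1) (one_le_pow₀ h2)) (one_le_pow₀ h3))
      (one_le_pow₀ h4)
  refine mul_le_mul_of_nonneg_left ?_ (by positivity)
  calc _ = ((A.card : ℝ) ^ 44 * (B.card : ℝ) ^ 45 *
      ((G.image fun x => x.1 - x.2).card : ℝ) ^ 28 *
      ((G.image fun x => x.1 / x.2).card : ℝ) ^ 16) ^ (1 : ℝ) := (Real.rpow_one _).symm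
    _ ≤ _ := Real.rpow_le_rpow_of_exponent_le hX (by linarith)
end

section
/- There exist absolute constants c > 0 and C > 0 such that for every prime p, all finite nonempty sets A, B ⊆ F_p with 0 ∉ A and 0 ∉ B, and every nonempty G ⊆ A × B, there exists a subset A' ⊆ A with |A'| ≥ c·|G|/|B| satisfying all of: (1) |A' − A'| ≤ C · |A −_G B|⁴ · |A|⁴ · |B|³ / |G|⁵; (2) |A'/A'| ≤ C · |A /_G B|⁴ · |A|⁴ · |B|³ / |G|⁵; and (3) E_×(A') ≥ c · |G|² · |A'|⁴ / (|A /_G B|² · |A|² · |B|). -/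
/-- The multiplicative energy of a finite set: the number of quadruples `(a,b,c,d)`
with `a*b = c*d`. -/
def multEnergy {α : Type*} [Mul α] [DecidableEq α] (A : Finset α) : ℕ :=
  (((A ×ˢ A) ×ˢ (A ×ˢ A)).filter fun x => x.1.1 * x.1.2 = x.2.1 * x.2.2).card

lemma div_inj_aux {K : Type*} [Field K] {a b c : K} (ha : a ≠ 0) (h : a / b = a / c) : b = c := by
  rw [div_eq_mul_inv, div_eq_mul_inv] at h
  exact inv_injective (mul_left_cancel₀ ha h)

open Finset in
lemma count_aux {σ κ π β : Type*} [DecidableEq β] [DecidableEq κ]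
    (S : Finset σ) (Q : Finset κ) (P : σ → Finset π) (f : σ → β) (φ : σ → π → κ) (g : κ → β)
    (T : ℝ) (hmap : ∀ s ∈ S, ∀ x ∈ P s, φ s x ∈ Q)
    (hinj : ∀ s ∈ S, ∀ x ∈ P s, ∀ y ∈ P s, φ s x = φ s y → x = y)
    (hg : ∀ s ∈ S, ∀ x ∈ P s, g (φ s x) = f s)
    (hT : ∀ s ∈ S, T ≤ ((P s).card : ℝ)) :
    ((S.image f).card : ℝ) * T ≤ (Q.card : ℝ) := by
  have h1 : ∀ v ∈ S.image f, T ≤ ((Q.filter fun q => g q = v).card : ℝ) := by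
    intro v hv
    obtain ⟨s, hs, rfl⟩ := Finset.mem_image.1 hv
    refine (hT s hs).trans ?_
    have : (P s).card ≤ (Q.filter fun q => g q = f s).card := by
      apply Finset.card_le_card_of_injOn (φ s)
      · intro x hx
        simp only [Finset.coe_filter, Set.mem_ofPred_eq]
        exact ⟨hmap s hs x hx, hg s hs x hx⟩
      · intro x hx y hy h
        exact hinj s hs x hx y hy h
    exact_mod_cast this
  have h2 : ∑ v ∈ S.image f, (Q.filter fun q => g q = v).card ≤ Q.card := by
    rw [← Finset.card_biUnion]
    · apply Finset.card_le_card
      intro x hx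
      simp only [Finset.mem_biUnion, Finset.mem_filter] at hx
      obtain ⟨_, _, h, _⟩ := hx
      exact h
    · intro v _ w _ hvw
      rw [Function.onFun, Finset.disjoint_left]
      intro q hq hq'
      simp only [Finset.mem_filter] at hq hq'
      exact hvw (hq.2.symm.trans hq'.2)
  calc ((S.image f).card : ℝ) * T = ∑ v ∈ S.image f, T := by simp
    _ ≤ ∑ v ∈ S.image f, ((Q.filter fun q => g q = v).card : ℝ) := Finset.sum_le_sum h1
    _ ≤ (Q.card : ℝ) := by exact_mod_cast h2

lemma cs_aux {σ β : Type*} [DecidableEq β] (S : Finset σ) (f : σ → β) :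
    S.card ^ 2 ≤ (S.image f).card * ((S ×ˢ S).filter fun x => f x.1 = f x.2).card := by
  have h1 : S.card = ∑ v ∈ S.image f, (S.filter fun s => f s = v).card :=
    Finset.card_eq_sum_card_image f S
  have h2 : ((S ×ˢ S).filter fun x => f x.1 = f x.2).card
      = ∑ v ∈ S.image f, (S.filter fun s => f s = v).card ^ 2 := by
    rw [Finset.card_eq_sum_card_fiberwise (f := fun x : σ × σ => f x.1) (t := S.image f)]
    · apply Finset.sum_congr rfl
      intro v _
      rw [sq, ← Finset.card_product]
      congr 1
      ext ⟨a, b⟩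
      simp only [Finset.mem_filter, Finset.mem_product]
      constructor
      · rintro ⟨⟨⟨h1, h2⟩, h3⟩, h4⟩
        exact ⟨⟨h1, h4⟩, h2, h3 ▸ h4⟩
      · rintro ⟨⟨h1, h2⟩, h3, h4⟩
        exact ⟨⟨⟨h1, h3⟩, h2.trans h4.symm⟩, h2⟩
    · intro x hx
      simp only [Finset.coe_filter, Finset.mem_product, Set.mem_ofPred_eq] at hx
      exact Finset.mem_coe.2 (Finset.mem_image_of_mem _ hx.1.1)
  rw [h2, h1]
  exact sq_sum_le_card_mul_sum_sq

/-- common neighbours -/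
def codN {α : Type*} [DecidableEq α] (B : Finset α) (G : Finset (α × α)) (a a' : α) : Finset α :=
  B.filter fun b => (a, b) ∈ G ∧ (a', b) ∈ G

/-- paths of length four -/
def path4 {α : Type*} [DecidableEq α] (A B : Finset α) (G : Finset (α × α)) (a a' : α) :
    Finset (α × α × α) :=
  (A ×ˢ B ×ˢ B).filter fun x =>
    ((a, x.2.1) ∈ G ∧ (x.1, x.2.1) ∈ G) ∧ ((x.1, x.2.2) ∈ G ∧ (a', x.2.2) ∈ G)

lemma path4_card {α : Type*} [DecidableEq α] (A B : Finset α) (G : Finset (α × α)) (a a' : α) :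
    (path4 A B G a a').card = ∑ m ∈ A, (codN B G a m).card * (codN B G m a').card := by
  rw [Finset.card_eq_sum_card_fiberwise (f := fun x : α × α × α => x.1) (t := A)]
  · apply Finset.sum_congr rfl
    intro m hm
    rw [← Finset.card_product]
    symm
    apply Finset.card_bij (fun x _ => (m, x.1, x.2))
    · rintro ⟨x, y⟩ h
      simp only [path4, codN, Finset.mem_filter, Finset.mem_product] at h ⊢
      tauto
    · rintro ⟨x, y⟩ _ ⟨x', y'⟩ _ h
      simpa using h
    · rintro ⟨n, x, y⟩ h
      simp only [path4, codN, Finset.mem_filter, Finset.mem_product] at h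
      obtain ⟨h, rfl⟩ := h
      refine ⟨(x, y), ?_, rfl⟩
      simp only [codN, Finset.mem_filter, Finset.mem_product]
      tauto
  · intro x hx
    simp only [path4, Finset.coe_filter, Finset.mem_product, Set.mem_ofPred_eq] at hx
    exact hx.1.1

lemma codN_comm {α : Type*} [DecidableEq α] (B : Finset α) (G : Finset (α × α)) (a a' : α) :
    codN B G a a' = codN B G a' a := by
  simp only [codN, and_comm]

lemma graph_aux1 {α : Type*} [DecidableEq α] (A B : Finset α) (G : Finset (α × α))
    (hB : B.Nonempty) (hA : A.Nonempty) (hG : G ⊆ A ×ˢ B) (bad : α → α → Prop)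
    [∀ a a', Decidable (bad a a')]
    (hbad : ∀ a a', bad a a' →
      ((codN B G a a').card : ℝ) ≤ (G.card : ℝ) ^ 2 / (32 * (A.card : ℝ) ^ 2 * B.card)) :
    ∃ N ⊆ A, (G.card : ℝ) ^ 2 / (2 * (B.card : ℝ) ^ 2)
      + 16 * (((N ×ˢ N).filter fun x => bad x.1 x.2).card : ℝ) ≤ (N.card : ℝ) ^ 2 := by
  set N : α → Finset α := fun b => A.filter fun a => (a, b) ∈ G with hN
  have hBpos : (0 : ℝ) < B.card := by exact_mod_cast hB.card_pos
  have hApos : (0 : ℝ) < A.card := by exact_mod_cast hA.card_pos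
  have hGc : G.card = ∑ b ∈ B, (N b).card := by
    rw [Finset.card_eq_sum_card_fiberwise (f := fun x : α × α => x.2) (t := B)]
    · apply Finset.sum_congr rfl
      intro b hb
      symm
      apply Finset.card_bij (fun x _ => (x, b))
      · intro x h
        simp only [hN, Finset.mem_filter] at h ⊢
        exact ⟨h.2, trivial⟩
      · intro x _ y _ h
        simpa using h
      · rintro ⟨x, y⟩ h
        simp only [Finset.mem_filter] at h
        obtain ⟨h, rfl⟩ := h
        refine ⟨x, ?_, rfl⟩
        simp only [hN, Finset.mem_filter]
        exact ⟨(Finset.mem_product.1 (hG h)).1, h⟩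
    · intro x hx
      exact (Finset.mem_product.1 (hG hx)).2
  have hsq : (G.card : ℝ) ^ 2 ≤ B.card * ∑ b ∈ B, ((N b).card : ℝ) ^ 2 := by
    rw [hGc]; push_cast
    exact sq_sum_le_card_mul_sum_sq
  have hdc : ∑ b ∈ B, (((N b ×ˢ N b).filter fun x => bad x.1 x.2).card)
      = ∑ x ∈ (A ×ˢ A).filter (fun x => bad x.1 x.2), (codN B G x.1 x.2).card := by
    have := Finset.sum_card_bipartiteAbove_eq_sum_card_bipartiteBelow
      (s := B) (t := (A ×ˢ A).filter (fun x => bad x.1 x.2))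
      (fun b x => (x.1, b) ∈ G ∧ (x.2, b) ∈ G)
    refine Eq.trans (Finset.sum_congr rfl fun b _ => ?_) this
    congr 1
    ext x
    simp only [hN, Finset.bipartiteAbove, Finset.mem_filter, Finset.mem_product]
    tauto
  have hbs : ∑ b ∈ B, (((N b ×ˢ N b).filter fun x => bad x.1 x.2).card : ℝ)
      ≤ (G.card : ℝ) ^ 2 / (32 * B.card) := by
    have e : ∑ b ∈ B, (((N b ×ˢ N b).filter fun x => bad x.1 x.2).card : ℝ)
      = ∑ x ∈ (A ×ˢ A).filter (fun x => bad x.1 x.2), ((codN B G x.1 x.2).card : ℝ) := by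
      exact_mod_cast hdc
    rw [e]
    have h1 := Finset.sum_le_card_nsmul ((A ×ˢ A).filter (fun x => bad x.1 x.2))
      (fun x => ((codN B G x.1 x.2).card : ℝ)) ((G.card : ℝ) ^ 2 / (32 * (A.card : ℝ) ^ 2 * B.card))
      (fun x hx => hbad _ _ (Finset.mem_filter.1 hx).2)
    refine h1.trans ?_
    rw [nsmul_eq_mul]
    have h2 : (((A ×ˢ A).filter (fun x => bad x.1 x.2)).card : ℝ) ≤ (A.card : ℝ) ^ 2 := by
      have := Finset.card_filter_le (A ×ˢ A) (fun x => bad x.1 x.2)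
      rw [Finset.card_product, ← sq] at this
      exact_mod_cast this
    calc _ ≤ (A.card : ℝ) ^ 2 * ((G.card : ℝ) ^ 2 / (32 * (A.card : ℝ) ^ 2 * B.card)) := by
          gcongr
      _ = _ := by field_simp
  have hex : ∃ b ∈ B, (G.card : ℝ) ^ 2 / (2 * (B.card : ℝ) ^ 2)
      + 16 * (((N b ×ˢ N b).filter fun x => bad x.1 x.2).card : ℝ) ≤ ((N b).card : ℝ) ^ 2 := by
    apply Finset.exists_le_of_sum_le hB
    rw [Finset.sum_add_distrib, ← Finset.mul_sum, Finset.sum_const, nsmul_eq_mul]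
    have h3 : (G.card : ℝ) ^ 2 / B.card ≤ ∑ b ∈ B, ((N b).card : ℝ) ^ 2 := by
      rw [div_le_iff₀ hBpos]; linarith
    have h4 : (B.card : ℝ) * ((G.card : ℝ) ^ 2 / (2 * (B.card : ℝ) ^ 2))
      = (G.card : ℝ) ^ 2 / B.card / 2 := by field_simp
    have h5 : (G.card : ℝ) ^ 2 / (32 * B.card) = (G.card : ℝ) ^ 2 / B.card / 32 := by field_simp
    rw [h4]; rw [h5] at hbs
    linarith
  obtain ⟨b, hb, h⟩ := hex
  exact ⟨N b, Finset.filter_subset _ _, h⟩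

lemma graph_aux {α : Type*} [DecidableEq α] (A B : Finset α) (G : Finset (α × α))
    (hB : B.Nonempty) (hA : A.Nonempty) (hG : G ⊆ A ×ˢ B) (hG0 : G.Nonempty) :
    ∃ A' ⊆ A, (G.card : ℝ) / (4 * B.card) ≤ (A'.card : ℝ) ∧
      (∀ a ∈ A', ∀ a' ∈ A', (G.card : ℝ) ^ 5 / (4096 * (A.card : ℝ) ^ 4 * (B.card : ℝ) ^ 3) ≤
        ((path4 A B G a a').card : ℝ)) ∧
      ∃ S ⊆ A' ×ˢ A', (A'.card : ℝ) ^ 2 / 2 ≤ (S.card : ℝ) ∧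
        ∀ x ∈ S, (G.card : ℝ) ^ 2 / (32 * (A.card : ℝ) ^ 2 * B.card) ≤
          ((codN B G x.1 x.2).card : ℝ) := by
  classical
  have hBpos : (0 : ℝ) < B.card := by exact_mod_cast hB.card_pos
  have hApos : (0 : ℝ) < A.card := by exact_mod_cast hA.card_pos
  have hGpos : (0 : ℝ) < G.card := by exact_mod_cast hG0.card_pos
  set τ : ℝ := (G.card : ℝ) ^ 2 / (32 * (A.card : ℝ) ^ 2 * B.card) with hτ
  have hτ0 : 0 ≤ τ := by positivity
  set bad : α → α → Prop := fun a a' => ((codN B G a a').card : ℝ) < τ with hbd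
  obtain ⟨N, hNA, hN⟩ := graph_aux1 A B G hB hA hG bad (fun a a' h => le_of_lt h)
  have hNG : (G.card : ℝ) / (2 * B.card) ≤ N.card := by
    refine (sq_le_sq₀ (by positivity) (by positivity)).1 ?_
    have e : ((G.card : ℝ) / (2 * B.card)) ^ 2 = (G.card : ℝ) ^ 2 / (2 * (B.card : ℝ) ^ 2) / 2 := by
      field_simp
    have : 0 ≤ (G.card : ℝ) ^ 2 / (2 * (B.card : ℝ) ^ 2) := by positivity
    have : 0 ≤ (((N ×ˢ N).filter fun x => bad x.1 x.2).card : ℝ) := by positivity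
    rw [e]; linarith
  have hNpos : (0 : ℝ) < N.card := lt_of_lt_of_le (by positivity) hNG
  have hbadN : 16 * (((N ×ˢ N).filter fun x => bad x.1 x.2).card : ℝ) ≤ (N.card : ℝ) ^ 2 := by
    have : 0 ≤ (G.card : ℝ) ^ 2 / (2 * (B.card : ℝ) ^ 2) := by positivity
    linarith
  set A' := N.filter fun a => ((N.filter fun m => bad a m).card : ℝ) ≤ N.card / 8 with hA'
  have hA'N : A' ⊆ N := Finset.filter_subset _ _
  have hsum : ((N ×ˢ N).filter fun x => bad x.1 x.2).card
      = ∑ a ∈ N, (N.filter fun m => bad a m).card := by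
    simp only [Finset.card_filter, Finset.sum_product]
  have hA'card : (N.card : ℝ) / 2 ≤ A'.card := by
    have h1 : ((N.filter fun a => ¬ ((N.filter fun m => bad a m).card : ℝ) ≤ N.card / 8).card : ℝ)
        * (N.card / 8) ≤ (((N ×ˢ N).filter fun x => bad x.1 x.2).card : ℝ) := by
      rw [hsum]; push_cast
      rw [← nsmul_eq_mul]
      refine (Finset.card_nsmul_le_sum _
        (fun a => ((N.filter fun m => bad a m).card : ℝ)) _ ?_).trans ?_
      · intro a ha
        exact le_of_lt (not_le.1 (Finset.mem_filter.1 ha).2)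
      · apply Finset.sum_le_sum_of_subset_of_nonneg (Finset.filter_subset _ _)
        intros; positivity
    have h2 : (A'.card : ℝ) + ((N.filter fun a =>
        ¬ ((N.filter fun m => bad a m).card : ℝ) ≤ N.card / 8).card : ℝ) = N.card := by
      exact_mod_cast Finset.card_filter_add_card_filter_not (s := N)
        (fun a => ((N.filter fun m => bad a m).card : ℝ) ≤ N.card / 8)
    by_contra hcon
    push Not at hcon
    nlinarith
  refine ⟨A', hA'N.trans hNA, ?_, ?_, ?_⟩
  · have : (G.card : ℝ) / (4 * B.card) = (G.card : ℝ) / (2 * B.card) / 2 := by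
      field_simp; norm_num
    rw [this]; linarith
  · intro a ha a' ha'
    have h1 := (Finset.mem_filter.1 ha).2
    have h2 := (Finset.mem_filter.1 ha').2
    set M := N.filter fun m => ¬ bad a m ∧ ¬ bad a' m with hM
    have hMc : 3 / 4 * (N.card : ℝ) ≤ M.card := by
      have : N.card ≤ M.card + (N.filter fun m => bad a m).card
          + (N.filter fun m => bad a' m).card := by
        refine le_trans (Finset.card_le_card (t := (M ∪ (N.filter fun m => bad a m)) ∪
          (N.filter fun m => bad a' m)) ?_) ((Finset.card_union_le _ _).trans
            (Nat.add_le_add_right (Finset.card_union_le _ _) _))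
        intro m hm
        simp only [hM, Finset.mem_union, Finset.mem_filter]
        tauto
      have : (N.card : ℝ) ≤ M.card + (N.filter fun m => bad a m).card
          + (N.filter fun m => bad a' m).card := by exact_mod_cast this
      linarith
    rw [path4_card]; push_cast
    have h3 : (M.card : ℝ) * (τ * τ) ≤
        ∑ m ∈ M, ((codN B G a m).card : ℝ) * ((codN B G m a').card : ℝ) := by
      rw [← nsmul_eq_mul]
      apply Finset.card_nsmul_le_sum
      intro m hm
      obtain ⟨_, h4, h5⟩ := Finset.mem_filter.1 hm
      rw [codN_comm B G m a']
      exact mul_le_mul (not_lt.1 h4) (not_lt.1 h5) hτ0 (by positivity)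
    have h4 : ∑ m ∈ M, ((codN B G a m).card : ℝ) * ((codN B G m a').card : ℝ) ≤
        ∑ m ∈ A, ((codN B G a m).card : ℝ) * ((codN B G m a').card : ℝ) := by
      apply Finset.sum_le_sum_of_subset_of_nonneg ((Finset.filter_subset _ _).trans hNA)
      intros; positivity
    refine le_trans ?_ (h3.trans h4)
    have h5 : 3 / 4 * ((G.card : ℝ) / (2 * B.card)) ≤ M.card := by linarith
    calc (G.card : ℝ) ^ 5 / (4096 * (A.card : ℝ) ^ 4 * (B.card : ℝ) ^ 3)
        ≤ 3 / 4 * ((G.card : ℝ) / (2 * B.card)) * (τ * τ) := by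
          have : 3 / 4 * ((G.card : ℝ) / (2 * B.card)) * (τ * τ)
            = 3 / 2 * ((G.card : ℝ) ^ 5 / (4096 * (A.card : ℝ) ^ 4 * (B.card : ℝ) ^ 3)) := by
            rw [hτ]; field_simp; norm_num
          rw [this]
          have : 0 ≤ (G.card : ℝ) ^ 5 / (4096 * (A.card : ℝ) ^ 4 * (B.card : ℝ) ^ 3) := by
            positivity
          linarith
      _ ≤ _ := by gcongr
  · refine ⟨(A' ×ˢ A').filter fun x => ¬ bad x.1 x.2, Finset.filter_subset _ _, ?_, ?_⟩
    · have h1 : (((A' ×ˢ A').filter fun x => bad x.1 x.2).card : ℝ)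
          + (((A' ×ˢ A').filter fun x => ¬ bad x.1 x.2).card : ℝ) = (A'.card : ℝ) ^ 2 := by
        have := Finset.card_filter_add_card_filter_not (s := A' ×ˢ A') (fun x => bad x.1 x.2)
        rw [Finset.card_product, ← sq] at this
        exact_mod_cast this
      have h2 : (((A' ×ˢ A').filter fun x => bad x.1 x.2).card : ℝ) ≤ A'.card * (N.card / 8) := by
        have e : ((A' ×ˢ A').filter fun x => bad x.1 x.2).card
            = ∑ a ∈ A', (A'.filter fun m => bad a m).card := by
          simp only [Finset.card_filter, Finset.sum_product]
        rw [e]; push_cast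
        rw [← nsmul_eq_mul]
        apply Finset.sum_le_card_nsmul
        intro a ha
        refine le_trans ?_ (Finset.mem_filter.1 ha).2
        exact_mod_cast Finset.card_le_card (Finset.filter_subset_filter _ hA'N)
      nlinarith
    · intro x hx
      exact not_lt.1 (Finset.mem_filter.1 hx).2

theorem stmt11 :
    ∃ c C : ℝ, 0 < c ∧ 0 < C ∧
      ∀ (p : ℕ) [Fact p.Prime],
        ∀ A B : Finset (ZMod p), A.Nonempty → B.Nonempty →
          (0 : ZMod p) ∉ A → (0 : ZMod p) ∉ B →
          ∀ G ⊆ A ×ˢ B, G.Nonempty →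
            ∃ A' ⊆ A, c * (G.card : ℝ) / (B.card : ℝ) ≤ (A'.card : ℝ) ∧
              (((A' ×ˢ A').image fun x => x.1 - x.2).card : ℝ) ≤
                C * ((G.image fun x => x.1 - x.2).card : ℝ) ^ 4 * (A.card : ℝ) ^ 4 *
                  (B.card : ℝ) ^ 3 / (G.card : ℝ) ^ 5 ∧
              (((A' ×ˢ A').image fun x => x.1 / x.2).card : ℝ) ≤
                C * ((G.image fun x => x.1 / x.2).card : ℝ) ^ 4 * (A.card : ℝ) ^ 4 *
                  (B.card : ℝ) ^ 3 / (G.card : ℝ) ^ 5 ∧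
              c * (G.card : ℝ) ^ 2 * (A'.card : ℝ) ^ 4 /
                  (((G.image fun x => x.1 / x.2).card : ℝ) ^ 2 * (A.card : ℝ) ^ 2 *
                    (B.card : ℝ)) ≤
                (multEnergy A' : ℝ) := by
  refine ⟨1 / 128, 4096, by norm_num, by norm_num, ?_⟩
  intro p _ A B hA hB hA0 hB0 G hG hG0
  have hBpos : (0 : ℝ) < B.card := by exact_mod_cast hB.card_pos
  have hApos : (0 : ℝ) < A.card := by exact_mod_cast hA.card_pos
  have hGpos : (0 : ℝ) < G.card := by exact_mod_cast hG0.card_pos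
  have nzA : ∀ x ∈ A, x ≠ 0 := fun x hx h => hA0 (h ▸ hx)
  have nzB : ∀ x ∈ B, x ≠ 0 := fun x hx h => hB0 (h ▸ hx)
  obtain ⟨A', hA', h1, h2, S, hSA, hS, hS2⟩ := graph_aux A B G hB hA hG hG0
  refine ⟨A', hA', ?_, ?_, ?_, ?_⟩
  · refine le_trans ?_ h1
    rw [div_le_div_iff₀ hBpos (by positivity)]
    nlinarith [mul_pos hGpos hBpos]
  · set D := G.image fun x => x.1 - x.2 with hD
    have memD : ∀ x y, (x, y) ∈ G → x - y ∈ D := fun x y h =>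
      Finset.mem_image.2 ⟨(x, y), h, rfl⟩
    have := count_aux (A' ×ˢ A') (D ×ˢ D ×ˢ D ×ˢ D) (fun s => path4 A B G s.1 s.2)
      (fun x => x.1 - x.2)
      (fun s x => (s.1 - x.2.1, x.1 - x.2.1, x.1 - x.2.2, s.2 - x.2.2))
      (fun q => q.1 - q.2.1 + q.2.2.1 - q.2.2.2)
      ((G.card : ℝ) ^ 5 / (4096 * (A.card : ℝ) ^ 4 * (B.card : ℝ) ^ 3))
      (by
        rintro ⟨a, a'⟩ hs ⟨m, b, b'⟩ hx
        simp only [path4, Finset.mem_filter, Finset.mem_product] at hx ⊢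
        exact ⟨memD _ _ hx.2.1.1, memD _ _ hx.2.1.2, memD _ _ hx.2.2.1, memD _ _ hx.2.2.2⟩)
      (by
        rintro ⟨a, a'⟩ hs ⟨m, b, b'⟩ hx ⟨n, d, d'⟩ hy h
        simp only [Prod.mk.injEq] at h ⊢
        obtain ⟨e1, e2, e3, e4⟩ := h
        have e1 := sub_right_injective e1
        have e4 := sub_right_injective e4
        subst e1 e4
        exact ⟨sub_left_injective e2, rfl, rfl⟩)
      (by
        rintro ⟨a, a'⟩ hs ⟨m, b, b'⟩ hx
        simp only
        ring)
      (fun s hs => h2 _ (Finset.mem_product.1 hs).1 _ (Finset.mem_product.1 hs).2)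
    simp only [Finset.card_product] at this
    push_cast at this
    rw [mul_div_assoc', div_le_iff₀ (by positivity)] at this
    rw [le_div_iff₀ (by positivity)]
    linarith
  · set D := G.image fun x => x.1 / x.2 with hD
    have memD : ∀ x y, (x, y) ∈ G → x / y ∈ D := fun x y h =>
      Finset.mem_image.2 ⟨(x, y), h, rfl⟩
    have := count_aux (A' ×ˢ A') (D ×ˢ D ×ˢ D ×ˢ D) (fun s => path4 A B G s.1 s.2)
      (fun x => x.1 / x.2)
      (fun s x => (s.1 / x.2.1, x.1 / x.2.1, x.1 / x.2.2, s.2 / x.2.2))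
      (fun q => q.1 / q.2.1 * q.2.2.1 / q.2.2.2)
      ((G.card : ℝ) ^ 5 / (4096 * (A.card : ℝ) ^ 4 * (B.card : ℝ) ^ 3))
      (by
        rintro ⟨a, a'⟩ hs ⟨m, b, b'⟩ hx
        simp only [path4, Finset.mem_filter, Finset.mem_product] at hx ⊢
        exact ⟨memD _ _ hx.2.1.1, memD _ _ hx.2.1.2, memD _ _ hx.2.2.1, memD _ _ hx.2.2.2⟩)
      (by
        rintro ⟨a, a'⟩ hs ⟨m, b, b'⟩ hx ⟨n, d, d'⟩ hy h
        simp only [path4, Finset.mem_filter, Finset.mem_product] at hs hx hy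
        simp only [Prod.mk.injEq] at h ⊢
        have a0 := nzA a (hA' hs.1)
        have a0' := nzA a' (hA' hs.2)
        have b0 := nzB _ hx.1.2.1
        obtain ⟨e1, e2, e3, e4⟩ := h
        have e1 := div_inj_aux a0 e1
        have e4 := div_inj_aux a0' e4
        subst e1 e4
        exact ⟨div_left_inj' b0 |>.1 e2, rfl, rfl⟩)
      (by
        rintro ⟨a, a'⟩ hs ⟨m, b, b'⟩ hx
        simp only [path4, Finset.mem_filter, Finset.mem_product] at hs hx
        have a0' := nzA a' (hA' hs.2)
        have m0 := nzA _ hx.1.1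
        have b0 := nzB _ hx.1.2.1
        have b0' := nzB _ hx.1.2.2
        simp only
        field_simp)
      (fun s hs => h2 _ (Finset.mem_product.1 hs).1 _ (Finset.mem_product.1 hs).2)
    simp only [Finset.card_product] at this
    push_cast at this
    rw [mul_div_assoc', div_le_iff₀ (by positivity)] at this
    rw [le_div_iff₀ (by positivity)]
    linarith
  · set D := G.image fun x => x.1 / x.2 with hD
    have hDpos : (0 : ℝ) < D.card := by exact_mod_cast (hG0.image _).card_pos
    have memD : ∀ x y, (x, y) ∈ G → x / y ∈ D := fun x y h =>
      Finset.mem_image.2 ⟨(x, y), h, rfl⟩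
    have h3 := count_aux S (D ×ˢ D) (fun s => codN B G s.1 s.2)
      (fun x => x.1 / x.2) (fun s x => (s.1 / x, s.2 / x)) (fun q => q.1 / q.2)
      ((G.card : ℝ) ^ 2 / (32 * (A.card : ℝ) ^ 2 * B.card))
      (by
        rintro ⟨a, a'⟩ hs b hx
        simp only [codN, Finset.mem_filter, Finset.mem_product] at hx ⊢
        exact ⟨memD _ _ hx.2.1, memD _ _ hx.2.2⟩)
      (by
        rintro ⟨a, a'⟩ hs b hx d hy h
        have hs := Finset.mem_product.1 (hSA hs)
        simp only [Prod.mk.injEq] at h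
        exact div_inj_aux (nzA a (hA' hs.1)) h.1)
      (by
        rintro ⟨a, a'⟩ hs b hx
        simp only [codN, Finset.mem_filter] at hx
        exact div_div_div_cancel_right₀ (nzB _ hx.1) _ _)
      hS2
    have h4 := cs_aux S (fun x => x.1 / x.2)
    have h5 : ((S ×ˢ S).filter fun x => x.1.1 / x.1.2 = x.2.1 / x.2.2).card ≤ multEnergy A' := by
      apply Finset.card_le_card_of_injOn (fun x => ((x.1.1, x.2.2), (x.2.1, x.1.2)))
      · rintro ⟨⟨a, b⟩, ⟨c, d⟩⟩ hx
        simp only [Finset.coe_filter, Set.mem_ofPred_eq, Finset.mem_product] at hx ⊢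
        obtain ⟨⟨hx1, hx2⟩, hx3⟩ := hx
        have hx1 := Finset.mem_product.1 (hSA hx1)
        have hx2 := Finset.mem_product.1 (hSA hx2)
        refine ⟨⟨⟨hx1.1, hx2.2⟩, hx2.1, hx1.2⟩, ?_⟩
        exact (div_eq_div_iff (nzA _ (hA' hx1.2)) (nzA _ (hA' hx2.2))).1 hx3
      · rintro ⟨⟨a, b⟩, ⟨c, d⟩⟩ _ ⟨⟨a', b'⟩, ⟨c', d'⟩⟩ _ h
        simp only [Prod.mk.injEq] at h ⊢
        tauto
    have h6 : (S.card : ℝ) ^ 2 ≤ ((S.image fun x => x.1 / x.2).card : ℝ) * (multEnergy A' : ℝ) := by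
      exact_mod_cast h4.trans (Nat.mul_le_mul_left _ h5)
    have h7 : ((A'.card : ℝ) ^ 2 / 2) ^ 2 ≤
        ((S.image fun x => x.1 / x.2).card : ℝ) * (multEnergy A' : ℝ) :=
      le_trans (by gcongr) h6
    rw [mul_div_assoc', div_le_iff₀ (by positivity), Finset.card_product] at h3
    push_cast at h3
    rw [div_le_iff₀ (by positivity)]
    have h8 := mul_le_mul_of_nonneg_right h7 (sq_nonneg (G.card : ℝ))
    have h9 := mul_le_mul_of_nonneg_right h3 (Nat.cast_nonneg (α := ℝ) (multEnergy A'))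
    nlinarith
end

section
/- There exists an absolute constant c > 0 such that for every prime power q and every finite set A ⊆ F_q(t) with |A| ≥ 2, the set A contains an A-chain C with |C| ≥ c · |A|⁵ / (|A + A|² · |A·A|² · (log|A|)³). -/
open scoped Pointwise

open scoped Classical in
/-- The non-archimedean norm on `F_q(t)`: `|x| = q ^ deg x` for `x ≠ 0`, and `|0| = 0`. -/
noncomputable def ffNorm {F : Type*} [Field F] [Fintype F] (x : RatFunc F) : ℝ :=
  if x = 0 then 0 else (Fintype.card F : ℝ) ^ x.intDegree

/-- A ball in `F_q(t)` with centre `x` and radius `r`. -/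
def ffBall {F : Type*} [Field F] [Fintype F] (x : RatFunc F) (r : ℝ) : Set (RatFunc F) :=
  {y | ffNorm (x - y) ≤ r}

/-- `r_A(a)`: the minimal distance from `a` to another element of `A`. -/
noncomputable def rA {F : Type*} [Field F] [Fintype F] (A : Set (RatFunc F))
    (a : RatFunc F) : ℝ :=
  sInf {r : ℝ | ∃ a' ∈ A, a' ≠ a ∧ r = ffNorm (a - a')}

/-- `B_A(a)`: the ball of radius `r_A(a)` centred at `a`. -/
noncomputable def BA {F : Type*} [Field F] [Fintype F] (A : Set (RatFunc F))
    (a : RatFunc F) : Set (RatFunc F) :=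
  ffBall a (rA A a)

/-- `C` is an `A`-chain: a subset of `A` whose elements can be enumerated
`c₁, …, c_n` with `B_A(c₁) ⊆ ⋯ ⊆ B_A(c_n)`. -/
def IsAChain {F : Type*} [Field F] [Fintype F] (A C : Set (RatFunc F)) : Prop :=
  C ⊆ A ∧ ∃ (n : ℕ) (c : Fin n → RatFunc F), Function.Injective c ∧ C = Set.range c ∧
    ∀ i j : Fin n, i ≤ j → BA A (c i) ⊆ BA A (c j)

lemma rank_bound {α : Type*} (X : Finset α) (f : α → ℝ) (T : ℝ) (hT : 0 ≤ T) :
    ((X.filter fun x => ((X.filter fun y => f y ≤ f x).card : ℝ) ≤ T).card : ℝ) ≤ T := by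
  classical
  rcases (X.filter fun x => ((X.filter fun y => f y ≤ f x).card : ℝ) ≤ T).eq_empty_or_nonempty
    with h | h
  · rw [h]; simpa using hT
  · obtain ⟨x, hx, hmax⟩ := Finset.exists_max_image _ f h
    refine le_trans ?_ (Finset.mem_filter.1 hx).2
    exact_mod_cast Finset.card_le_card (fun y hy =>
      Finset.mem_filter.2 ⟨(Finset.mem_filter.1 hy).1, hmax y hy⟩)

lemma markov_bound {α β : Type*} (A' : Finset α) (X : Finset β) (R : α → β → Prop)
    [∀ a x, Decidable (R a x)] (L : ℝ) (hL : 0 < L) (hA' : A'.Nonempty) (hX : X.Nonempty)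
    (h : ∀ x ∈ X, ((A'.filter fun a => R a x).card : ℝ) ≤ L) :
    ((A'.filter fun a => ¬ ((X.filter fun x => R a x).card : ℝ)
      ≤ 4 * L * X.card / A'.card).card : ℝ) ≤ A'.card / 4 := by
  classical
  set T : ℝ := 4 * L * X.card / A'.card with hT
  have hA0 : (0:ℝ) < A'.card := by exact_mod_cast hA'.card_pos
  have hX0 : (0:ℝ) < X.card := by exact_mod_cast hX.card_pos
  set Bd := A'.filter fun a => ¬ ((X.filter fun x => R a x).card : ℝ) ≤ T
  have h1 : (Bd.card : ℝ) * T ≤ ∑ a ∈ A', ((X.filter fun x => R a x).card : ℝ) := by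
    calc (Bd.card : ℝ) * T = ∑ a ∈ Bd, T := by simp
      _ ≤ ∑ a ∈ Bd, ((X.filter fun x => R a x).card : ℝ) :=
        Finset.sum_le_sum fun a ha => le_of_lt (not_le.1 (Finset.mem_filter.1 ha).2)
      _ ≤ _ := Finset.sum_le_sum_of_subset_of_nonneg (Finset.filter_subset _ _)
        (fun _ _ _ => by positivity)
  have h2 : ∑ a ∈ A', ((X.filter fun x => R a x).card : ℝ)
      = ∑ x ∈ X, ((A'.filter fun a => R a x).card : ℝ) := by
    exact_mod_cast Finset.sum_card_bipartiteAbove_eq_sum_card_bipartiteBelow R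
  have h3 : ∑ x ∈ X, ((A'.filter fun a => R a x).card : ℝ) ≤ X.card * L := by
    calc _ ≤ ∑ x ∈ X, L := Finset.sum_le_sum h
      _ = _ := by simp
  have h4 : (Bd.card : ℝ) * T ≤ X.card * L := by linarith
  rw [hT] at h4
  have h5 : (Bd.card : ℝ) * (4 * L * X.card / A'.card) = (L * X.card) * (4 * Bd.card / A'.card) := by
    ring
  rw [h5, mul_comm (X.card : ℝ) L] at h4
  have h6 : (4 * Bd.card / A'.card : ℝ) ≤ 1 := by
    by_contra hcon
    push Not at hcon
    nlinarith [mul_pos hL hX0]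
  rw [div_le_one hA0] at h6
  linarith

lemma count_bound {k : Type*} [Field k] [DecidableEq k] (N : k → ℝ)
    (hmul : ∀ x y, N (x * y) = N x * N y) (hnn : ∀ x, 0 ≤ N x) (hneg : ∀ x, N (-x) = N x)
    (hpos : ∀ x, x ≠ 0 → 0 < N x)
    (A A' : Finset k) (hA'A : A' ⊆ A) (r : k → ℝ) (L M : ℝ) (hL : 0 < L) (hA' : A'.Nonempty)
    (hA0 : (A.erase 0).Nonempty)
    (hcov : ∀ x, ((A'.filter fun a => N (a - x) ≤ r a).card : ℝ) ≤ L)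
    (hnb : ∀ a ∈ A', M ≤ ((A.filter fun a' => a' ≠ a ∧ N (a - a') ≤ r a).card : ℝ)) (hM : 0 ≤ M) :
    (A'.card : ℝ) ^ 3 * A.card * (A.erase 0).card * M
      ≤ 32 * L ^ 2 * ((A + A).card : ℝ) ^ 2 * ((A * A).card : ℝ) ^ 2 := by
  classical
  have hAne : A.Nonempty := hA'.mono hA'A
  have hS : (A + A).Nonempty := hAne.add hAne
  have hP : (A * A).Nonempty := hAne.mul hAne
  have ha0 : (0:ℝ) < A'.card := by exact_mod_cast hA'.card_pos
  set T1 : ℝ := 4 * L * (A + A).card / A'.card with hT1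
  set T2 : ℝ := 4 * L * (A * A).card / A'.card with hT2
  have hT1n : 0 ≤ T1 := by positivity
  have hT2n : 0 ≤ T2 := by positivity
  have m1 : ∀ b, ((A'.filter fun a => ¬ (((A + A).filter fun v => N (a - (v - b)) ≤ r a).card : ℝ)
      ≤ T1).card : ℝ) ≤ A'.card / 4 := fun b =>
    markov_bound A' (A + A) (fun a v => N (a - (v - b)) ≤ r a) L hL hA' hS
      (fun v _ => hcov (v - b))
  have m2 : ∀ c, ((A'.filter fun a => ¬ (((A * A).filter fun v => N (a - (v / c)) ≤ r a).card : ℝ)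
      ≤ T2).card : ℝ) ≤ A'.card / 4 := fun c =>
    markov_bound A' (A * A) (fun a v => N (a - (v / c)) ≤ r a) L hL hA' hP
      (fun v _ => hcov (v / c))
  let good : k × k → Finset k := fun bc => A'.filter fun a =>
    (((A + A).filter fun v => N (a - (v - bc.1)) ≤ r a).card : ℝ) ≤ T1 ∧
    (((A * A).filter fun v => N (a - (v / bc.2)) ≤ r a).card : ℝ) ≤ T2
  have hgood : ∀ bc, (A'.card : ℝ) / 2 ≤ (good bc).card := by
    intro bc
    have hsub : A' ⊆ good bc ∪
      ((A'.filter fun a => ¬ (((A + A).filter fun v => N (a - (v - bc.1)) ≤ r a).card : ℝ) ≤ T1) ∪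
       (A'.filter fun a => ¬ (((A * A).filter fun v => N (a - (v / bc.2)) ≤ r a).card : ℝ) ≤ T2)) := by
      intro a ha
      simp only [good, Finset.mem_union, Finset.mem_filter]
      tauto
    have h1 := (Finset.card_le_card hsub).trans (Finset.card_union_le _ _)
    have h2 := h1.trans (Nat.add_le_add_left (Finset.card_union_le _ _) _)
    have h3 := (Nat.cast_le (α := ℝ)).2 h2
    push_cast at h3
    have := m1 bc.1
    have := m2 bc.2
    linarith
  let nb : k → Finset k := fun a => A.filter fun a' => a' ≠ a ∧ N (a - a') ≤ r a
  let Q : Finset (Σ _ : k × k, Σ _ : k, k) :=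
    (A ×ˢ (A.erase 0)).sigma fun bc => (good bc).sigma fun a => nb a
  have hQ : (A.card : ℝ) * (A.erase 0).card * (A'.card / 2 * M) ≤ Q.card := by
    have e : (Q.card : ℝ) = ∑ bc ∈ A ×ˢ (A.erase 0), ∑ a ∈ good bc, ((nb a).card : ℝ) := by
      simp [Q, Finset.card_sigma]
    rw [e]
    calc (A.card : ℝ) * (A.erase 0).card * (A'.card / 2 * M)
        = ∑ bc ∈ A ×ˢ (A.erase 0), (A'.card / 2 * M : ℝ) := by
          rw [Finset.sum_const, Finset.card_product, nsmul_eq_mul]; push_cast; ring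
      _ ≤ _ := by
          apply Finset.sum_le_sum
          intro bc _
          calc (A'.card / 2 * M : ℝ) ≤ (good bc).card * M :=
                mul_le_mul_of_nonneg_right (hgood bc) hM
            _ = ∑ a ∈ good bc, M := by simp
            _ ≤ _ := Finset.sum_le_sum fun a ha => hnb a (Finset.mem_filter.1 ha).1
  let D : Finset k → ℝ → Finset (Σ _ : k, k) := fun X T =>
    X.sigma fun s => X.filter fun s' => ((X.filter fun v => N (v - s) ≤ N (s' - s)).card : ℝ) ≤ T
  have hD : ∀ X T, 0 ≤ T → ((D X T).card : ℝ) ≤ X.card * T := by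
    intro X T hT
    have e : ((D X T).card : ℝ) = ∑ s ∈ X, ((X.filter fun s' =>
        ((X.filter fun v => N (v - s) ≤ N (s' - s)).card : ℝ) ≤ T).card : ℝ) := by
      simp [D, Finset.card_sigma]
    rw [e]
    calc _ ≤ ∑ s ∈ X, T := Finset.sum_le_sum fun s _ => rank_bound X (fun v => N (v - s)) T hT
      _ = _ := by simp
  have hsymm : ∀ x y, N (x - y) = N (y - x) := fun x y => by rw [← hneg, neg_sub]
  have hQD : Q.card ≤ (D (A + A) T1 ×ˢ D (A * A) T2).card := by
    apply Finset.card_le_card_of_injOn (fun q =>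
      (⟨q.2.1 + q.1.1, q.2.2 + q.1.1⟩, ⟨q.2.1 * q.1.2, q.2.2 * q.1.2⟩))
    · rintro ⟨⟨b, c⟩, a, a'⟩ hq
      simp only [Q, good, nb, Finset.coe_sigma, Set.mem_sigma_iff, Finset.mem_coe, Finset.mem_product,
        Finset.mem_erase, Finset.mem_filter, Finset.mem_sigma] at hq
      obtain ⟨⟨hb, hc0, hc⟩, ⟨haA', hg1, hg2⟩, ha'A, hne, hN⟩ := hq
      have haA := hA'A haA'
      simp only [D, Finset.mem_coe, Finset.mem_product, Finset.mem_sigma, Finset.mem_filter]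
      refine ⟨⟨Finset.add_mem_add haA hb, Finset.add_mem_add ha'A hb, ?_⟩,
        Finset.mul_mem_mul haA hc, Finset.mul_mem_mul ha'A hc, ?_⟩
      · refine le_trans ?_ hg1
        norm_cast
        apply Finset.card_le_card
        intro v hv
        rw [Finset.mem_filter] at hv ⊢
        refine ⟨hv.1, le_trans ?_ hN⟩
        have := hv.2
        have e : v - (a + b) = -(a - (v - b)) := by ring
        rwa [add_sub_add_right_eq_sub, hsymm a' a, e, hneg] at this
      · refine le_trans ?_ hg2
        norm_cast
        apply Finset.card_le_card
        intro v hv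
        rw [Finset.mem_filter] at hv ⊢
        refine ⟨hv.1, le_trans ?_ hN⟩
        have := hv.2
        rw [← sub_mul, hmul, hsymm a' a, hsymm] at this
        have e : a * c - v = (a - v / c) * c := by field_simp
        rw [e, hmul] at this
        exact le_of_mul_le_mul_right this (hpos c hc0)
    · rintro ⟨⟨b, c⟩, a, a'⟩ hq ⟨⟨b2, c2⟩, a2, a2'⟩ hq2 heq
      simp only [Q, good, nb, Finset.coe_sigma, Set.mem_sigma_iff, Finset.mem_coe, Finset.mem_product,
        Finset.mem_erase, Finset.mem_filter, Finset.mem_sigma] at hq hq2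
      obtain ⟨⟨hb, hc0, hc⟩, ⟨haA', hg1, hg2⟩, ha'A, hne, hN⟩ := hq
      simp only [Prod.mk.injEq, Sigma.mk.injEq, heq_eq_eq] at heq
      obtain ⟨⟨e1, e2⟩, e3, e4⟩ := heq
      have hd : a' - a = a2' - a2 := by linear_combination e2 - e1
      have hcc : c = c2 := by
        have : (a' - a) * c = (a' - a) * c2 := by rw [sub_mul, e3, e4, hd]; ring
        exact mul_left_cancel₀ (sub_ne_zero.2 hne) this
      subst hcc
      have ha := mul_right_cancel₀ hc0 e3
      have ha' := mul_right_cancel₀ hc0 e4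
      subst ha ha'
      have := add_left_cancel e1
      subst this
      rfl
  have h1 : (Q.card : ℝ) ≤ ((A + A).card * T1) * ((A * A).card * T2) := by
    calc (Q.card : ℝ) ≤ ((D (A + A) T1).card : ℝ) * (D (A * A) T2).card := by
          rw [Finset.card_product] at hQD; exact_mod_cast hQD
      _ ≤ _ := mul_le_mul (hD _ _ hT1n) (hD _ _ hT2n) (by positivity) (by positivity)
  have h2 := hQ.trans h1
  rw [hT1, hT2] at h2
  have h3 : ((A + A).card * (4 * L * (A + A).card / A'.card)) *
      ((A * A).card * (4 * L * (A * A).card / A'.card)) =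
      (16 * L ^ 2 * ((A + A).card : ℝ) ^ 2 * ((A * A).card : ℝ) ^ 2) / (A'.card : ℝ) ^ 2 := by
    field_simp; ring
  rw [h3, le_div_iff₀ (by positivity)] at h2
  nlinarith [h2]

lemma final_arith (n n' n0 Z Y l C : ℝ) (j : ℕ) (hn : 0 ≤ n) (hn' : 0 ≤ n') (hn0 : 0 ≤ n0)
    (hZ : 0 ≤ Z) (hY : 0 ≤ Y) (hl : 0 ≤ l)
    (main : n' ^ 3 * n * n0 * (2 ^ j / 2) ≤ 32 * (2 ^ (j + 1)) ^ 2 * Z ^ 2 * Y ^ 2)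
    (h1 : n ≤ 2 * l * n') (h2 : n ≤ 2 * n0) (hC : 2 ^ j ≤ C) :
    n ^ 5 ≤ 4096 * C * (Z ^ 2 * Y ^ 2 * l ^ 3) := by
  have hp : (0:ℝ) < 2 ^ j := by positivity
  have main2 : n' ^ 3 * n * n0 ≤ 256 * 2 ^ j * (Z ^ 2 * Y ^ 2) := by
    refine le_of_mul_le_mul_right ?_ (half_pos hp)
    calc _ ≤ _ := main
      _ = _ := by ring
  calc n ^ 5 = n ^ 3 * n * n := by ring
    _ ≤ (2 * l * n') ^ 3 * n * (2 * n0) := by gcongr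
    _ = 16 * l ^ 3 * (n' ^ 3 * n * n0) := by ring
    _ ≤ 16 * l ^ 3 * (256 * 2 ^ j * (Z ^ 2 * Y ^ 2)) := by gcongr
    _ = 4096 * 2 ^ j * (Z ^ 2 * Y ^ 2 * l ^ 3) := by ring
    _ ≤ 4096 * C * (Z ^ 2 * Y ^ 2 * l ^ 3) := by gcongr

set_option maxHeartbeats 1000000 in
lemma core {k : Type*} [Field k] [DecidableEq k] (N : k → ℝ) 
    (hmul : ∀ x y, N (x * y) = N x * N y) (hneg : ∀ x, N (-x) = N x) (h0 : N 0 = 0)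
    (hpos : ∀ x, x ≠ 0 → 0 < N x) (hult : ∀ x y, N (x + y) ≤ max (N x) (N y))
    (A : Finset k) (hA : 2 ≤ A.card) (r : k → ℝ)
    (hr : ∀ a ∈ A, ∃ a' ∈ A, a' ≠ a ∧ N (a - a') ≤ r a) :
    ∃ C ⊆ A, (∀ c ∈ C, ∀ c' ∈ C, r c ≤ r c' → ∀ y, N (c - y) ≤ r c → N (c' - y) ≤ r c') ∧
      (A.card : ℝ) ^ 5 ≤ 4096 * C.card * (((A + A).card : ℝ) ^ 2 * ((A * A).card : ℝ) ^ 2 *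
        Real.logb 2 A.card ^ 3) := by
  classical
  have hnn : ∀ x, 0 ≤ N x := fun x => by
    by_cases h : x = 0
    · rw [h, h0]
    · exact (hpos x h).le
  have hr0 : ∀ a ∈ A, 0 ≤ r a := fun a ha => by
    obtain ⟨a', _, _, h⟩ := hr a ha
    exact (hnn _).trans h
  have htri : ∀ x y z, N (x - z) ≤ max (N (x - y)) (N (y - z)) := fun x y z => by
    have := hult (x - y) (y - z); rwa [sub_add_sub_cancel] at this
  have hsymm : ∀ x y, N (x - y) = N (y - x) := fun x y => by rw [← hneg, neg_sub]
  let IsCh : Finset k → Prop := fun C =>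
    ∀ c ∈ C, ∀ c' ∈ C, r c ≤ r c' → ∀ y, N (c - y) ≤ r c → N (c' - y) ≤ r c'
  -- chains with top element `a`
  let Ch : k → Finset (Finset k) := fun a =>
    A.powerset.filter fun C => IsCh C ∧ a ∈ C ∧ ∀ c ∈ C, N (a - c) ≤ r a
  have hChne : ∀ a ∈ A, {a} ∈ Ch a := by
    intro a ha
    simp only [Ch, IsCh, Finset.mem_filter, Finset.mem_powerset, Finset.singleton_subset_iff,
      Finset.mem_singleton]
    refine ⟨ha, ?_, trivial, ?_⟩
    · rintro c rfl c' rfl _ y hy; exact hy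
    · rintro c rfl; rw [sub_self, h0]; exact hr0 _ ha
  let h : k → ℕ := fun a => (Ch a).sup Finset.card
  have hh1 : ∀ a ∈ A, 1 ≤ h a := fun a ha => by
    have := Finset.le_sup (f := Finset.card) (hChne a ha)
    rwa [Finset.card_singleton] at this
  have hhex : ∀ a ∈ A, ∃ C ∈ Ch a, h a = C.card := fun a ha =>
    Finset.exists_mem_eq_sup (Ch a) ⟨_, hChne a ha⟩ Finset.card
  have hhA : ∀ a ∈ A, h a ≤ A.card := fun a ha => by
    obtain ⟨C, hC, e⟩ := hhex a ha
    rw [e]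
    exact Finset.card_le_card (Finset.mem_powerset.1 (Finset.mem_filter.1 hC).1)
  -- pigeonhole
  have hmaps : ∀ a ∈ A, Nat.log 2 (h a) ∈ Finset.range (Nat.log 2 A.card + 1) := fun a ha =>
    Finset.mem_range.2 (Nat.lt_succ_of_le (Nat.log_mono_right (hhA a ha)))
  obtain ⟨j, hj, hjc⟩ : ∃ j ∈ Finset.range (Nat.log 2 A.card + 1),
      A.card ≤ (Nat.log 2 A.card + 1) * (A.filter fun a => Nat.log 2 (h a) = j).card := by
    by_contra hcon
    push Not at hcon
    have e := Finset.card_eq_sum_card_fiberwise hmaps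
    have l := Finset.sum_lt_sum_of_nonempty (s := Finset.range (Nat.log 2 A.card + 1)) (by simp) hcon
    rw [← Finset.mul_sum, ← e] at l
    simp at l
  set A' := A.filter fun a => Nat.log 2 (h a) = j with hA'def
  have hA'A : A' ⊆ A := Finset.filter_subset _ _
  have hA'ne : A'.Nonempty := by
    rw [← Finset.card_pos]
    rcases Nat.eq_zero_or_pos A'.card with h | h
    · rw [h] at hjc; omega
    · exact h
  have hlo : ∀ a ∈ A', 2 ^ j ≤ h a := fun a ha => by
    have := (Finset.mem_filter.1 ha).2
    rw [← this]
    exact Nat.pow_log_le_self 2 (by have := hh1 a (hA'A ha); omega)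
  have hhi : ∀ a ∈ A', h a ≤ 2 ^ (j+1) := fun a ha => by
    have := (Finset.mem_filter.1 ha).2
    rw [← this]
    exact (Nat.lt_pow_succ_log_self (by norm_num) _).le
  have hcov : ∀ x, ((A'.filter fun a => N (a - x) ≤ r a).card : ℝ) ≤ 2 ^ (j+1) := by
    intro x
    rcases (A'.filter fun a => N (a - x) ≤ r a).eq_empty_or_nonempty with he | he
    · rw [he]; simp
    · obtain ⟨a, ha, hmax⟩ := Finset.exists_max_image _ r he
      have ha2 := Finset.mem_filter.1 ha
      have : (A'.filter fun a => N (a - x) ≤ r a) ∈ Ch a := by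
        simp only [Ch, IsCh]
        rw [Finset.mem_filter, Finset.mem_powerset]
        refine ⟨(Finset.filter_subset _ _).trans hA'A, ?_, ha, ?_⟩
        · intro c hc c' hc' hle y hy
          have hc := (Finset.mem_filter.1 hc).2
          have hc' := (Finset.mem_filter.1 hc').2
          refine (htri c' x y).trans (max_le hc' ?_)
          refine (htri x c y).trans (max_le ?_ (hy.trans hle))
          rw [hsymm]; exact hc.trans hle
        · intro c hc
          refine (htri a x c).trans (max_le ha2.2 ?_)
          rw [hsymm]
          exact (Finset.mem_filter.1 hc).2.trans (hmax c hc)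
      have h2 := (Finset.le_sup (f := Finset.card) this).trans (hhi a ha2.1)
      exact_mod_cast h2
  have hnb : ∀ a ∈ A', (2:ℝ) ^ j / 2 ≤
      ((A.filter fun a' => a' ≠ a ∧ N (a - a') ≤ r a).card : ℝ) := by
    intro a ha
    obtain ⟨C, hC, e⟩ := hhex a (hA'A ha)
    simp only [Ch] at hC
    rw [Finset.mem_filter, Finset.mem_powerset] at hC
    obtain ⟨hCA, _, haC, hCr⟩ := hC
    obtain ⟨a', ha'A, hne, hN⟩ := hr a (hA'A ha)
    have one : 1 ≤ (A.filter fun a' => a' ≠ a ∧ N (a - a') ≤ r a).card :=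
      Finset.card_pos.2 ⟨a', Finset.mem_filter.2 ⟨ha'A, hne, hN⟩⟩
    have two : C.card - 1 ≤ (A.filter fun a' => a' ≠ a ∧ N (a - a') ≤ r a).card := by
      rw [← Finset.card_erase_of_mem haC]
      apply Finset.card_le_card
      intro c hc
      rw [Finset.mem_erase] at hc
      exact Finset.mem_filter.2 ⟨hCA hc.2, hc.1, hCr c hc.2⟩
    have three := hlo a ha
    have four : 2 ^ j ≤ 2 * (A.filter fun a' => a' ≠ a ∧ N (a - a') ≤ r a).card := by omega
    have five : (2:ℝ) ^ j ≤ 2 * ((A.filter fun a' => a' ≠ a ∧ N (a - a') ≤ r a).card : ℝ) := by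
      exact_mod_cast four
    linarith
  have hA0c : A.card ≤ 2 * (A.erase 0).card := by
    have := Finset.pred_card_le_card_erase (s := A) (a := 0)
    omega
  have hA0 : (A.erase 0).Nonempty := by
    rw [← Finset.card_pos]; omega
  have main := count_bound N hmul hnn hneg hpos A A' hA'A r (2^(j+1)) (2^j/2) (by positivity)
    hA'ne hA0 hcov hnb (by positivity)
  obtain ⟨a, ha⟩ := hA'ne
  obtain ⟨C, hC, e⟩ := hhex a (hA'A ha)
  have hCj : 2 ^ j ≤ C.card := e ▸ hlo a ha
  simp only [Ch] at hC
  rw [Finset.mem_filter, Finset.mem_powerset] at hC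
  refine ⟨C, hC.1, hC.2.1, ?_⟩
  set l := Real.logb 2 A.card
  have hl1 : 1 ≤ l := by
    rw [Real.le_logb_iff_rpow_le (by norm_num) (by positivity)]
    simpa using (by exact_mod_cast hA : (2:ℝ) ≤ A.card)
  have hl2 : ((Nat.log 2 A.card : ℕ) : ℝ) ≤ l := by
    have := Real.natLog_le_logb A.card 2
    exact_mod_cast this
  have hjc' : (A.card : ℝ) ≤ 2 * l * A'.card := by
    have : (A.card : ℝ) ≤ ((Nat.log 2 A.card : ℕ) + 1 : ℝ) * A'.card := by exact_mod_cast hjc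
    refine this.trans (mul_le_mul_of_nonneg_right (by linarith) (by positivity))
  have hA0r : (A.card : ℝ) ≤ 2 * (A.erase 0).card := by exact_mod_cast hA0c
  have hCr : (2:ℝ) ^ j ≤ C.card := by exact_mod_cast hCj
  exact final_arith _ _ _ _ _ _ _ j (by positivity) (by positivity) (by positivity)
    (by positivity) (by positivity) (by linarith) main hjc' hA0r hCr

lemma ffNorm_zero {F : Type*} [Field F] [Fintype F] : ffNorm (0 : RatFunc F) = 0 := by
  simp [ffNorm]

lemma ffNorm_pos {F : Type*} [Field F] [Fintype F] (x : RatFunc F) (hx : x ≠ 0) :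
    0 < ffNorm x := by
  rw [ffNorm, if_neg hx]
  have : (0:ℝ) < Fintype.card F := by exact_mod_cast Fintype.card_pos
  positivity

lemma ffNorm_nonneg {F : Type*} [Field F] [Fintype F] (x : RatFunc F) : 0 ≤ ffNorm x := by
  by_cases h : x = 0
  · rw [h, ffNorm_zero]
  · exact (ffNorm_pos x h).le

lemma ffNorm_neg {F : Type*} [Field F] [Fintype F] (x : RatFunc F) :
    ffNorm (-x) = ffNorm x := by
  by_cases hx : x = 0
  · rw [hx, neg_zero]
  · have hx' : -x ≠ 0 := neg_ne_zero.2 hx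
    rw [ffNorm, ffNorm, if_neg hx, if_neg hx', RatFunc.intDegree_neg]

lemma ffNorm_mul {F : Type*} [Field F] [Fintype F] (x y : RatFunc F) :
    ffNorm (x * y) = ffNorm x * ffNorm y := by
  by_cases hx : x = 0
  · simp [hx, ffNorm_zero]
  by_cases hy : y = 0
  · simp [hy, ffNorm_zero]
  have h0 : (Fintype.card F : ℝ) ≠ 0 := by exact_mod_cast Fintype.card_ne_zero
  rw [ffNorm, ffNorm, ffNorm, if_neg hx, if_neg hy, if_neg (mul_ne_zero hx hy),
    RatFunc.intDegree_mul hx hy, zpow_add₀ h0]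

lemma ffNorm_add {F : Type*} [Field F] [Fintype F] (x y : RatFunc F) :
    ffNorm (x + y) ≤ max (ffNorm x) (ffNorm y) := by
  by_cases hx : x = 0
  · simp [hx]
  by_cases hy : y = 0
  · simp [hy]
  by_cases hxy : x + y = 0
  · rw [hxy, ffNorm_zero]; exact (ffNorm_nonneg x).trans (le_max_left _ _)
  have h1 : (1:ℝ) ≤ Fintype.card F := by exact_mod_cast Fintype.card_pos
  have := RatFunc.intDegree_add_le hy hxy
  rw [ffNorm, ffNorm, ffNorm, if_neg hx, if_neg hy, if_neg hxy]
  rcases le_max_iff.1 this with h | h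
  · exact le_max_of_le_left (zpow_le_zpow_right₀ h1 h)
  · exact le_max_of_le_right (zpow_le_zpow_right₀ h1 h)

lemma chain_of {F : Type*} [Field F] [Fintype F] (A : Set (RatFunc F)) (C : Finset (RatFunc F))
    (hCA : (C : Set (RatFunc F)) ⊆ A)
    (h : ∀ c ∈ C, ∀ c' ∈ C, rA A c ≤ rA A c' → BA A c ⊆ BA A c') : IsAChain A (C : Set _) := by
  classical
  let e := C.equivFin.symm
  let f : Fin C.card → ℝ := fun i => rA A (e i)
  let σ := Tuple.sort f
  refine ⟨hCA, C.card, fun i => (e (σ i) : RatFunc F), ?_, ?_, ?_⟩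
  · intro i j hij
    exact σ.injective (e.injective (Subtype.ext hij))
  · ext x
    constructor
    · intro hx
      exact ⟨σ.symm (e.symm ⟨x, hx⟩), by simp⟩
    · rintro ⟨i, rfl⟩
      exact (e (σ i)).2
  · intro i j hij
    exact h _ (e (σ i)).2 _ (e (σ j)).2 (Tuple.monotone_sort f hij)

theorem stmt18 :
    ∃ c : ℝ, 0 < c ∧
      ∀ (F : Type) [Field F] [Fintype F],
        ∀ A : Set (RatFunc F), A.Finite → 2 ≤ A.ncard →
          ∃ C : Set (RatFunc F), IsAChain A C ∧
            c * (A.ncard : ℝ) ^ 5 /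
                (((A + A).ncard : ℝ) ^ 2 * ((A * A).ncard : ℝ) ^ 2 *
                  Real.logb 2 (A.ncard : ℝ) ^ 3) ≤
              (C.ncard : ℝ) := by
  classical
  refine ⟨1 / 4096, by norm_num, ?_⟩
  intro F _ _ A hfin hcard
  lift A to Finset (RatFunc F) using hfin
  rw [Set.ncard_coe_finset] at hcard
  have hr : ∀ a ∈ A, ∃ a' ∈ A, a' ≠ a ∧ ffNorm (a - a') ≤ rA (A : Set (RatFunc F)) a := by
    intro a ha
    have hne : {r : ℝ | ∃ a' ∈ (A : Set (RatFunc F)), a' ≠ a ∧ r = ffNorm (a - a')}.Nonempty := by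
      obtain ⟨b, hb, hba⟩ := Finset.exists_mem_ne (by omega : 1 < A.card) a
      exact ⟨_, b, hb, hba, rfl⟩
    have hf : {r : ℝ | ∃ a' ∈ (A : Set (RatFunc F)), a' ≠ a ∧ r = ffNorm (a - a')}.Finite := by
      refine (A.finite_toSet.image fun a' => ffNorm (a - a')).subset ?_
      rintro r ⟨a', h, _, rfl⟩
      exact ⟨a', h, rfl⟩
    obtain ⟨a', h1, h2, h3⟩ := hne.csInf_mem hf
    exact ⟨a', h1, h2, h3.ge⟩
  obtain ⟨C, hCA, hC, hb⟩ := core ffNorm ffNorm_mul ffNorm_neg ffNorm_zero ffNorm_pos ffNorm_add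
    A hcard (rA (A : Set (RatFunc F))) hr
  refine ⟨C, chain_of _ C (by exact_mod_cast hCA) (fun c hc c' hc' hle y hy =>
    hC c hc c' hc' hle y hy), ?_⟩
  rw [← Finset.coe_add, ← Finset.coe_mul]
  simp only [Set.ncard_coe_finset]
  have hl : 0 ≤ Real.logb 2 (A.card : ℝ) :=
    Real.logb_nonneg (by norm_num) (by exact_mod_cast (by omega : 1 ≤ A.card))
  apply div_le_of_le_mul₀ (by positivity) (by positivity)
  linarith
end
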